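/- arXiv:2407.04546 — 2 statements merged into one kernel-verified Lean document; each statement's English description precedes it below -/
import Mathlib

section
/- There exist a smooth odd function f : ℝ → ℝ and a bounded smooth function u : [0,∞) × ℝ → ℝ such that: −Δu = f(u) in (0,∞) × ℝ; u = 0 on {0} × ℝ; ∇u is bounded on [0,∞) × ℝ; ∇u(x) ≠ 0 for every x ∈ [0,∞) × ℝ; and u is not one-dimensional, i.e. there do not exist a unit vector e ∈ ℝ² and a function g : ℝ → ℝ with u(x) = g(x·e) for all x ∈ [0,∞) × ℝ. -/
open MeasureTheory

/-- Partial derivative of `u : ℝ² → ℝ` in the first coordinate. -/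
noncomputable def pd1 (u : ℝ × ℝ → ℝ) (p : ℝ × ℝ) : ℝ := fderiv ℝ u p (1, 0)

/-- Partial derivative of `u : ℝ² → ℝ` in the second coordinate. -/
noncomputable def pd2 (u : ℝ × ℝ → ℝ) (p : ℝ × ℝ) : ℝ := fderiv ℝ u p (0, 1)

/-- Laplacian of `u : ℝ² → ℝ`. -/
noncomputable def lap2 (u : ℝ × ℝ → ℝ) (p : ℝ × ℝ) : ℝ :=
  fderiv ℝ (pd1 u) p (1, 0) + fderiv ℝ (pd2 u) p (0, 1)

/-- Gradient of `u : ℝ² → ℝ`. -/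
noncomputable def grad2 (u : ℝ × ℝ → ℝ) (p : ℝ × ℝ) : ℝ × ℝ := (pd1 u p, pd2 u p)

/-- Cosine series `∑ aₖ cos (k x)` with coefficients in `V` and `∑ 2ᵏ ‖aₖ‖ < ∞`; the stored
sequence is `2ᵏ aₖ`. -/
def CosSeries (V : Type*) [NormedCommRing V] : Type _ := lp (fun _ : ℕ => V) 1

namespace CosSeries

noncomputable section

variable {V : Type*} [NormedCommRing V]

instance : NormedAddCommGroup (CosSeries V) :=
  inferInstanceAs (NormedAddCommGroup (lp (fun _ : ℕ => V) 1))

variable [NormedAlgebra ℝ V]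

instance : NormedSpace ℝ (CosSeries V) :=
  inferInstanceAs (NormedSpace ℝ (lp (fun _ : ℕ => V) 1))

instance [CompleteSpace V] : CompleteSpace (CosSeries V) :=
  inferInstanceAs (CompleteSpace (lp (fun _ : ℕ => V) 1))

/-- The element `v cos (k x)`. -/
def e (k : ℕ) : V →L[ℝ] CosSeries V :=
  (2 : ℝ) ^ k • lp.singleContinuousLinearMap ℝ (fun _ : ℕ => V) 1 k

/-- The coefficient of `cos (k x)`. -/
def coef (k : ℕ) : CosSeries V →L[ℝ] V :=
  ((2 : ℝ) ^ k)⁻¹ • lp.evalCLM (𝕜 := ℝ) (fun _ : ℕ => V) (p := 1) k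

lemma norm_e (k : ℕ) (v : V) : ‖e k v‖ = 2 ^ k * ‖v‖ := by
  have h : e k v = (2 : ℝ) ^ k • (lp.single (E := fun _ : ℕ => V) 1 k v) := rfl
  rw [h]
  have := lp.norm_single (E := fun _ : ℕ => V) (p := 1) one_pos k v
  exact (norm_smul ((2:ℝ)^k) (lp.single (E := fun _ : ℕ => V) 1 k v)).trans (by
    rw [this]; simp)

lemma coef_apply (k : ℕ) (a : CosSeries V) :
    coef k a = ((2 : ℝ) ^ k)⁻¹ • (show lp (fun _ : ℕ => V) 1 from a) k := rfl

lemma coef_e (k j : ℕ) (v : V) : coef k (e j v) = if k = j then v else 0 := by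
  have h : e j v = (2 : ℝ) ^ j • (lp.single (E := fun _ : ℕ => V) 1 j v) := rfl
  rw [coef_apply]
  have h2 : (show lp (fun _ : ℕ => V) 1 from e j v) k = (2:ℝ)^j • (Pi.single j v : ℕ → V) k := by
    rw [h]; rfl
  rw [h2]
  split_ifs with hk
  · subst hk; rw [Pi.single_eq_same, smul_smul, inv_mul_cancel₀ (by positivity), one_smul]
  · rw [Pi.single_eq_of_ne hk]; simp

lemma hasSum_norm (a : CosSeries V) : HasSum (fun k => 2 ^ k * ‖coef k a‖) ‖a‖ := by
  have := lp.hasSum_norm (E := fun _ : ℕ => V) (p := 1) (by simp) a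
  simp only [ENNReal.toReal_one, Real.rpow_one] at this
  refine Eq.mp ?_ this
  congr 1
  funext k
  rw [coef_apply, norm_smul, norm_inv, norm_pow, Real.norm_ofNat, ← mul_assoc,
    mul_inv_cancel₀ (by positivity), one_mul]

lemma norm_coef_apply_le (k : ℕ) (a : CosSeries V) : ‖coef k a‖ ≤ (2 ^ k)⁻¹ * ‖a‖ := by
  have h := le_hasSum (hasSum_norm a) k fun j _ => by positivity
  rw [inv_mul_eq_div, le_div_iff₀ (by positivity)]
  linarith

lemma hasSum_e (a : CosSeries V) : HasSum (fun k => e k (coef k a)) a := by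
  refine Eq.mp ?_ (lp.hasSum_single (E := fun _ : ℕ => V) (p := 1) (by simp) a)
  refine congrArg (fun f => HasSum (α := CosSeries V) f a) (funext fun k => ?_)
  rw [coef_apply, map_smul]
  change _ = ((2 : ℝ) ^ k)⁻¹ • (2 : ℝ) ^ k • (lp.single (E := fun _ : ℕ => V) 1 k _)
  exact ((smul_smul _ _ (lp.single (E := fun _ : ℕ => V) 1 k _)).trans (by
    rw [inv_mul_cancel₀ (by positivity)]; exact one_smul ℝ _)).symm

lemma ext_coef {a b : CosSeries V} (h : ∀ k, coef k a = coef k b) : a = b := by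
  refine (hasSum_e a).unique ?_
  simp_rw [h]
  exact hasSum_e b

variable {W : Type*} [NormedAddCommGroup W] [NormedSpace ℝ W]

lemma clm_ext {F G : CosSeries V →L[ℝ] W} (h : ∀ k v, F (e k v) = G (e k v)) : F = G := by
  ext a
  have h1 := (hasSum_e a).mapL F
  have h2 := (hasSum_e a).mapL G
  simp_rw [h] at h1
  exact h1.unique h2

section lift
variable [CompleteSpace W]

/-- The continuous linear map determined by its values on the elements `v cos (k x)`. -/
def lift (F : ℕ → V →L[ℝ] W) (C : ℝ) (hF : ∀ k v, ‖F k v‖ ≤ C * 2 ^ k * ‖v‖) :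
    CosSeries V →L[ℝ] W :=
  have key (a : CosSeries V) : HasSum (fun k => C * (2 ^ k * ‖coef k a‖)) (C * ‖a‖) :=
    (hasSum_norm a).mul_left C
  have bd (a : CosSeries V) (k : ℕ) : ‖F k (coef k a)‖ ≤ C * (2 ^ k * ‖coef k a‖) := by
    rw [← mul_assoc]; exact hF k _
  have sm (a : CosSeries V) : Summable fun k => F k (coef k a) :=
    .of_norm_bounded (key a).summable (bd a)
  LinearMap.mkContinuous
    { toFun := fun a => ∑' k, F k (coef k a)
      map_add' := fun a b => by
        simp only [map_add]; exact (sm a).tsum_add (sm b)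
      map_smul' := fun c a => by
        simp only [map_smul, RingHom.id_apply]; exact (sm a).tsum_const_smul c }
    C fun a => tsum_of_norm_bounded (key a) (bd a)

lemma lift_e (F : ℕ → V →L[ℝ] W) (C : ℝ) (hF) (k : ℕ) (v : V) :
    lift F C hF (e k v) = F k v := by
  change ∑' j, F j (coef j (e k v)) = _
  rw [tsum_eq_single k]
  · rw [coef_e, if_pos rfl]
  · intro j hj; rw [coef_e, if_neg hj, map_zero]

lemma norm_lift_le (F : ℕ → V →L[ℝ] W) (C : ℝ) (hF) (a : CosSeries V) :
    ‖lift F C hF a‖ ≤ C * ‖a‖ := by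
  refine tsum_of_norm_bounded ((hasSum_norm a).mul_left C) fun k => ?_
  rw [← mul_assoc]; exact hF k _

end lift

/-- The product of `v cos (j x)` and `w cos (k x)`. -/
def mulAux (j k : ℕ) (v : V) : V →L[ℝ] CosSeries V :=
  (2⁻¹ : ℝ) • ((e (j + k) + e ((j - k : ℤ).natAbs)) ∘L ContinuousLinearMap.mul ℝ V v)

lemma norm_mulAux_le (j k : ℕ) (v w : V) :
    ‖mulAux j k v w‖ ≤ (2 ^ j * ‖v‖) * 2 ^ k * ‖w‖ := by
  have h1 : ‖e (j + k) (v * w)‖ ≤ 2 ^ j * 2 ^ k * (‖v‖ * ‖w‖) := by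
    rw [norm_e, pow_add]; gcongr; exact norm_mul_le _ _
  have h2 : ‖e ((j - k : ℤ).natAbs) (v * w)‖ ≤ 2 ^ j * 2 ^ k * (‖v‖ * ‖w‖) := by
    rw [norm_e, ← pow_add]
    gcongr
    · norm_num
    · omega
    · exact norm_mul_le _ _
  change ‖(2⁻¹ : ℝ) • (e (j + k) (v * w) + e ((j - k : ℤ).natAbs) (v * w))‖ ≤ _
  rw [norm_smul]
  have := norm_add_le (e (j + k) (v * w)) (e ((j - k : ℤ).natAbs) (v * w))
  norm_num
  nlinarith

lemma mulAux_add (j k : ℕ) (v v' w : V) :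
    mulAux j k (v + v') w = mulAux j k v w + mulAux j k v' w := by
  change (2⁻¹ : ℝ) • (e (j + k) ((v + v') * w) + e ((j - k : ℤ).natAbs) ((v + v') * w)) =
    (2⁻¹ : ℝ) • (e (j + k) (v * w) + e ((j - k : ℤ).natAbs) (v * w)) +
    (2⁻¹ : ℝ) • (e (j + k) (v' * w) + e ((j - k : ℤ).natAbs) (v' * w))
  rw [add_mul, map_add, map_add]
  module

lemma mulAux_smul (j k : ℕ) (c : ℝ) (v w : V) :
    mulAux j k (c • v) w = c • mulAux j k v w := by
  change (2⁻¹ : ℝ) • (e (j + k) ((c • v) * w) + e ((j - k : ℤ).natAbs) ((c • v) * w)) =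
    c • (2⁻¹ : ℝ) • (e (j + k) (v * w) + e ((j - k : ℤ).natAbs) (v * w))
  rw [smul_mul_assoc, map_smul, map_smul]
  module

instance : One (CosSeries V) := ⟨e 0 1⟩

lemma one_def : (1 : CosSeries V) = e 0 1 := rfl

variable [CompleteSpace V]

/-- Multiplication by `v cos (j x)`. -/
def mulE (j : ℕ) : V →L[ℝ] CosSeries V →L[ℝ] CosSeries V :=
  LinearMap.mkContinuous
    { toFun := fun v => lift (fun k => mulAux j k v) (2 ^ j * ‖v‖)
        fun k w => norm_mulAux_le j k v w
      map_add' := fun v v' => clm_ext fun k w => by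
        rw [add_apply, lift_e, lift_e, lift_e, mulAux_add]
      map_smul' := fun c v => clm_ext fun k w => by
        rw [RingHom.id_apply, smul_apply, lift_e, lift_e, mulAux_smul] } (2 ^ j)
      fun v => ContinuousLinearMap.opNorm_le_bound _ (by positivity) fun a =>
        norm_lift_le (fun k => mulAux j k v) _ (fun k w => norm_mulAux_le j k v w) a

lemma norm_mulE_le (j : ℕ) (v : V) : ‖mulE j v‖ ≤ 1 * 2 ^ j * ‖v‖ := by
  rw [one_mul]
  exact ContinuousLinearMap.opNorm_le_bound _ (by positivity) fun a =>
    norm_lift_le (fun k => mulAux j k v) _ (fun k w => norm_mulAux_le j k v w) a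

/-- Multiplication as a continuous bilinear map. -/
def mulL : CosSeries V →L[ℝ] CosSeries V →L[ℝ] CosSeries V := lift mulE 1 norm_mulE_le

instance : Mul (CosSeries V) := ⟨fun a b => mulL a b⟩

lemma mul_def (a b : CosSeries V) : a * b = mulL a b := rfl

lemma e_mul_e (j k : ℕ) (v w : V) : e j v * e k w =
    (2⁻¹ : ℝ) • (e (j + k) (v * w) + e ((j - k : ℤ).natAbs) (v * w)) := by
  rw [mul_def, mulL, lift_e]
  exact lift_e (fun k => mulAux j k v) (2 ^ j * ‖v‖) (fun k w => norm_mulAux_le j k v w) k w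

lemma mulL_norm_le (a b : CosSeries V) : ‖mulL a b‖ ≤ ‖a‖ * ‖b‖ := by
  have h : ‖mulL a‖ ≤ 1 * ‖a‖ := by rw [mulL]; exact norm_lift_le _ _ _ a
  refine ((mulL a).le_opNorm b).trans ?_
  gcongr; linarith

attribute [irreducible] mulL lift e coef

/-- Integer frequencies, with `cos (-z x) = cos (z x)`. -/
def eZ (z : ℤ) : V →L[ℝ] CosSeries V := e z.natAbs

lemma eZ_mul_eZ (z w : ℤ) (v v' : V) : eZ z v * eZ w v' =
    (2⁻¹ : ℝ) • (eZ (z + w) (v * v') + eZ (z - w) (v * v')) := by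
  unfold eZ
  rw [e_mul_e]
  rcases le_total 0 z with hz | hz <;> rcases le_total 0 w with hw | hw
  · congr 4 <;> omega
  · rw [add_comm (e _ _)]; congr 4 <;> omega
  · rw [add_comm (e _ _)]; congr 4 <;> omega
  · congr 4 <;> omega

lemma mul_comm' (a b : CosSeries V) : mulL a b = mulL b a := by
  have : (mulL : CosSeries V →L[ℝ] _) = mulL.flip := clm_ext fun j v => clm_ext fun k w => by
    change e j v * e k w = e k w * e j v
    rw [e_mul_e, e_mul_e, mul_comm v w, add_comm j k]
    congr 4
    omega
  exact congrArg (fun F => F a b) this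

lemma e_mul_assoc (j k l : ℕ) (u v w : V) :
    (e j u * e k v) * e l w = e j u * (e k v * e l w) := by
  have add_mul' (a b c : CosSeries V) : (a + b) * c = a * c + b * c := by
    rw [mul_def, map_add]; rfl
  have smul_mul' (r : ℝ) (a c : CosSeries V) : (r • a) * c = r • (a * c) := by
    rw [mul_def, map_smul]; rfl
  have mul_add' (a b c : CosSeries V) : a * (b + c) = a * b + a * c := map_add (mulL a) b c
  have mul_smul' (r : ℝ) (a c : CosSeries V) : a * (r • c) = r • (a * c) := map_smul (mulL a) r c
  change (eZ j u * eZ k v) * eZ l w = eZ j u * (eZ k v * eZ l w)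
  rw [eZ_mul_eZ, eZ_mul_eZ, smul_mul', mul_smul', add_mul', mul_add']
  simp only [eZ_mul_eZ]
  rw [mul_assoc, show (j:ℤ) + k + l = j + (k + l) by ring,
    show (j:ℤ) + k - l = j + (k - l) by ring, show (j:ℤ) - k + l = j - (k - l) by ring,
    show (j:ℤ) - k - l = j - (k + l) by ring]
  module

lemma mul_assoc' (a b c : CosSeries V) : a * b * c = a * (b * c) := by
  have h2 (j k) (u v : V) (c) : mulL (mulL (e j u) (e k v)) c = mulL (e j u) (mulL (e k v) c) :=
    DFunLike.congr_fun (clm_ext (F := mulL (mulL (e j u) (e k v)))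
      (G := mulL (e j u) ∘L mulL (e k v)) fun l w => e_mul_assoc j k l u v w) c
  have h3 (j) (u : V) (b c) : mulL (mulL (e j u) b) c = mulL (e j u) (mulL b c) :=
    DFunLike.congr_fun (clm_ext (F := mulL.flip c ∘L (mulL (e j u)))
      (G := mulL (e j u) ∘L mulL.flip c) fun k v => h2 j k u v c) b
  exact DFunLike.congr_fun (clm_ext (F := mulL.flip c ∘L (mulL.flip b))
      (G := mulL.flip (mulL b c)) fun k v => h3 k v b c) a

lemma one_mul' (a : CosSeries V) : mulL (e 0 1) a = a := by
  refine congrArg (fun F => F a) (clm_ext (F := mulL (e 0 (1:V)))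
      (G := ContinuousLinearMap.id ℝ _) fun k v => ?_)
  change e 0 1 * e k v = e k v
  rw [e_mul_e, one_mul, zero_add]
  simp only [Nat.cast_zero, zero_sub, Int.natAbs_neg, Int.natAbs_natCast]
  module

instance : NormedCommRing (CosSeries V) where
  __ := (inferInstance : NormedAddCommGroup (CosSeries V))
  mul := (· * ·)
  one := 1
  left_distrib a b c := map_add (mulL a) b c
  right_distrib a b c := by
    change mulL (a + b) c = mulL a c + mulL b c
    rw [map_add]; rfl
  zero_mul a := by
    change mulL 0 a = 0
    rw [map_zero]; rfl
  mul_zero a := map_zero (mulL a)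
  mul_assoc := mul_assoc'
  one_mul := one_mul'
  mul_one a := (mul_comm' a _).trans (one_mul' a)
  mul_comm := mul_comm'
  norm_mul_le := mulL_norm_le

instance : NormedAlgebra ℝ (CosSeries V) where
  __ := (inferInstance : NormedSpace ℝ (CosSeries V))
  __ := Algebra.ofModule (R := ℝ) (A := CosSeries V)
    (fun r a b => by change mulL (r • a) b = r • mulL a b; rw [map_smul]; rfl)
    (fun r a b => map_smul (mulL a) r b)

end
end CosSeries

namespace CosSeries
noncomputable section
variable {V : Type*} [NormedCommRing V] [NormedAlgebra ℝ V]

section diag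

/-- The operator acting on the coefficient of `cos (k x)` by `L k`. -/
def diag [CompleteSpace V] (L : ℕ → V →L[ℝ] V) (C : ℝ) (hL : ∀ k v, ‖L k v‖ ≤ C * ‖v‖) :
    CosSeries V →L[ℝ] CosSeries V :=
  lift (fun k => e k ∘L L k) C fun k v => by
    rw [ContinuousLinearMap.comp_apply, norm_e]
    have := mul_le_mul_of_nonneg_left (hL k v) (pow_nonneg zero_le_two k : (0:ℝ) ≤ 2 ^ k)
    linarith

variable [CompleteSpace V] (L : ℕ → V →L[ℝ] V) (C : ℝ) (hL : ∀ k v, ‖L k v‖ ≤ C * ‖v‖)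

lemma diag_e (k : ℕ) (v : V) : diag L C hL (e k v) = e k (L k v) := lift_e _ _ _ _ _

lemma coef_diag (k : ℕ) (a : CosSeries V) : coef k (diag L C hL a) = L k (coef k a) := by
  refine DFunLike.congr_fun (clm_ext (F := coef k ∘L diag L C hL) (G := L k ∘L coef k)
    fun j v => ?_) a
  simp only [ContinuousLinearMap.comp_apply, diag_e, coef_e]
  split_ifs with h
  · rw [h]
  · rw [map_zero]

lemma norm_diag_le (a : CosSeries V) : ‖diag L C hL a‖ ≤ C * ‖a‖ := norm_lift_le _ _ _ a

/-- A continuous linear map is multiplicative if it is so on the generators. -/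
lemma map_mul_of_e {W : Type*} [NormedCommRing W] [NormedAlgebra ℝ W]
    (F : CosSeries V →L[ℝ] W)
    (h : ∀ j k v w, F (e j v * e k w) = F (e j v) * F (e k w)) (a b : CosSeries V) :
    F (a * b) = F a * F b := by
  have : F ∘L (ContinuousLinearMap.mul ℝ (CosSeries V) a) =
      ContinuousLinearMap.mul ℝ W (F a) ∘L F := by
    refine clm_ext fun k w => ?_
    have h2 : F ∘L ((ContinuousLinearMap.mul ℝ (CosSeries V)).flip (e k w)) =
        (ContinuousLinearMap.mul ℝ W).flip (F (e k w)) ∘L F := clm_ext fun j v => h j k v w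
    exact DFunLike.congr_fun h2 a
  exact DFunLike.congr_fun this b

lemma diag_mul (h1 : ∀ j k v w, L (j + k) (v * w) = L j v * L k w)
    (h2 : ∀ j k : ℕ, ∀ v w, L ((j - k : ℤ).natAbs) (v * w) = L j v * L k w)
    (a b : CosSeries V) : diag L C hL (a * b) = diag L C hL a * diag L C hL b := by
  refine map_mul_of_e (V := V) (W := CosSeries V) (diag L C hL) (fun j k v w => ?_) a b
  rw [e_mul_e, map_smul, map_add, diag_e, diag_e, diag_e, diag_e, e_mul_e, h1, h2]

end diag

section ring
variable [CompleteSpace V]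

lemma e_zero_mul_e (k : ℕ) (v w : V) : e 0 v * e k w = e k (v * w) := by
  rw [e_mul_e]
  simp only [Nat.cast_zero, zero_sub, Int.natAbs_neg, Int.natAbs_natCast, zero_add]
  module

lemma coef_e_zero_mul (k : ℕ) (v : V) (a : CosSeries V) :
    coef k (e 0 v * a) = v * coef k a := by
  refine DFunLike.congr_fun (clm_ext (V := V)
    (F := coef (V := V) k ∘L ContinuousLinearMap.mul ℝ (CosSeries V) (e 0 v))
    (G := ContinuousLinearMap.mul ℝ V v ∘L coef (V := V) k) fun j w => ?_) a
  change coef k (e 0 v * e j w) = v * coef k (e j w)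
  rw [e_zero_mul_e, coef_e, coef_e]
  split_ifs <;> simp

lemma e_pow_three (v : V) : (e 1 v) ^ 3 = (3/4 : ℝ) • e 1 (v ^ 3) + (1/4 : ℝ) • e 3 (v ^ 3) := by
  rw [pow_succ, pow_two, e_mul_e, smul_mul_assoc, add_mul, e_mul_e, e_mul_e,
    show v * v * v = v ^ 3 by ring]
  norm_num
  module

lemma e_pow_five (v : V) : (e 1 v) ^ 5 =
    (10/16 : ℝ) • e 1 (v ^ 5) + (5/16 : ℝ) • e 3 (v ^ 5) + (1/16 : ℝ) • e 5 (v ^ 5) := by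
  rw [show 5 = 3 + 2 from rfl, pow_add, e_pow_three, pow_two, e_mul_e, add_mul]
  simp only [smul_mul_assoc, mul_smul_comm, mul_add, e_mul_e]
  norm_num
  rw [show v ^ 3 * (v * v) = v ^ 5 by ring]
  module

/-- The reflection `cos (k x) ↦ cos (k (x + π))`. -/
def refl : CosSeries V →L[ℝ] CosSeries V :=
  diag (fun k => ((-1 : ℝ) ^ k) • ContinuousLinearMap.id ℝ V) 1 fun k v => by
    simp [norm_smul]

lemma refl_mul (a b : CosSeries V) : refl (a * b) = refl a * refl b := by
  refine diag_mul _ _ _ (fun j k v w => ?_) (fun j k v w => ?_) a b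
  · simp [pow_add, smul_smul, mul_comm]
  · have : (-1 : ℝ) ^ ((j - k : ℤ).natAbs) = (-1) ^ j * (-1) ^ k := by
      rw [← pow_add]
      apply neg_one_pow_congr
      rw [Int.natAbs_even, Int.even_sub, Nat.even_add]; simp
    simp [this, smul_smul, mul_comm]

/-- Only odd frequencies occur. -/
def IsOdd (a : CosSeries V) : Prop := refl a = -a

lemma IsOdd.coef_eq_zero {a : CosSeries V} (h : IsOdd a) {k : ℕ} (hk : Even k) :
    coef k a = 0 := by
  have := congrArg (coef k) h
  rw [refl, coef_diag, map_neg] at this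
  simp only [hk.neg_one_pow, one_smul, ContinuousLinearMap.id_apply] at this
  have h2 : (2 : ℝ) • coef k a = 0 := by rw [two_smul]; nth_rw 1 [this]; simp
  simpa using h2

lemma isOdd_of_coef {a : CosSeries V} (h : ∀ k, Even k → coef k a = 0) : IsOdd a := by
  refine ext_coef fun k => ?_
  rw [refl, coef_diag, map_neg]
  rcases Nat.even_or_odd k with hk | hk
  · rw [h k hk]; simp
  · simp [hk.neg_one_pow]

lemma IsOdd.add {a b : CosSeries V} (ha : IsOdd a) (hb : IsOdd b) : IsOdd (a + b) := by
  rw [IsOdd, map_add, ha, hb]; abel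

lemma IsOdd.smul {a : CosSeries V} (c : ℝ) (ha : IsOdd a) : IsOdd (c • a) := by
  rw [IsOdd, map_smul, ha, smul_neg]

lemma IsOdd.pow {a : CosSeries V} (ha : IsOdd a) {n : ℕ} (hn : Odd n) : IsOdd (a ^ n) := by
  have h : ∀ m : ℕ, refl (a ^ (m + 1)) = (-a) ^ (m + 1) := fun m => by
    induction m with
    | zero => rw [zero_add, pow_one, pow_one]; exact ha
    | succ m ih => rw [pow_succ, refl_mul, ih, ha, pow_succ (-a) (m + 1)]
  obtain ⟨m, rfl⟩ := hn
  rw [IsOdd, h, Odd.neg_pow ⟨m, rfl⟩]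

end ring

section eval
variable [CompleteSpace V]

lemma norm_coef_le (k : ℕ) : ‖(coef k : CosSeries V →L[ℝ] V)‖ ≤ (2 ^ k)⁻¹ :=
  ContinuousLinearMap.opNorm_le_bound _ (by positivity) (norm_coef_apply_le k)

/-- Summation of the cosine series at the point `x`. -/
def evalAt (x : ℝ) : CosSeries V →L[ℝ] V := ∑' k : ℕ, Real.cos (k * x) • coef k

lemma summable_evalAt (x : ℝ) :
    Summable fun k : ℕ => Real.cos (k * x) • (coef k : CosSeries V →L[ℝ] V) := by
  refine .of_norm_bounded (g := fun k : ℕ => (2⁻¹ : ℝ) ^ k)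
    (summable_geometric_of_lt_one (by norm_num) (by norm_num)) fun k => ?_
  rw [norm_smul, inv_pow]
  have := norm_coef_le (V := V) k
  have h2 : ‖Real.cos (k * x)‖ ≤ 1 := Real.abs_cos_le_one _
  nlinarith [norm_nonneg (coef k : CosSeries V →L[ℝ] V)]

lemma hasSum_evalAt (x : ℝ) (a : CosSeries V) :
    HasSum (fun k : ℕ => Real.cos (k * x) • coef k a) (evalAt x a) :=
  (summable_evalAt x).hasSum.mapL (ContinuousLinearMap.apply ℝ V a)

lemma evalAt_e (x : ℝ) (k : ℕ) (v : V) : evalAt x (e k v) = Real.cos (k * x) • v := by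
  refine (hasSum_evalAt x (e k v)).unique ?_
  simp only [coef_e]
  convert hasSum_ite_eq k (Real.cos (k * x) • v) using 2 with j
  split_ifs with h
  · rw [h]
  · rw [smul_zero]

lemma norm_evalAt_apply_le (x : ℝ) (a : CosSeries V) : ‖evalAt x a‖ ≤ ‖a‖ := by
  rw [← (hasSum_evalAt x a).tsum_eq]
  refine tsum_of_norm_bounded (hasSum_norm a) fun k => ?_
  rw [norm_smul]
  exact mul_le_mul_of_nonneg_right ((Real.abs_cos_le_one _).trans (one_le_pow₀ one_le_two))
    (norm_nonneg _)

lemma contDiff_evalAt : ContDiff ℝ (⊤ : ℕ∞) (evalAt : ℝ → CosSeries V →L[ℝ] V) := by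
  change ContDiff ℝ (⊤ : ℕ∞) fun x : ℝ =>
    ∑' k : ℕ, Real.cos (k * x) • (coef k : CosSeries V →L[ℝ] V)
  refine contDiff_tsum (𝕜 := ℝ) (α := ℕ) (N := ⊤) (E := ℝ) (F := CosSeries V →L[ℝ] V) (v := fun m k => (k : ℝ) ^ m * (2⁻¹) ^ k) (fun k => ?_) (fun m _ => ?_)
    fun m k x _ => ?_
  · fun_prop
  · exact summable_pow_mul_geometric_of_norm_lt_one m (by norm_num)
  · rw [norm_iteratedFDeriv_eq_norm_iteratedDeriv,
      iteratedDeriv_smul_const (by fun_prop), norm_smul, inv_pow]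
    have h1 := norm_coef_le (V := V) k
    have h2 : ‖iteratedDeriv m (fun x => Real.cos (k * x)) x‖ ≤ (k : ℝ) ^ m := by
      rw [iteratedDeriv_comp_const_mul Real.contDiff_cos]
      have := Real.abs_iteratedDeriv_cos_le_one m (k * x)
      rw [norm_mul, norm_pow, Real.norm_natCast, Real.norm_eq_abs]
      exact mul_le_of_le_one_right (by positivity) this
    gcongr

lemma evalAt_mul (x : ℝ) (a b : CosSeries V) : evalAt x (a * b) = evalAt x a * evalAt x b := by
  refine map_mul_of_e _ (fun j k v w => ?_) a b
  have hc : Real.cos (((j - k : ℤ).natAbs : ℝ) * x) = Real.cos (j * x - k * x) := by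
    rw [Nat.cast_natAbs, Int.cast_abs, ← Real.cos_abs (j * x - k * x), ← sub_mul, abs_mul,
      ← Real.cos_abs (_ * x), abs_mul, abs_abs]
    simp
  rw [e_mul_e, map_smul, map_add, evalAt_e, evalAt_e, evalAt_e, evalAt_e, hc,
    smul_mul_smul_comm]
  push_cast
  rw [add_mul, Real.cos_add, Real.cos_sub]
  module

lemma evalAt_one (x : ℝ) : evalAt x (1 : CosSeries V) = 1 := by
  rw [one_def, evalAt_e]; simp

lemma evalAt_pow (x : ℝ) (a : CosSeries V) (n : ℕ) : evalAt x (a ^ n) = evalAt x a ^ n := by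
  induction n with
  | zero => rw [pow_zero, pow_zero, evalAt_one]
  | succ n ih => rw [pow_succ, pow_succ, evalAt_mul, ih]

lemma abs_cos_natCast_mul_le (x : ℝ) {k : ℕ} (hk : Odd k) :
    |Real.cos (k * x)| ≤ k * |Real.cos x| := by
  obtain ⟨m, rfl⟩ := hk
  induction m with
  | zero => simp
  | succ m ih =>
    have h : Real.cos ((2 * (m + 1) + 1 : ℕ) * x) =
        2 * Real.cos x * Real.cos ((2 * m + 2) * x) - Real.cos ((2 * m + 1 : ℕ) * x) := by
      have := Real.cos_add_cos ((2 * (m + 1) + 1 : ℕ) * x) ((2 * m + 1 : ℕ) * x)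
      push_cast at this ⊢
      rw [show ((2 * ((m:ℝ) + 1) + 1) * x + (2 * m + 1) * x) / 2 = (2 * m + 2) * x by ring,
        show ((2 * ((m:ℝ) + 1) + 1) * x - (2 * m + 1) * x) / 2 = x by ring] at this
      linarith
    rw [h]
    refine (abs_sub _ _).trans ?_
    rw [abs_mul, abs_mul, abs_two]
    have h2 := Real.abs_cos_le_one ((2 * m + 2) * x)
    have h3 := abs_nonneg (Real.cos x)
    push_cast at ih ⊢
    nlinarith [mul_le_mul_of_nonneg_left h2 h3]

lemma norm_evalAt_le_of_isOdd (x : ℝ) {a : CosSeries V} (ha : IsOdd a) :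
    ‖evalAt x a‖ ≤ ‖a‖ * |Real.cos x| := by
  rw [← (hasSum_evalAt x a).tsum_eq]
  refine tsum_of_norm_bounded ((hasSum_norm a).mul_right _) fun k => ?_
  rcases Nat.even_or_odd k with hk | hk
  · rw [ha.coef_eq_zero hk]; simp
  · rw [norm_smul, Real.norm_eq_abs]
    have h1 : (k : ℝ) ≤ 2 ^ k := by exact_mod_cast Nat.lt_two_pow_self.le
    calc _ ≤ (k * |Real.cos x|) * ‖coef k a‖ := by gcongr; exact abs_cos_natCast_mul_le x hk
      _ ≤ (2 ^ k * |Real.cos x|) * ‖coef k a‖ := by gcongr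
      _ = _ := by ring

end eval

end
end CosSeries

/-- Bounded continuous functions on the line. -/
abbrev BC := BoundedContinuousFunction ℝ ℝ

namespace BC

noncomputable section

/-- A bounded operator on `BC` from pointwise data. -/
def mkOp (F : BC → ℝ → ℝ) (C : ℝ) (hadd : ∀ f g y, F (f + g) y = F f y + F g y)
    (hsmul : ∀ (c : ℝ) f y, F (c • f) y = c * F f y) (hcont : ∀ f, Continuous (F f))
    (hbd : ∀ f y, |F f y| ≤ C * ‖f‖) : BC →L[ℝ] BC :=
  LinearMap.mkContinuous
    { toFun := fun f => BoundedContinuousFunction.ofNormedAddCommGroup (F f) (hcont f) (C * ‖f‖)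
        (hbd f)
      map_add' := fun f g => by ext y; exact hadd f g y
      map_smul' := fun c f => by ext y; exact hsmul c f y } C fun f => by
    exact (BoundedContinuousFunction.norm_le ((abs_nonneg _).trans (hbd f 0))).2 (hbd f)

lemma norm_mkOp_apply_le (F C hadd hsmul hcont hbd) (f : BC) :
    ‖mkOp F C hadd hsmul hcont hbd f‖ ≤ C * ‖f‖ :=
  (BoundedContinuousFunction.norm_le ((abs_nonneg _).trans (hbd f 0))).2 (hbd f)

lemma abs_le_norm (f : BC) (y : ℝ) : |f y| ≤ ‖f‖ := f.norm_coe_le_norm y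

/-- Translation by `s`. -/
def shift (s : ℝ) : BC →L[ℝ] BC :=
  mkOp (fun f y => f (y + s)) 1 (fun _ _ _ => rfl) (fun _ _ _ => rfl)
    (fun f => f.continuous.comp (by fun_prop)) fun f y => by rw [one_mul]; exact abs_le_norm f _

@[simp] lemma shift_apply (s : ℝ) (f : BC) (y : ℝ) : shift s f y = f (y + s) := rfl

/-- Reflection. -/
def reflect : BC →L[ℝ] BC :=
  mkOp (fun f y => f (-y)) 1 (fun _ _ _ => rfl) (fun _ _ _ => rfl)
    (fun f => f.continuous.comp (by fun_prop)) fun f y => by rw [one_mul]; exact abs_le_norm f _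

@[simp] lemma reflect_apply (f : BC) (y : ℝ) : reflect f y = f (-y) := rfl

lemma norm_reflect_le (f : BC) : ‖reflect f‖ ≤ ‖f‖ :=
  (norm_mkOp_apply_le _ _ _ _ _ _ f).trans (one_mul _).le

lemma norm_shift_le (s : ℝ) (f : BC) : ‖shift s f‖ ≤ ‖f‖ :=
  (norm_mkOp_apply_le _ _ _ _ _ _ f).trans (one_mul _).le

lemma shift_reflect (s : ℝ) (f : BC) : shift s (reflect f) = reflect (shift (-s) f) := by
  ext y; simp [add_comm]

end

end BC

lemma hasDerivAt_integral_Iic {g : ℝ → ℝ} (hg : Continuous g)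
    (hi : ∀ y, IntegrableOn g (Set.Iic y)) (y : ℝ) :
    HasDerivAt (fun y => ∫ t in Set.Iic y, g t) (g y) y := by
  have h : (fun y => ∫ t in Set.Iic y, g t) =
      fun y => (∫ t in Set.Iic 0, g t) + ∫ t in (0:ℝ)..y, g t := by
    funext y
    rw [← intervalIntegral.integral_Iic_sub_Iic (hi 0) (hi y)]; ring
  rw [h]
  exact (intervalIntegral.integral_hasDerivAt_right (hg.intervalIntegrable _ _)
    (hg.stronglyMeasurableAtFilter _ _) hg.continuousAt).const_add _

lemma setIntegral_Ioi_comp_sub_left (f : ℝ → ℝ) (y : ℝ) :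
    ∫ t in Set.Ioi 0, f (y - t) = ∫ s in Set.Iic y, f s := by
  rw [integral_Iic_eq_integral_Iio, ← integral_indicator measurableSet_Ioi,
    ← integral_indicator measurableSet_Iio, ← integral_sub_left_eq_self _ volume y]
  congr 1
  ext t
  simp [Set.indicator]

namespace BC

noncomputable section

lemma integrable_exp_mul {κ : ℝ} (hκ : 0 < κ) (f : BC) (y : ℝ) :
    IntegrableOn (fun t => Real.exp (-κ * t) * f (y - t)) (Set.Ioi 0) :=
  (integrableOn_exp_mul_Ioi (neg_lt_zero.2 hκ) 0).mul_bdd (c := ‖f‖)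
    (f.continuous.comp (by fun_prop)).aestronglyMeasurable (.of_forall fun t => abs_le_norm f _)

lemma abs_integral_exp_mul_le {κ : ℝ} (hκ : 0 < κ) (f : BC) (y : ℝ) :
    |∫ t in Set.Ioi 0, Real.exp (-κ * t) * f (y - t)| ≤ κ⁻¹ * ‖f‖ := by
  have h1 : ∫ t in Set.Ioi (0:ℝ), Real.exp (-κ * t) * ‖f‖ = κ⁻¹ * ‖f‖ := by
    rw [integral_mul_const, integral_exp_mul_Ioi (neg_lt_zero.2 hκ)]
    simp [div_eq_mul_inv]
  rw [← h1, ← Real.norm_eq_abs]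
  refine norm_integral_le_of_norm_le
    ((integrableOn_exp_mul_Ioi (neg_lt_zero.2 hκ) 0).mul_const _) (.of_forall fun t => ?_)
  rw [norm_mul, Real.norm_eq_abs, Real.abs_exp]
  exact mul_le_mul_of_nonneg_left (abs_le_norm f _) (Real.exp_pos _).le

lemma hasDerivAt_integral_exp_mul {κ : ℝ} (hκ : 0 < κ) (f : BC) (y : ℝ) :
    HasDerivAt (fun y => ∫ t in Set.Ioi 0, Real.exp (-κ * t) * f (y - t))
      (f y - κ * ∫ t in Set.Ioi 0, Real.exp (-κ * t) * f (y - t)) y := by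
  have h : (fun y => ∫ t in Set.Ioi 0, Real.exp (-κ * t) * f (y - t)) =
      fun y => Real.exp (-κ * y) * ∫ s in Set.Iic y, Real.exp (κ * s) * f s := by
    funext y
    rw [← setIntegral_Ioi_comp_sub_left, ← integral_const_mul]
    congr 1
    funext t
    rw [← mul_assoc, ← Real.exp_add]
    ring_nf
  have hd := hasDerivAt_integral_Iic (g := fun s => Real.exp (κ * s) * f s) (by fun_prop)
    (fun y => (integrableOn_exp_mul_Iic hκ y).mul_bdd (c := ‖f‖)
      f.continuous.aestronglyMeasurable (.of_forall fun t => abs_le_norm f _)) y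
  have he : HasDerivAt (fun y => Real.exp (-κ * y)) (Real.exp (-κ * y) * (-κ)) y := by
    simpa using ((hasDerivAt_id y).const_mul (-κ)).exp
  have hh := congrFun h y
  rw [h]
  refine (he.mul hd).congr_deriv ?_
  rw [hh]
  have : Real.exp (-κ * y) * (Real.exp (κ * y) * f y) = f y := by
    rw [← mul_assoc, ← Real.exp_add]; simp
  rw [this]; ring

/-- `∫₀^∞ exp (-κ t) f (y - t) dt`. -/
def past (κ : ℝ) (hκ : 0 < κ) : BC →L[ℝ] BC :=
  mkOp (fun f y => ∫ t in Set.Ioi 0, Real.exp (-κ * t) * f (y - t)) κ⁻¹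
    (fun f g y => by
      rw [← integral_add (integrable_exp_mul hκ f y) (integrable_exp_mul hκ g y)]
      simp [mul_add])
    (fun c f y => by
      rw [← integral_const_mul]; simp [mul_left_comm])
    (fun f => continuous_iff_continuousAt.2 fun y =>
      (hasDerivAt_integral_exp_mul hκ f y).continuousAt)
    fun f y => abs_integral_exp_mul_le hκ f y

lemma hasDerivAt_past {κ : ℝ} (hκ : 0 < κ) (f : BC) (y : ℝ) :
    HasDerivAt (past κ hκ f) (f y - κ * past κ hκ f y) y :=
  hasDerivAt_integral_exp_mul hκ f y

lemma norm_past_le {κ : ℝ} (hκ : 0 < κ) (f : BC) : ‖past κ hκ f‖ ≤ κ⁻¹ * ‖f‖ :=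
  norm_mkOp_apply_le _ _ _ _ _ _ f

lemma past_shift {κ : ℝ} (hκ : 0 < κ) (s : ℝ) (f : BC) :
    past κ hκ (shift s f) = shift s (past κ hκ f) := by
  ext y
  change ∫ t in Set.Ioi 0, Real.exp (-κ * t) * f (y - t + s) =
    ∫ t in Set.Ioi 0, Real.exp (-κ * t) * f (y + s - t)
  simp only [sub_add_eq_add_sub]

/-- `∫₀^∞ exp (-κ t) f (y + t) dt`. -/
def future (κ : ℝ) (hκ : 0 < κ) : BC →L[ℝ] BC := reflect ∘L past κ hκ ∘L reflect

lemma hasDerivAt_future {κ : ℝ} (hκ : 0 < κ) (f : BC) (y : ℝ) :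
    HasDerivAt (future κ hκ f) (κ * future κ hκ f y - f y) y := by
  have := (hasDerivAt_past hκ (reflect f) (-y)).comp y (hasDerivAt_neg y)
  refine this.congr_deriv ?_
  change _ = κ * past κ hκ (reflect f) (-y) - f y
  rw [reflect_apply, neg_neg]; ring

lemma norm_future_le {κ : ℝ} (hκ : 0 < κ) (f : BC) : ‖future κ hκ f‖ ≤ κ⁻¹ * ‖f‖ := by
  refine (norm_reflect_le _).trans ((norm_past_le hκ _).trans ?_)
  exact mul_le_mul_of_nonneg_left (norm_reflect_le f) (by positivity)

lemma future_shift {κ : ℝ} (hκ : 0 < κ) (s : ℝ) (f : BC) :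
    future κ hκ (shift s f) = shift s (future κ hκ f) := by
  have h : reflect (shift s f) = shift (-s) (reflect f) := by rw [shift_reflect, neg_neg]
  simp only [future, ContinuousLinearMap.comp_apply]
  rw [h, past_shift, shift_reflect]

/-- The bounded solution operator of `-w'' + κ² w = f`. -/
def green (κ : ℝ) (hκ : 0 < κ) : BC →L[ℝ] BC := (2 * κ)⁻¹ • (past κ hκ + future κ hκ)

/-- The derivative of `green`. -/
def greenDeriv (κ : ℝ) (hκ : 0 < κ) : BC →L[ℝ] BC := (2⁻¹ : ℝ) • (future κ hκ - past κ hκ)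

lemma green_apply {κ : ℝ} (hκ : 0 < κ) (f : BC) (y : ℝ) :
    green κ hκ f y = (2 * κ)⁻¹ * (past κ hκ f y + future κ hκ f y) := rfl

lemma greenDeriv_apply {κ : ℝ} (hκ : 0 < κ) (f : BC) (y : ℝ) :
    greenDeriv κ hκ f y = 2⁻¹ * (future κ hκ f y - past κ hκ f y) := rfl

lemma hasDerivAt_green {κ : ℝ} (hκ : 0 < κ) (f : BC) (y : ℝ) :
    HasDerivAt (green κ hκ f) (greenDeriv κ hκ f y) y := by
  refine (((hasDerivAt_past hκ f y).add (hasDerivAt_future hκ f y)).const_mul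
    (2 * κ)⁻¹).congr_deriv ?_
  rw [greenDeriv_apply]
  field_simp
  ring

lemma hasDerivAt_greenDeriv {κ : ℝ} (hκ : 0 < κ) (f : BC) (y : ℝ) :
    HasDerivAt (greenDeriv κ hκ f) (κ ^ 2 * green κ hκ f y - f y) y := by
  refine (((hasDerivAt_future hκ f y).sub (hasDerivAt_past hκ f y)).const_mul
    2⁻¹).congr_deriv ?_
  rw [green_apply]
  field_simp
  ring

lemma norm_green_le {κ : ℝ} (hκ : 0 < κ) (f : BC) : ‖green κ hκ f‖ ≤ (κ ^ 2)⁻¹ * ‖f‖ := by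
  change ‖(2 * κ)⁻¹ • (past κ hκ f + future κ hκ f)‖ ≤ _
  rw [norm_smul, Real.norm_of_nonneg (by positivity)]
  calc _ ≤ (2 * κ)⁻¹ * (κ⁻¹ * ‖f‖ + κ⁻¹ * ‖f‖) := by
        gcongr
        exact (norm_add_le _ _).trans (add_le_add (norm_past_le hκ f) (norm_future_le hκ f))
    _ = _ := by field_simp; ring

lemma norm_greenDeriv_le {κ : ℝ} (hκ : 0 < κ) (f : BC) :
    ‖greenDeriv κ hκ f‖ ≤ κ⁻¹ * ‖f‖ := by
  change ‖(2⁻¹ : ℝ) • (future κ hκ f - past κ hκ f)‖ ≤ _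
  rw [norm_smul, Real.norm_of_nonneg (by positivity)]
  calc _ ≤ (2⁻¹ : ℝ) * (κ⁻¹ * ‖f‖ + κ⁻¹ * ‖f‖) := by
        gcongr
        exact (norm_sub_le _ _).trans (add_le_add (norm_future_le hκ f) (norm_past_le hκ f))
    _ = _ := by ring

lemma green_shift {κ : ℝ} (hκ : 0 < κ) (s : ℝ) (f : BC) :
    green κ hκ (shift s f) = shift s (green κ hκ f) := by
  change (2 * κ)⁻¹ • (past κ hκ (shift s f) + future κ hκ (shift s f)) = _
  rw [past_shift, future_shift]; rfl

end

end BC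

noncomputable section

/-- The heteroclinic profile solving `A' = A (1 - A²)`. -/
def prof (y : ℝ) : ℝ := (√(1 + Real.exp (-2 * y)))⁻¹

/-- The derivative of `prof`. -/
def profD (y : ℝ) : ℝ := prof y * (1 - prof y ^ 2)

lemma prof_sq (y : ℝ) : prof y ^ 2 = (1 + Real.exp (-2 * y))⁻¹ := by
  rw [prof, inv_pow, Real.sq_sqrt (by positivity)]

lemma prof_pos (y : ℝ) : 0 < prof y := by unfold prof; positivity

lemma prof_lt_one (y : ℝ) : prof y < 1 := by
  have h := prof_sq y
  have : (1 + Real.exp (-2 * y))⁻¹ < 1 := inv_lt_one_of_one_lt₀ (by linarith [Real.exp_pos (-2 * y)])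
  nlinarith [prof_pos y]

lemma one_sub_prof_sq (y : ℝ) : 1 - prof y ^ 2 = Real.exp (-2 * y) * prof y ^ 2 := by
  rw [prof_sq]
  have : 1 + Real.exp (-2 * y) ≠ 0 := by positivity
  field_simp
  ring

lemma profD_pos (y : ℝ) : 0 < profD y :=
  mul_pos (prof_pos y) (by nlinarith [prof_pos y, prof_lt_one y])

lemma profD_lt_one (y : ℝ) : profD y < 1 := by
  have := prof_pos y
  have := prof_lt_one y
  unfold profD
  nlinarith [sq_nonneg (prof y)]

lemma hasDerivAt_prof (y : ℝ) : HasDerivAt prof (profD y) y := by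
  have h1 : HasDerivAt (fun y : ℝ => 1 + Real.exp (-2 * y)) (Real.exp (-2 * y) * (-2)) y := by
    simpa using (((hasDerivAt_id y).const_mul (-2)).exp).const_add 1
  have h2 := ((h1.sqrt (by positivity)).inv (by positivity))
  refine h2.congr_deriv ?_
  have h3 : 1 - prof y ^ 2 = Real.exp (-2 * y) * ((√(1 + Real.exp (-2 * y))) ^ 2)⁻¹ := by
    rw [one_sub_prof_sq, prof, inv_pow]
  rw [profD, h3, prof]
  have : √(1 + Real.exp (-2 * y)) ≠ 0 := by positivity
  field_simp

lemma hasDerivAt_profD (y : ℝ) : HasDerivAt profD (profD y * (1 - 3 * prof y ^ 2)) y := by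
  have h := hasDerivAt_prof y
  refine (h.mul ((h.pow 2).const_sub 1)).congr_deriv ?_
  rw [profD]; simp; ring

lemma continuous_prof : Continuous prof :=
  continuous_iff_continuousAt.2 fun y => (hasDerivAt_prof y).continuousAt

lemma continuous_profD : Continuous profD :=
  continuous_iff_continuousAt.2 fun y => (hasDerivAt_profD y).continuousAt

lemma strictMono_prof : StrictMono prof :=
  strictMono_of_hasDerivAt_pos hasDerivAt_prof profD_pos

lemma tendsto_prof_atTop : Filter.Tendsto prof Filter.atTop (nhds 1) := by
  have h : Filter.Tendsto (fun y : ℝ => Real.exp (-2 * y)) Filter.atTop (nhds 0) :=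
    Real.tendsto_exp_atBot.comp (Filter.tendsto_id.const_mul_atTop_of_neg (by norm_num))
  have h2 : Filter.Tendsto (fun y : ℝ => (√(1 + Real.exp (-2 * y)))⁻¹) Filter.atTop
      (nhds (√(1 + 0))⁻¹) := ((h.const_add 1).sqrt).inv₀ (by simp)
  rw [add_zero, Real.sqrt_one, inv_one] at h2
  exact h2

lemma prof_le_exp (y : ℝ) : prof y ≤ Real.exp y := by
  have h : prof y ^ 2 ≤ Real.exp y ^ 2 := by
    rw [prof_sq]
    have : Real.exp y ^ 2 = (Real.exp (-2 * y))⁻¹ := by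
      rw [← Real.exp_neg, ← Real.exp_nat_mul]; congr 1; push_cast; ring
    rw [this]
    exact inv_anti₀ (Real.exp_pos _) (by linarith)
  exact le_of_sq_le_sq h (Real.exp_pos y).le

lemma tendsto_prof_atBot : Filter.Tendsto prof Filter.atBot (nhds 0) :=
  squeeze_zero (fun y => (prof_pos y).le) prof_le_exp Real.tendsto_exp_atBot

lemma integrable_profD : Integrable profD := by
  rw [← integrableOn_univ, ← Set.Iic_union_Ioi (a := (0:ℝ))]
  refine IntegrableOn.union ?_ ?_
  · refine (integrableOn_exp_Iic 0).mono' continuous_profD.aestronglyMeasurable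
      (.of_forall fun y => ?_)
    rw [Real.norm_of_nonneg (profD_pos y).le]
    refine le_trans ?_ (prof_le_exp y)
    unfold profD
    nlinarith [prof_pos y, sq_nonneg (prof y)]
  · refine (integrableOn_exp_mul_Ioi (show (-2:ℝ) < 0 by norm_num) 0).mono'
      continuous_profD.aestronglyMeasurable (.of_forall fun y => ?_)
    rw [Real.norm_of_nonneg (profD_pos y).le, profD, one_sub_prof_sq]
    have := prof_pos y
    have := prof_lt_one y
    have h3 : prof y * prof y ^ 2 ≤ 1 := by nlinarith [sq_nonneg (prof y)]
    nlinarith [Real.exp_pos (-2 * y)]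

lemma integral_Iic_profD (s : ℝ) : ∫ t in Set.Iic s, profD t = prof s := by
  rw [integral_Iic_of_hasDerivAt_of_tendsto' (fun y _ => hasDerivAt_prof y)
    integrable_profD.integrableOn tendsto_prof_atBot, sub_zero]

lemma integral_profD : ∫ t, profD t = 1 := by
  rw [integral_of_hasDerivAt_of_tendsto hasDerivAt_prof integrable_profD tendsto_prof_atBot
    tendsto_prof_atTop, sub_zero]

lemma integral_Ioi_profD (s : ℝ) : ∫ t in Set.Ioi s, profD t = 1 - prof s := by
  rw [integral_Ioi_of_hasDerivAt_of_tendsto' (fun y _ => hasDerivAt_prof y)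
    integrable_profD.integrableOn tendsto_prof_atTop]

namespace BC

/-- `prof` as a bounded continuous function. -/
def profC : BC := BoundedContinuousFunction.ofNormedAddCommGroup prof continuous_prof 1 fun y => by
  rw [Real.norm_of_nonneg (prof_pos y).le]; exact (prof_lt_one y).le

@[simp] lemma profC_apply (y : ℝ) : profC y = prof y := rfl

lemma norm_profC_le : ‖profC‖ ≤ 1 :=
  (BoundedContinuousFunction.norm_le zero_le_one).2 fun y => by
    rw [profC_apply, Real.norm_of_nonneg (prof_pos y).le]; exact (prof_lt_one y).le

lemma integrable_profD_mul (f : BC) : Integrable fun y => profD y * f y :=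
  integrable_profD.mul_bdd (c := ‖f‖) f.continuous.aestronglyMeasurable
    (.of_forall (abs_le_norm f))

lemma abs_setIntegral_profD_mul_le (f : BC) (S : Set ℝ) :
    |∫ y in S, profD y * f y| ≤ ‖f‖ * ∫ y in S, profD y := by
  rw [← integral_const_mul, ← Real.norm_eq_abs]
  refine norm_integral_le_of_norm_le (integrable_profD.integrableOn.const_mul _)
    (.of_forall fun t => ?_)
  rw [norm_mul, Real.norm_of_nonneg (profD_pos t).le, mul_comm]
  exact mul_le_mul_of_nonneg_right (abs_le_norm f t) (profD_pos t).le

/-- Pairing with the kernel element `profD`. -/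
def pairing : BC →L[ℝ] ℝ :=
  LinearMap.mkContinuous
    { toFun := fun f => ∫ y, profD y * f y
      map_add' := fun f g => by
        rw [← integral_add (integrable_profD_mul f) (integrable_profD_mul g)]
        simp [mul_add]
      map_smul' := fun c f => by
        simp only [BoundedContinuousFunction.coe_smul, smul_eq_mul, RingHom.id_apply]
        rw [← integral_const_mul]; simp [mul_left_comm] } 1 fun f => by
    have := abs_setIntegral_profD_mul_le f Set.univ
    rw [Measure.restrict_univ, integral_profD, mul_comm] at this
    exact this

lemma pairing_apply (f : BC) : pairing f = ∫ y, profD y * f y := rfl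

lemma abs_pairing_le (f : BC) : |pairing f| ≤ ‖f‖ :=
  (LinearMap.mkContinuous_norm_le _ zero_le_one _ |> fun h =>
    (pairing.le_of_opNorm_le h f)).trans (one_mul _).le

lemma pairing_profC_pow : pairing (profC ^ 3) = 1 / 4 := by
  rw [pairing_apply]
  have hi := integrable_profD_mul (profC ^ 3)
  have hd : ∀ y, HasDerivAt (fun y => prof y ^ 4 / 4) (profD y * (profC ^ 3 : BC) y) y := fun y => by
    refine (((hasDerivAt_prof y).pow 4).div_const 4).congr_deriv ?_
    simp; ring
  rw [integral_of_hasDerivAt_of_tendsto hd hi ((tendsto_prof_atBot.pow 4).div_const 4)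
    ((tendsto_prof_atTop.pow 4).div_const 4)]
  norm_num

/-- Removal of the solvability obstruction. -/
def solvable : BC →L[ℝ] BC :=
  (4 : ℝ) • (pairing.smulRight (profC ^ 3)) - ContinuousLinearMap.id ℝ BC

lemma solvable_apply (R : BC) : solvable R = (4 * pairing R) • profC ^ 3 - R := by
  simp [solvable, mul_smul]

lemma pairing_solvable (R : BC) : pairing (solvable R) = 0 := by
  rw [solvable_apply, map_sub, map_smul, pairing_profC_pow, smul_eq_mul]; ring

lemma norm_solvable_le (R : BC) : ‖solvable R‖ ≤ 5 * ‖R‖ := by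
  rw [solvable_apply]
  have h1 : ‖profC ^ 3‖ ≤ 1 :=
    (norm_pow_le _ 3).trans (pow_le_one₀ (norm_nonneg _) norm_profC_le)
  have h2 : ‖(4 * pairing R) • profC ^ 3‖ ≤ 4 * ‖R‖ := by
    rw [norm_smul, norm_mul]
    have := abs_pairing_le R
    calc _ ≤ (4 * ‖R‖) * 1 := by
          gcongr
          · norm_num
          · exact this
      _ = _ := mul_one _
  linarith [norm_sub_le ((4 * pairing R) • profC ^ 3) R]

lemma abs_integral_Iic_solvable_le (R : BC) (s : ℝ) :
    |∫ y in Set.Iic s, profD y * solvable R y| ≤ 10 * ‖R‖ * profD s := by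
  have h1 := abs_setIntegral_profD_mul_le (solvable R) (Set.Iic s)
  have h2 := abs_setIntegral_profD_mul_le (solvable R) (Set.Ioi s)
  rw [integral_Iic_profD] at h1
  rw [integral_Ioi_profD] at h2
  have h3 := intervalIntegral.integral_Iic_add_Ioi (b := s)
    (integrable_profD_mul (solvable R)).integrableOn (integrable_profD_mul (solvable R)).integrableOn
  rw [← pairing_apply, pairing_solvable] at h3
  have h4 : ∫ y in Set.Iic s, profD y * solvable R y =
    -∫ y in Set.Ioi s, profD y * solvable R y := by linarith
  have h5 := norm_solvable_le R
  rw [← abs_neg, ← h4] at h2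
  have hp := prof_pos s
  have hq := prof_lt_one s
  have h6 := norm_nonneg R
  have hD : profD s = prof s * (1 - prof s) * (1 + prof s) := by unfold profD; ring
  rcases le_total (prof s) (1 / 2) with h | h
  · refine h1.trans ?_
    calc _ ≤ 5 * ‖R‖ * prof s := by gcongr
      _ ≤ 10 * ‖R‖ * profD s := by
        have : prof s ≤ 2 * profD s := by rw [hD]; nlinarith [mul_pos hp hp]
        nlinarith
  · refine h2.trans ?_
    calc _ ≤ 5 * ‖R‖ * (1 - prof s) := by gcongr
      _ ≤ 10 * ‖R‖ * profD s := by
        have : 1 - prof s ≤ 2 * profD s := by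
          rw [hD]
          nlinarith [mul_nonneg (sub_nonneg.2 h) (sub_pos.2 hq).le,
            mul_nonneg (mul_nonneg (sub_nonneg.2 h) (sub_pos.2 hq).le) hp.le]
        nlinarith

lemma hasDerivAt_integral_Iic_profD_mul (f : BC) (y : ℝ) :
    HasDerivAt (fun s => ∫ t in Set.Iic s, profD t * f t) (profD y * f y) y :=
  hasDerivAt_integral_Iic (continuous_profD.mul f.continuous)
    (fun _ => (integrable_profD_mul f).integrableOn) y

/-- First integration in the inversion of the operator linearised at `prof`. -/
def slowFst : BC →L[ℝ] BC :=
  mkOp (fun R s => (∫ y in Set.Iic s, profD y * solvable R y) / profD s) 10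
    (fun f g y => by
      rw [← add_div, ← integral_add (integrable_profD_mul _).integrableOn
        (integrable_profD_mul _).integrableOn]
      simp [mul_add])
    (fun c f y => by
      rw [← mul_div_assoc, ← integral_const_mul]; simp [mul_left_comm])
    (fun f => Continuous.div (continuous_iff_continuousAt.2 fun y =>
      (hasDerivAt_integral_Iic_profD_mul (solvable f) y).continuousAt) continuous_profD
      fun y => (profD_pos y).ne')
    fun f y => by
      rw [abs_div, abs_of_pos (profD_pos y), div_le_iff₀ (profD_pos y)]
      exact abs_integral_Iic_solvable_le f y

lemma hasDerivAt_slowFst (R : BC) (y : ℝ) :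
    HasDerivAt (slowFst R) (solvable R y - (1 - 3 * prof y ^ 2) * slowFst R y) y := by
  have h := (hasDerivAt_integral_Iic_profD_mul (solvable R) y).div (hasDerivAt_profD y)
    (profD_pos y).ne'
  refine h.congr_deriv ?_
  change _ = solvable R y - (1 - 3 * prof y ^ 2) *
    ((∫ y in Set.Iic y, profD y * solvable R y) / profD y)
  have := (profD_pos y).ne'
  field_simp

lemma norm_slowFst_le (R : BC) : ‖slowFst R‖ ≤ 10 * ‖R‖ := norm_mkOp_apply_le _ _ _ _ _ _ R

lemma hasDerivAt_integral_div_profD (f : BC) (y : ℝ) :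
    HasDerivAt (fun y => ∫ t in (0:ℝ)..y, f t / profD t) (f y / profD y) y := by
  have hc : Continuous fun t => f t / profD t :=
    f.continuous.div continuous_profD fun y => (profD_pos y).ne'
  exact intervalIntegral.integral_hasDerivAt_right (hc.intervalIntegrable _ _)
    (hc.stronglyMeasurableAtFilter _ _) hc.continuousAt

lemma abs_profD_mul_integral_le (f : BC) (y : ℝ) :
    |profD y * ∫ t in (0:ℝ)..y, f t / profD t| ≤ 9 * ‖f‖ := by
  set G : ℝ → ℝ := fun y => ∫ t in (0:ℝ)..y, f t / profD t with hG
  set h : ℝ → ℝ := fun y => (1 - prof y)⁻¹ - 4 * (prof y)⁻¹ with hh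
  have hd : ∀ y, HasDerivAt h (profD y / (1 - prof y) ^ 2 + 4 * (profD y / prof y ^ 2)) y := by
    intro y
    have h1 := ((hasDerivAt_prof y).const_sub 1).inv (sub_pos.2 (prof_lt_one y)).ne'
    have h2 := ((hasDerivAt_prof y).inv (prof_pos y).ne').const_mul 4
    refine (h1.sub h2).congr_deriv ?_
    ring
  have hb : ∀ y, 1 / profD y ≤ profD y / (1 - prof y) ^ 2 + 4 * (profD y / prof y ^ 2) := by
    intro y
    have hp := prof_pos y
    have hq := sub_pos.2 (prof_lt_one y)
    rw [div_le_iff₀ (profD_pos y)]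
    have : (profD y / (1 - prof y) ^ 2 + 4 * (profD y / prof y ^ 2)) * profD y =
        prof y ^ 2 * (1 + prof y) ^ 2 + 4 * (1 - prof y ^ 2) ^ 2 := by
      unfold profD
      field_simp
      ring
    rw [this]
    nlinarith [sq_nonneg (prof y ^ 2 - 1 / 2), mul_pos hp hp, mul_pos (mul_pos hp hp) hp,
      sq_nonneg (prof y ^ 2), sq_nonneg (4 * prof y ^ 2 - 3)]
  have hfb : ∀ y, |f y / profD y| ≤
      ‖f‖ * (profD y / (1 - prof y) ^ 2 + 4 * (profD y / prof y ^ 2)) := by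
    intro y
    rw [abs_div, abs_of_pos (profD_pos y), div_eq_mul_one_div]
    exact mul_le_mul (abs_le_norm f y) (hb y) (by have := profD_pos y; positivity) (norm_nonneg _)
  have m1 : Monotone fun y => ‖f‖ * h y - G y := by
    refine monotone_of_hasDerivAt_nonneg (fun y => ((hd y).const_mul ‖f‖).sub
      (hasDerivAt_integral_div_profD f y)) fun y => ?_
    have := (abs_le.1 (hfb y)).2
    simp only [Pi.zero_apply]; linarith
  have m2 : Monotone fun y => ‖f‖ * h y + G y := by
    refine monotone_of_hasDerivAt_nonneg (fun y => ((hd y).const_mul ‖f‖).add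
      (hasDerivAt_integral_div_profD f y)) fun y => ?_
    have := (abs_le.1 (hfb y)).1
    simp only [Pi.zero_apply]; linarith
  have hG0 : G 0 = 0 := by simp [hG]
  have hGb : |G y| ≤ ‖f‖ * |h y - h 0| := by
    rcases le_total 0 y with hy | hy
    · have a1 := m1 hy
      have a2 := m2 hy
      simp only [hG0] at a1 a2
      have : ‖f‖ * (h y - h 0) ≤ ‖f‖ * |h y - h 0| :=
        mul_le_mul_of_nonneg_left (le_abs_self _) (norm_nonneg _)
      rw [abs_le]; constructor <;> linarith
    · have a1 := m1 hy
      have a2 := m2 hy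
      simp only [hG0] at a1 a2
      have : ‖f‖ * (-(h y - h 0)) ≤ ‖f‖ * |h y - h 0| :=
        mul_le_mul_of_nonneg_left (neg_le_abs _) (norm_nonneg _)
      rw [abs_le]; constructor <;> linarith
  have h0 : |h 0| ≤ 3 := by
    have hs : prof 0 ^ 2 = 1 / 2 := by rw [prof_sq]; norm_num
    have hp := prof_pos 0
    have hl : 7 / 10 ≤ prof 0 := by nlinarith
    have hu : prof 0 ≤ 71 / 100 := by nlinarith
    have i1 : (1 - prof 0)⁻¹ ≤ 4 := by
      rw [inv_le_comm₀ (by linarith) (by norm_num)]; norm_num; linarith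
    have i2 : 3 ≤ (1 - prof 0)⁻¹ := by
      rw [le_inv_comm₀ (by norm_num) (by linarith)]; norm_num; linarith
    have i3 : (prof 0)⁻¹ ≤ 3 / 2 := by
      rw [inv_le_comm₀ (by linarith) (by norm_num)]; norm_num; linarith
    have i4 : 1 ≤ (prof 0)⁻¹ := by
      rw [le_inv_comm₀ (by norm_num) (by linarith)]; norm_num; linarith
    rw [abs_le]; simp only [hh]; constructor <;> linarith
  have hy : profD y * |h y| ≤ 6 := by
    have hp := prof_pos y
    have hq := sub_pos.2 (prof_lt_one y)
    have : |h y| ≤ (1 - prof y)⁻¹ + 4 * (prof y)⁻¹ := by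
      have i1 := inv_pos.2 hp
      have i2 := inv_pos.2 hq
      rw [abs_le]; simp only [hh]; constructor <;> linarith
    refine (mul_le_mul_of_nonneg_left this (profD_pos y).le).trans ?_
    have : profD y * ((1 - prof y)⁻¹ + 4 * (prof y)⁻¹) =
        prof y * (1 + prof y) + 4 * (1 - prof y ^ 2) := by
      unfold profD
      field_simp
      ring
    rw [this]; nlinarith
  have hD := profD_pos y
  have hD1 := profD_lt_one y
  rw [abs_mul, abs_of_pos hD]
  have t := abs_sub (h y) (h 0)
  have hn := norm_nonneg f
  calc profD y * |G y| ≤ profD y * (‖f‖ * (|h y| + 3)) := by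
        refine mul_le_mul_of_nonneg_left (hGb.trans ?_) hD.le
        exact mul_le_mul_of_nonneg_left (by linarith) hn
    _ = ‖f‖ * (profD y * |h y| + 3 * profD y) := by ring
    _ ≤ ‖f‖ * 9 := mul_le_mul_of_nonneg_left (by linarith) hn
    _ = _ := mul_comm _ _

/-- Second integration in the inversion of the operator linearised at `prof`. -/
def slowSnd : BC →L[ℝ] BC :=
  mkOp (fun f y => profD y * ∫ t in (0:ℝ)..y, f t / profD t) 9
    (fun f g y => by
      have hc : ∀ f : BC, Continuous fun t => f t / profD t := fun f =>
        f.continuous.div continuous_profD fun y => (profD_pos y).ne'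
      rw [← mul_add, ← intervalIntegral.integral_add ((hc f).intervalIntegrable _ _)
        ((hc g).intervalIntegrable _ _)]
      simp [add_div])
    (fun c f y => by
      rw [mul_left_comm, ← intervalIntegral.integral_const_mul]
      simp [mul_div_assoc])
    (fun f => continuous_profD.mul (continuous_iff_continuousAt.2 fun y =>
      (hasDerivAt_integral_div_profD f y).continuousAt))
    abs_profD_mul_integral_le

lemma hasDerivAt_slowSnd (f : BC) (y : ℝ) :
    HasDerivAt (slowSnd f) ((1 - 3 * prof y ^ 2) * slowSnd f y + f y) y := by
  refine ((hasDerivAt_profD y).mul (hasDerivAt_integral_div_profD f y)).congr_deriv ?_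
  change _ = (1 - 3 * prof y ^ 2) * (profD y * ∫ t in (0:ℝ)..y, f t / profD t) + f y
  have := (profD_pos y).ne'
  field_simp

/-- The slow correction `B`. -/
def slow : BC →L[ℝ] BC := slowSnd ∘L slowFst

/-- The derivative of the slow correction. -/
def slowDeriv : BC →L[ℝ] BC :=
  ContinuousLinearMap.mul ℝ BC (1 - (3:ℝ) • profC ^ 2) ∘L slow + slowFst

lemma slowDeriv_apply (R : BC) (y : ℝ) :
    slowDeriv R y = (1 - 3 * prof y ^ 2) * slow R y + slowFst R y := rfl

lemma hasDerivAt_slow (R : BC) (y : ℝ) : HasDerivAt (slow R) (slowDeriv R y) y :=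
  hasDerivAt_slowSnd _ y

lemma hasDerivAt_slowDeriv (R : BC) (y : ℝ) :
    HasDerivAt (slowDeriv R)
      (4 * pairing R * prof y ^ 3 - R y - (-1 + 12 * prof y ^ 2 - 15 * prof y ^ 4) * slow R y) y := by
  have hq : HasDerivAt (fun y => 1 - 3 * prof y ^ 2) (-(3 * (2 * prof y * profD y))) y := by
    refine ((((hasDerivAt_prof y).pow 2).const_mul 3).const_sub 1).congr_deriv ?_
    simp
  refine ((hq.mul (hasDerivAt_slow R y)).add (hasDerivAt_slowFst R y)).congr_deriv ?_
  rw [solvable_apply, slowDeriv_apply]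
  simp only [BoundedContinuousFunction.sub_apply, BoundedContinuousFunction.smul_apply,
    BoundedContinuousFunction.pow_apply, profC_apply, smul_eq_mul, profD]
  ring

end BC
end

/-- A parametrised contraction principle. -/
lemma exists_fixedPoint_of_hasStrictFDerivAt {E G H : Type*} [NormedAddCommGroup E]
    [NormedSpace ℝ E] [CompleteSpace E] [NormedAddCommGroup G] [NormedSpace ℝ G] [CompleteSpace G]
    [NormedAddCommGroup H] [NormedSpace ℝ H] {Q : E × G → E} {P : E × G → H} {Λ : G →L[ℝ] E}
    {P' : E × G →L[ℝ] H} (hQ : HasStrictFDerivAt Q (Λ ∘L ContinuousLinearMap.snd ℝ E G) 0)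
    (hQ0 : Q 0 = 0) (hP : HasStrictFDerivAt P P' 0) :
    ∃ C > 0, ∀ r > 0, ∃ ε₀ > 0, ∀ ε, 0 < ε → ε ≤ ε₀ → ∀ F : H →L[ℝ] G,
      (∀ h, ‖F h‖ ≤ ε ^ 2 * ‖h‖) → ∃ R w, ‖R‖ ≤ r ∧ ‖w‖ ≤ ε * r ∧ R = Q (R, w) ∧
        w = F (P (R, w)) ∧ ‖P (R, w)‖ ≤ C := by
  obtain ⟨K, s, hs, hlip⟩ := hP.exists_lipschitzOnWith
  obtain ⟨ρ₁, hρ₁, h1⟩ := Metric.mem_nhds_iff.1 hs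
  obtain ⟨ρ₂, hρ₂, h2⟩ := Metric.eventually_nhds_iff_ball.1
    (hQ.isLittleO.def (c := 1 / 4) (by norm_num))
  obtain ⟨ρ, hρ, hρ1, hρ2⟩ : ∃ ρ : ℝ, 0 < ρ ∧ ρ < ρ₁ ∧ ρ < ρ₂ :=
    ⟨min ρ₁ ρ₂ / 2, by positivity, by have := min_le_left ρ₁ ρ₂; linarith,
      by have := min_le_right ρ₁ ρ₂; linarith⟩
  have hPl : ∀ p p' : E × G, ‖p‖ ≤ ρ → ‖p'‖ ≤ ρ → ‖P p - P p'‖ ≤ K * ‖p - p'‖ := by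
    intro p p' hp hp'
    refine hlip.norm_sub_le (h1 ?_) (h1 ?_) <;> rw [mem_ball_zero_iff] <;> linarith
  have hQl : ∀ p p' : E × G, ‖p‖ ≤ ρ → ‖p'‖ ≤ ρ →
      ‖Q p - Q p'‖ ≤ 1 / 4 * ‖p - p'‖ + ‖Λ‖ * ‖p.2 - p'.2‖ := by
    intro p p' hp hp'
    have h3 := h2 (p, p') (by
      rw [show ((0 : E × G), (0 : E × G)) = 0 from rfl, mem_ball_zero_iff, Prod.norm_def]
      exact max_lt (by simpa using by linarith) (by simpa using by linarith))
    have h4 := Λ.le_opNorm (p.2 - p'.2)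
    have h5 := norm_add_le (Q p - Q p' - Λ (p.2 - p'.2)) (Λ (p.2 - p'.2))
    rw [sub_add_cancel] at h5
    exact h5.trans (add_le_add h3 h4)
  have hK : (0:ℝ) ≤ K := K.2
  refine ⟨‖P 0‖ + K * ρ + 1, by positivity, fun r hr => ?_⟩
  set t := min r ρ with ht
  have ht0 : 0 < t := lt_min hr hρ
  have htr : t ≤ r := min_le_left _ _
  have htρ : t ≤ ρ := min_le_right _ _
  set B := ‖Λ‖ + K + 1 with hB
  have hBpos : 0 < B := by positivity
  refine ⟨min 1 (min (1 / (4 * B)) (t / (2 * (‖P 0‖ + 1)))), by positivity,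
    fun ε hε hε₀ F hF => ?_⟩
  have e1 : ε ≤ 1 := hε₀.trans (min_le_left _ _)
  have e2 : ε * B ≤ 1 / 4 := by
    have := hε₀.trans ((min_le_right _ _).trans (min_le_left _ _))
    rw [le_div_iff₀ (by positivity)] at this
    linarith
  have e3 : ε * ‖P 0‖ ≤ t / 2 := by
    have := hε₀.trans ((min_le_right _ _).trans (min_le_right _ _))
    rw [le_div_iff₀ (by positivity)] at this
    nlinarith
  have hsc : ∀ z : E × G, ‖((z.1, ε • z.2) : E × G)‖ ≤ ‖z‖ := by
    intro z
    rw [Prod.norm_def, Prod.norm_def, norm_smul, Real.norm_of_nonneg hε.le]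
    exact max_le_max le_rfl (mul_le_of_le_one_left (norm_nonneg _) e1)
  set Φ : E × G → E × G := fun z => (Q (z.1, ε • z.2), ε⁻¹ • F (P (z.1, ε • z.2))) with hΦ
  have hΦF : ∀ h, ‖ε⁻¹ • F h‖ ≤ ε * ‖h‖ := by
    intro h
    rw [norm_smul, Real.norm_of_nonneg (by positivity)]
    calc _ ≤ ε⁻¹ * (ε ^ 2 * ‖h‖) := mul_le_mul_of_nonneg_left (hF h) (by positivity)
      _ = _ := by field_simp
  have hlipΦ : ∀ z z' : E × G, ‖z‖ ≤ t → ‖z'‖ ≤ t → ‖Φ z - Φ z'‖ ≤ 1 / 2 * ‖z - z'‖ := by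
    intro z z' hz hz'
    have a1 := (hsc z).trans (hz.trans htρ)
    have a2 := (hsc z').trans (hz'.trans htρ)
    have a3 : ‖((z.1, ε • z.2) : E × G) - (z'.1, ε • z'.2)‖ ≤ ‖z - z'‖ := by
      have := hsc (z - z')
      rwa [Prod.fst_sub, Prod.snd_sub, smul_sub] at this
    have a4 := hPl _ _ a1 a2
    have a5 := hQl _ _ a1 a2
    have a6 : ‖ε • z.2 - ε • z'.2‖ ≤ ε * ‖z - z'‖ := by
      rw [← smul_sub, norm_smul, Real.norm_of_nonneg hε.le]
      exact mul_le_mul_of_nonneg_left (norm_snd_le (z - z')) hε.le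
    have hn := norm_nonneg (z - z')
    have b1 : ‖Λ‖ * ε ≤ 1 / 4 := by nlinarith [norm_nonneg Λ]
    have b2 : ε * K ≤ 1 / 4 := by nlinarith [norm_nonneg Λ]
    refine max_le ?_ ?_
    · refine a5.trans ?_
      have : ‖Λ‖ * ‖ε • z.2 - ε • z'.2‖ ≤ ‖Λ‖ * (ε * ‖z - z'‖) :=
        mul_le_mul_of_nonneg_left a6 (norm_nonneg _)
      nlinarith
    · change ‖ε⁻¹ • F _ - ε⁻¹ • F _‖ ≤ _
      rw [← smul_sub, ← map_sub]
      refine (hΦF _).trans ?_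
      have : ε * ‖P (z.1, ε • z.2) - P (z'.1, ε • z'.2)‖ ≤ ε * (K * ‖z - z'‖) :=
        mul_le_mul_of_nonneg_left (a4.trans (mul_le_mul_of_nonneg_left a3 hK)) hε.le
      nlinarith
  have hmaps : Set.MapsTo Φ (Metric.closedBall 0 t) (Metric.closedBall 0 t) := by
    intro z hz
    rw [mem_closedBall_zero_iff] at hz ⊢
    have h0 : ‖Φ 0‖ ≤ t / 2 := by
      have : Φ 0 = (0, ε⁻¹ • F (P 0)) := by
        simp only [hΦ, Prod.fst_zero, Prod.snd_zero, smul_zero, Prod.mk_zero_zero, hQ0]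
      rw [this, Prod.norm_def]
      refine max_le (by simpa using by linarith) ((hΦF _).trans e3)
    have h3 := hlipΦ z 0 hz (by simpa using ht0.le)
    rw [sub_zero] at h3
    have h4 := norm_add_le (Φ z - Φ 0) (Φ 0)
    rw [sub_add_cancel] at h4
    linarith
  have hcontr : ContractingWith (1 / 2) (hmaps.restrict Φ _ _) := by
    refine ⟨by norm_num, LipschitzWith.of_dist_le_mul fun z z' => ?_⟩
    rw [Subtype.dist_eq, Subtype.dist_eq, dist_eq_norm, dist_eq_norm]
    have := hlipΦ z z' (mem_closedBall_zero_iff.1 z.2)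
      (mem_closedBall_zero_iff.1 z'.2)
    simpa using this
  obtain ⟨z, hz, hfix, -⟩ := ContractingWith.exists_fixedPoint'
    Metric.isClosed_closedBall.isComplete hmaps hcontr (x := 0) (by simpa using ht0.le)
    (edist_ne_top _ _)
  rw [mem_closedBall_zero_iff] at hz
  have f1 : Q (z.1, ε • z.2) = z.1 := congrArg Prod.fst hfix
  have f2 : ε⁻¹ • F (P (z.1, ε • z.2)) = z.2 := congrArg Prod.snd hfix
  refine ⟨z.1, ε • z.2, (norm_fst_le z).trans (hz.trans htr), ?_, f1.symm, ?_, ?_⟩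
  · rw [norm_smul, Real.norm_of_nonneg hε.le]
    exact mul_le_mul_of_nonneg_left ((norm_snd_le z).trans (hz.trans htr)) hε.le
  · rw [inv_smul_eq_iff₀ hε.ne'] at f2
    exact f2.symm
  · have h3 := hPl _ 0 ((hsc z).trans (hz.trans htρ)) (by simpa using hρ.le)
    have h4 := norm_add_le (P (z.1, ε • z.2) - P 0) (P 0)
    rw [sub_add_cancel] at h4
    rw [sub_zero] at h3
    have h5 := mul_le_mul_of_nonneg_left ((hsc z).trans (hz.trans htρ)) hK
    linarith

noncomputable section

/-- The nonlinearity `-t + (16/3 + μ) t³ - (24/5) t⁵`. -/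
def nl {V : Type*} [CommRing V] [Module ℝ V] (μ : ℝ) (u : V) : V :=
  -u + (16 / 3 + μ) • u ^ 3 - (24 / 5 : ℝ) • u ^ 5

namespace CosSeries

/-- The parameter as a function of the residual. -/
def param : BC →L[ℝ] ℝ := (-(16 / 3) : ℝ) • BC.pairing

/-- The ansatz `(A + B) cos x + w`. -/
def ansatz (p : BC × CosSeries BC) : CosSeries BC := e 1 (BC.profC + BC.slow p.1) + p.2

/-- The linear part of the ansatz. -/
def ansatzL : BC × CosSeries BC →L[ℝ] CosSeries BC :=
  e 1 ∘L BC.slow ∘L ContinuousLinearMap.fst ℝ _ _ + ContinuousLinearMap.snd ℝ _ _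

/-- The nonlinearity evaluated at the ansatz. -/
def nlAt (p : BC × CosSeries BC) : CosSeries BC := nl (param p.1) (ansatz p)

/-- The residual of the slow equation. -/
def residual (p : BC × CosSeries BC) : BC :=
  coef 1 (nlAt p) - ((-BC.profC + (4 : ℝ) • BC.profC ^ 3 - (3 : ℝ) • BC.profC ^ 5) +
    (-1 + (12 : ℝ) • BC.profC ^ 2 - (15 : ℝ) • BC.profC ^ 4) * BC.slow p.1 +
    (3 / 4 * param p.1) • BC.profC ^ 3)

lemma ansatz_zero : ansatz 0 = e 1 BC.profC := by simp [ansatz]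

section
variable {V : Type*} [NormedCommRing V] [NormedAlgebra ℝ V] [CompleteSpace V]

lemma e_zero_mul_e_one (v : V) : e 0 v * e 1 1 = e 1 v := by rw [e_zero_mul_e, mul_one]

lemma e_zero_pow (v : V) (n : ℕ) : (e 0 v) ^ n = e 0 (v ^ n) := by
  induction n with
  | zero => simp [one_def]
  | succ n ih => rw [pow_succ, ih, e_zero_mul_e, pow_succ]

lemma coef_e_one_pow_mul (k n : ℕ) (v w : V) :
    coef k ((e 1 v) ^ n * e 1 w) = v ^ n * w * coef k ((e 1 1) ^ (n + 1) : CosSeries V) := by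
  rw [← e_zero_mul_e_one v, ← e_zero_mul_e_one w, mul_pow, e_zero_pow,
    ← coef_e_zero_mul, ← e_zero_mul_e (0:ℕ) (v ^ n) w]
  congr 1
  ring

lemma coef_one_e_one_pow_three : coef 1 ((e 1 1) ^ 3 : CosSeries V) = (3 / 4 : ℝ) • 1 := by
  rw [e_pow_three]; simp [coef_e]

lemma coef_one_e_one_pow_five : coef 1 ((e 1 1) ^ 5 : CosSeries V) = (10 / 16 : ℝ) • 1 := by
  rw [e_pow_five]; simp [coef_e]

end

lemma hasStrictFDerivAt_ansatz : HasStrictFDerivAt ansatz ansatzL 0 := by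
  have : ansatz = fun p => e 1 BC.profC + ansatzL p := by
    funext p; simp [ansatz, ansatzL, add_assoc]
  rw [this]
  exact ansatzL.hasStrictFDerivAt.const_add _

/-- The derivative of `nlAt` at `0`. -/
def nlAtL : BC × CosSeries BC →L[ℝ] CosSeries BC :=
  -ansatzL + ((16 / 3 : ℝ) • ((3 • (e 1 BC.profC) ^ 2) • ansatzL) +
    (param ∘L ContinuousLinearMap.fst ℝ _ _).smulRight ((e 1 BC.profC) ^ 3)) -
    (24 / 5 : ℝ) • ((5 • (e 1 BC.profC) ^ 4) • ansatzL)

lemma hasStrictFDerivAt_nlAt : HasStrictFDerivAt nlAt nlAtL 0 := by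
  have h := hasStrictFDerivAt_ansatz
  have hc : HasStrictFDerivAt (fun p : BC × CosSeries BC => 16 / 3 + param p.1)
      (param ∘L ContinuousLinearMap.fst ℝ BC (CosSeries BC)) 0 :=
    (param ∘L ContinuousLinearMap.fst ℝ BC (CosSeries BC)).hasStrictFDerivAt.const_add _
  have := (h.neg.add (hc.smul (h.pow 3))).sub ((h.pow 5).const_smul (24 / 5 : ℝ))
  refine this.congr_fderiv ?_
  simp [nlAtL, ansatz_zero]

/-- The derivative of `residual` at `0`. -/
def residualL : BC × CosSeries BC →L[ℝ] BC :=
  coef 1 ∘L nlAtL - (ContinuousLinearMap.mul ℝ BC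
    (-1 + (12 : ℝ) • BC.profC ^ 2 - (15 : ℝ) • BC.profC ^ 4) ∘L BC.slow +
    ((3 / 4 : ℝ) • param).smulRight (BC.profC ^ 3)) ∘L ContinuousLinearMap.fst ℝ _ _

lemma hasStrictFDerivAt_residual : HasStrictFDerivAt residual residualL 0 := by
  refine (((coef 1).hasStrictFDerivAt.comp _ hasStrictFDerivAt_nlAt).sub
    (((ContinuousLinearMap.mul ℝ BC
    (-1 + (12 : ℝ) • BC.profC ^ 2 - (15 : ℝ) • BC.profC ^ 4) ∘L BC.slow +
    ((3 / 4 : ℝ) • param).smulRight (BC.profC ^ 3)) ∘L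
      ContinuousLinearMap.fst ℝ BC (CosSeries BC)).hasStrictFDerivAt.const_add
      (-BC.profC + (4 : ℝ) • BC.profC ^ 3 - (3 : ℝ) • BC.profC ^ 5))).congr_of_eventuallyEq
    (.of_forall fun p => ?_)
  change coef 1 (nlAt p) - (_ + (_ + (3 / 4 * param p.1) • BC.profC ^ 3)) = _
  rw [residual, ← add_assoc]
  rfl

lemma residual_zero : residual 0 = 0 := by
  have h0 : param (0 : BC × CosSeries BC).1 = 0 := by simp
  rw [residual, nlAt, nl, h0, ansatz_zero, Prod.fst_zero, map_zero, e_pow_three, e_pow_five]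
  simp only [map_sub, map_add, map_neg, map_smul, coef_e]
  norm_num
  module

lemma residualL_inl (R : BC) : residualL (R, 0) = 0 := by
  have ha : ansatzL (R, 0) = e 1 (BC.slow R) := by simp [ansatzL]
  have h1 : coef 1 ((e 1 BC.profC) ^ 2 * e 1 (BC.slow R)) =
      (3 / 4 : ℝ) • (BC.profC ^ 2 * BC.slow R) := by
    rw [coef_e_one_pow_mul, coef_one_e_one_pow_three, mul_smul_comm, mul_one]
  have h2 : coef 1 ((e 1 BC.profC) ^ 4 * e 1 (BC.slow R)) =
      (10 / 16 : ℝ) • (BC.profC ^ 4 * BC.slow R) := by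
    rw [coef_e_one_pow_mul, coef_one_e_one_pow_five, mul_smul_comm, mul_one]
  have h3 : coef 1 ((e 1 BC.profC) ^ 3) = (3 / 4 : ℝ) • BC.profC ^ 3 := by
    rw [e_pow_three]; simp [coef_e]
  have h4 : coef 1 (e 1 (BC.slow R)) = BC.slow R := by simp [coef_e]
  have hn : nlAtL (R, 0) = -e 1 (BC.slow R) + ((16 / 3 : ℝ) • (3 : ℝ) •
      ((e 1 BC.profC) ^ 2 * e 1 (BC.slow R)) + param R • (e 1 BC.profC) ^ 3) -
      (24 / 5 : ℝ) • (5 : ℝ) • ((e 1 BC.profC) ^ 4 * e 1 (BC.slow R)) := by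
    simp only [nlAtL, sub_apply, add_apply,
      neg_apply, smul_apply, ha,
      ContinuousLinearMap.smulRight_apply, ContinuousLinearMap.comp_apply,
      ContinuousLinearMap.coe_fst', smul_eq_mul, smul_mul_assoc]
    module
  have hr : residualL (R, 0) = coef 1 (nlAtL (R, 0)) -
      ((-1 + (12 : ℝ) • BC.profC ^ 2 - (15 : ℝ) • BC.profC ^ 4) * BC.slow R +
        (3 / 4 * param R) • BC.profC ^ 3) := rfl
  have hm : (-1 + (12 : ℝ) • BC.profC ^ 2 - (15 : ℝ) • BC.profC ^ 4) * BC.slow R =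
      -BC.slow R + (12 : ℝ) • (BC.profC ^ 2 * BC.slow R) -
        (15 : ℝ) • (BC.profC ^ 4 * BC.slow R) := by
    ext y; simp; ring
  rw [hr, hn, hm]
  simp only [map_sub, map_add, map_neg, map_smul, h1, h2, h3, h4]
  module

lemma residualL_eq : residualL =
    (residualL ∘L ContinuousLinearMap.inr ℝ _ _) ∘L ContinuousLinearMap.snd ℝ _ _ := by
  refine ContinuousLinearMap.ext fun p => ?_
  have h := residualL.map_add (p.1, 0) (0, p.2)
  rw [residualL_inl, zero_add] at h
  simpa using h

lemma exists_fixedPoint : ∃ C > 0, ∀ r > 0, ∃ ε₀ > 0, ∀ ε, 0 < ε → ε ≤ ε₀ →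
    ∀ F : CosSeries BC →L[ℝ] CosSeries BC, (∀ h, ‖F h‖ ≤ ε ^ 2 * ‖h‖) →
      ∃ R w, ‖R‖ ≤ r ∧ ‖w‖ ≤ ε * r ∧ R = residual (R, w) ∧
        w = F (nlAt (R, w)) ∧ ‖nlAt (R, w)‖ ≤ C :=
  exists_fixedPoint_of_hasStrictFDerivAt (residualL_eq ▸ hasStrictFDerivAt_residual)
    residual_zero hasStrictFDerivAt_nlAt

end CosSeries
end

noncomputable section

namespace BC

/-- `profD` as a bounded continuous function. -/
def profDC : BC :=
  BoundedContinuousFunction.ofNormedAddCommGroup profD continuous_profD 1 fun y => by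
    rw [Real.norm_of_nonneg (profD_pos y).le]; exact (profD_lt_one y).le

lemma norm_slowSnd_le (f : BC) : ‖slowSnd f‖ ≤ 9 * ‖f‖ := norm_mkOp_apply_le _ _ _ _ _ _ f

lemma norm_slow_le (R : BC) : ‖slow R‖ ≤ 90 * ‖R‖ := by
  have h1 := norm_slowSnd_le (slowFst R)
  have h2 := norm_slowFst_le R
  rw [slow, ContinuousLinearMap.comp_apply]
  linarith

lemma norm_slowDeriv_le (R : BC) : ‖slowDeriv R‖ ≤ 190 * ‖R‖ := by
  refine (BoundedContinuousFunction.norm_le (by positivity)).2 fun y => ?_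
  rw [slowDeriv_apply]
  have h1 := (abs_le_norm (slow R) y).trans (norm_slow_le R)
  have h2 := (abs_le_norm (slowFst R) y).trans (norm_slowFst_le R)
  have hp := prof_pos y
  have hq := prof_lt_one y
  have h3 : |1 - 3 * prof y ^ 2| ≤ 2 := by
    rw [abs_le]; constructor <;> nlinarith
  have h4 := mul_le_mul h3 h1 (abs_nonneg _) (by norm_num)
  rw [← abs_mul] at h4
  rw [Real.norm_eq_abs]
  linarith [abs_add_le ((1 - 3 * prof y ^ 2) * slow R y) (slowFst R y)]

end BC

namespace CosSeries

/-- The decay rate of the `k`-th mode. -/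
def rate (ε : ℝ) (k : ℕ) : ℝ := √((k:ℝ) ^ 2 - 1) / ε

lemma three_le_of_odd {k : ℕ} (hk : Odd k) (h1 : k ≠ 1) : 3 ≤ k := by
  rcases hk with ⟨m, rfl⟩; omega

lemma rate_sq {ε : ℝ} (hε : 0 < ε) {k : ℕ} (hk : 3 ≤ k) :
    ε ^ 2 * rate ε k ^ 2 = (k:ℝ) ^ 2 - 1 := by
  have : (3:ℝ) ≤ k := by exact_mod_cast hk
  rw [rate, div_pow, Real.sq_sqrt (by nlinarith)]
  field_simp

lemma rate_pos {ε : ℝ} (hε : 0 < ε) {k : ℕ} (hk : 3 ≤ k) : 0 < rate ε k := by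
  have : (3:ℝ) ≤ k := by exact_mod_cast hk
  exact div_pos (Real.sqrt_pos.2 (by nlinarith)) hε

lemma inv_rate_le {ε : ℝ} (hε : 0 < ε) {k : ℕ} (hk : 3 ≤ k) : (rate ε k)⁻¹ ≤ ε := by
  have h1 := rate_sq hε hk
  have h2 := rate_pos hε hk
  have h3 : (3:ℝ) ≤ k := by exact_mod_cast hk
  rw [inv_le_iff_one_le_mul₀ h2]
  by_contra! h
  have : (ε * rate ε k) ^ 2 < 1 := by
    have : 0 < ε * rate ε k := by positivity
    nlinarith
  nlinarith

open Classical in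
/-- A diagonal operator, `S` on the mode `1` and `L k` on the odd modes `k ≥ 3`. -/
def modes (S : BC →L[ℝ] BC) (L : ∀ k, 3 ≤ k → BC →L[ℝ] BC) (k : ℕ) : BC →L[ℝ] BC :=
  if k = 1 then S else if h : Odd k ∧ 3 ≤ k then L k h.2 else 0

lemma modes_one (S L) : modes S L 1 = S := if_pos rfl

lemma modes_odd (S L) {k : ℕ} (hk : Odd k) (h3 : 3 ≤ k) : modes S L k = L k h3 := by
  rw [modes, if_neg (by omega), dif_pos ⟨hk, h3⟩]

lemma modes_even (S L) {k : ℕ} (hk : Even k) : modes S L k = 0 := by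
  have h : ¬ Odd k := Nat.not_odd_iff_even.2 hk
  rw [modes, if_neg (by rintro rfl; exact h odd_one), dif_neg fun h' => h h'.1]

lemma norm_modes_le {S : BC →L[ℝ] BC} {L : ∀ k, 3 ≤ k → BC →L[ℝ] BC} {C : ℝ}
    (hC : 0 ≤ C) (hS : ∀ v, ‖S v‖ ≤ C * ‖v‖) (hL : ∀ k h v, ‖L k h v‖ ≤ C * ‖v‖) (k : ℕ) (v : BC) :
    ‖modes S L k v‖ ≤ C * ‖v‖ := by
  rcases Nat.even_or_odd k with hk | hk
  · rw [modes_even _ _ hk, zero_apply, norm_zero]; positivity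
  · by_cases h1 : k = 1
    · subst h1; rw [modes_one]; exact hS v
    · rw [modes_odd _ _ hk (three_le_of_odd hk h1)]; exact hL _ _ _

/-- The solution operator on the fast modes. -/
def fast (ε : ℝ) (hε : 0 < ε) : CosSeries BC →L[ℝ] CosSeries BC :=
  diag (modes 0 fun k hk => BC.green (rate ε k) (rate_pos hε hk)) (ε ^ 2) <|
    norm_modes_le (by positivity) (fun v => by simp; positivity) fun k hk v => by
      refine (BC.norm_green_le _ v).trans (mul_le_mul_of_nonneg_right ?_ (norm_nonneg _))
      rw [← inv_pow]
      exact pow_le_pow_left₀ (inv_pos.2 (rate_pos hε hk)).le (inv_rate_le hε hk) 2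

/-- The derivative of the solution operator on the fast modes. -/
def fastDeriv (ε : ℝ) (hε : 0 < ε) : CosSeries BC →L[ℝ] CosSeries BC :=
  diag (modes 0 fun k hk => BC.greenDeriv (rate ε k) (rate_pos hε hk)) ε <|
    norm_modes_le (by positivity) (fun v => by simp; positivity) fun k hk v =>
      (BC.norm_greenDeriv_le _ v).trans (mul_le_mul_of_nonneg_right (inv_rate_le hε hk)
        (norm_nonneg _))

/-- The operator expressing the second derivative of a solution through the nonlinearity. -/
def accel (ε : ℝ) (hε : 0 < ε) : CosSeries BC →L[ℝ] CosSeries BC :=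
  diag (modes (-ContinuousLinearMap.id ℝ BC) fun k hk =>
    (rate ε k ^ 2) • BC.green (rate ε k) (rate_pos hε hk) - ContinuousLinearMap.id ℝ BC) 2 <|
    norm_modes_le (by positivity) (fun v => by simp; linarith [norm_nonneg v]) fun k hk v => by
      have h := BC.norm_green_le (rate_pos hε hk) v
      have hp := rate_pos hε hk
      have h2 : ‖rate ε k ^ 2 • BC.green (rate ε k) (rate_pos hε hk) v‖ ≤ ‖v‖ := by
        rw [norm_smul, Real.norm_of_nonneg (by positivity)]
        refine (mul_le_mul_of_nonneg_left h (by positivity)).trans (le_of_eq ?_)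
        field_simp
      exact (norm_sub_le _ _).trans (by simpa [two_mul] using h2)

/-- Coefficientwise differentiation. -/
def Der (a a' : CosSeries BC) : Prop := ∀ k y, HasDerivAt (coef k a : BC) ((coef k a' : BC) y) y

/-- Translation of all coefficients. -/
def trans (s : ℝ) : CosSeries BC →L[ℝ] CosSeries BC :=
  diag (fun _ => BC.shift s) 1 fun _ v => (BC.norm_shift_le s v).trans (one_mul _).ge

lemma coef_trans (s : ℝ) (k : ℕ) (a : CosSeries BC) : coef k (trans s a) = BC.shift s (coef k a) :=
  coef_diag _ _ _ _ _

lemma norm_trans_le (s : ℝ) (a : CosSeries BC) : ‖trans s a‖ ≤ ‖a‖ :=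
  (norm_diag_le _ _ _ a).trans (one_mul _).le

lemma trans_mul (s : ℝ) (a b : CosSeries BC) : trans s (a * b) = trans s a * trans s b :=
  diag_mul _ _ _ (fun _ _ _ _ => rfl) (fun _ _ _ _ => rfl) a b

lemma accel_trans (ε : ℝ) (hε : 0 < ε) (s : ℝ) (a : CosSeries BC) :
    accel ε hε (trans s a) = trans s (accel ε hε a) := by
  refine ext_coef fun k => ?_
  rw [accel, coef_diag, coef_trans, coef_trans, coef_diag]
  rcases Nat.even_or_odd k with hk | hk
  · rw [modes_even _ _ hk]; simp
  · by_cases h1 : k = 1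
    · subst h1; rw [modes_one]; simp
    · rw [modes_odd _ _ hk (three_le_of_odd hk h1)]
      simp [BC.green_shift]

lemma IsOdd.nl {a : CosSeries BC} (ha : IsOdd a) (μ : ℝ) : IsOdd (nl μ a) := by
  have h := (((ha.smul (-1)).add ((ha.pow (n := 3) (by decide)).smul (16 / 3 + μ))).add
    ((ha.pow (n := 5) (by decide)).smul (-(24 / 5))))
  convert h using 1
  rw [_root_.nl]
  module

lemma hasDerivAt_of_coef_one {R : BC} {w : CosSeries BC} (hR : R = residual (R, w)) (y : ℝ) :
    HasDerivAt (BC.profDC + BC.slowDeriv R : BC) (-coef 1 (nlAt (R, w)) y) y := by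
  have h := (hasDerivAt_profD y).add (BC.hasDerivAt_slowDeriv R y)
  refine h.congr_deriv ?_
  have h2 := DFunLike.congr_fun hR y
  have h3 : residual (R, w) y = coef 1 (nlAt (R, w)) y -
      ((-prof y + 4 * prof y ^ 3 - 3 * prof y ^ 5) +
      (-1 + 12 * prof y ^ 2 - 15 * prof y ^ 4) * BC.slow R y +
      (3 / 4 * (-(16 / 3) * BC.pairing R)) * prof y ^ 3) := rfl
  rw [h3] at h2
  rw [profD]
  linarith

/-- Existence of the profile in the space of cosine series. -/
theorem exists_profile {δ : ℝ} (hδ : 0 < δ) : ∃ (ε : ℝ) (hε : 0 < ε) (μ : ℝ)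
    (u u₁ : CosSeries BC), ε ≤ δ ∧ |μ| ≤ δ ∧ IsOdd u ∧ IsOdd u₁ ∧ Der u u₁ ∧
      Der u₁ (accel ε hε (nl μ u)) ∧
      (∀ k, ε ^ 2 • coef k (accel ε hε (nl μ u)) =
        ((k:ℝ) ^ 2 - 1) • coef k u - ε ^ 2 • coef k (nl μ u)) ∧
      ‖u - e 1 BC.profC‖ ≤ δ ∧ ‖u₁ - e 1 BC.profDC‖ ≤ δ := by
  obtain ⟨C, hC, hfix⟩ := exists_fixedPoint
  obtain ⟨ε₀, hε₀, hfix⟩ := hfix (δ / 800) (by positivity)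
  obtain ⟨ε, hε, e0, e1, e2, e3⟩ : ∃ ε : ℝ, 0 < ε ∧ ε ≤ ε₀ ∧ ε ≤ δ ∧ ε ≤ 1 ∧ ε ≤ δ / (2 * C) :=
    ⟨min (min ε₀ δ) (min 1 (δ / (2 * C))), by positivity,
      (min_le_left _ _).trans (min_le_left _ _), (min_le_left _ _).trans (min_le_right _ _),
      (min_le_right _ _).trans (min_le_left _ _), (min_le_right _ _).trans (min_le_right _ _)⟩
  rw [le_div_iff₀ (by positivity)] at e3
  obtain ⟨R, w, hRn, hwn, hR, hw, hn⟩ := hfix ε hε e0 (fast ε hε) fun h => norm_diag_le _ _ _ h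
  set n := nlAt (R, w) with hndef
  set u : CosSeries BC := ansatz (R, w) with hu
  have hnu : nl (param R) u = n := rfl
  set u₁ : CosSeries BC := e 1 (BC.profDC + BC.slowDeriv R) + fastDeriv ε hε n with hu₁
  have cu : ∀ k, coef k u = (if k = 1 then BC.profC + BC.slow R else 0) +
      modes 0 (fun k hk => BC.green (rate ε k) (rate_pos hε hk)) k (coef k n) := by
    intro k
    rw [← coef_diag _ (ε ^ 2), ← coef_e, ← map_add]
    · congr 1
      change e 1 _ + w = _
      rw [hw]; rfl
  have cu₁ : ∀ k, coef k u₁ = (if k = 1 then BC.profDC + BC.slowDeriv R else 0) +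
      modes 0 (fun k hk => BC.greenDeriv (rate ε k) (rate_pos hε hk)) k (coef k n) := by
    intro k
    rw [hu₁, map_add, coef_e, fastDeriv, coef_diag]
  have cu₂ : ∀ k, coef k (accel ε hε n) = modes (-ContinuousLinearMap.id ℝ BC) (fun k hk =>
      (rate ε k ^ 2) • BC.green (rate ε k) (rate_pos hε hk) - ContinuousLinearMap.id ℝ BC) k
      (coef k n) := fun k => coef_diag _ _ _ _ _
  have ou : IsOdd u := isOdd_of_coef fun k hk => by
    rw [cu, if_neg (by rintro rfl; exact absurd hk (by decide)), modes_even _ _ hk]; simp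
  have on : IsOdd n := hnu ▸ ou.nl _
  refine ⟨ε, hε, param R, u, u₁, e1, ?_, ou, ?_, ?_, ?_, ?_, ?_, ?_⟩
  · have h1 := BC.abs_pairing_le R
    have h2 : |param R| = 16 / 3 * |BC.pairing R| := by
      change |-(16 / 3) * BC.pairing R| = _
      rw [abs_mul]; norm_num
    rw [h2]; linarith
  · refine isOdd_of_coef fun k hk => ?_
    rw [cu₁, if_neg (by rintro rfl; exact absurd hk (by decide)), modes_even _ _ hk]; simp
  · intro k y
    rw [cu, cu₁]
    rcases Nat.even_or_odd k with hk | hk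
    · rw [if_neg (by rintro rfl; exact absurd hk (by decide)), modes_even _ _ hk,
        if_neg (by rintro rfl; exact absurd hk (by decide)), modes_even _ _ hk]
      simp
    · by_cases h1 : k = 1
      · subst h1
        rw [modes_one, modes_one, if_pos rfl, if_pos rfl]
        simp only [zero_apply, add_zero]
        exact (hasDerivAt_prof y).add (BC.hasDerivAt_slow R y)
      · have h3 := three_le_of_odd hk h1
        rw [modes_odd _ _ hk h3, modes_odd _ _ hk h3, if_neg h1, if_neg h1, zero_add, zero_add]
        exact BC.hasDerivAt_green _ _ _
  · intro k y
    rw [hnu, cu₁, cu₂]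
    rcases Nat.even_or_odd k with hk | hk
    · rw [if_neg (by rintro rfl; exact absurd hk (by decide)), modes_even _ _ hk,
        modes_even _ _ hk]
      simp
    · by_cases h1 : k = 1
      · subst h1
        rw [modes_one, modes_one, if_pos rfl]
        simpa using hasDerivAt_of_coef_one hR y
      · have h3 := three_le_of_odd hk h1
        rw [modes_odd _ _ hk h3, modes_odd _ _ hk h3, if_neg h1, zero_add]
        exact BC.hasDerivAt_greenDeriv _ _ _
  · intro k
    rw [hnu, cu₂, cu]
    rcases Nat.even_or_odd k with hk | hk
    · rw [if_neg (by rintro rfl; exact absurd hk (by decide)), modes_even _ _ hk,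
        modes_even _ _ hk, on.coef_eq_zero hk]
      simp
    · by_cases h1 : k = 1
      · subst h1
        rw [modes_one]
        simp
      · have h3 := three_le_of_odd hk h1
        rw [modes_odd _ _ hk h3, modes_odd _ _ hk h3, if_neg h1, zero_add, ← rate_sq hε h3]
        simp [smul_sub, smul_smul]
  · have : u - e 1 BC.profC = e 1 (BC.slow R) + w := by
      rw [hu, ansatz, map_add]; abel
    rw [this]
    refine (norm_add_le _ _).trans ?_
    rw [norm_e]
    have := BC.norm_slow_le R
    nlinarith
  · have : u₁ - e 1 BC.profDC = e 1 (BC.slowDeriv R) + fastDeriv ε hε n := by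
      rw [hu₁, map_add]; abel
    rw [this]
    refine (norm_add_le _ _).trans ?_
    rw [norm_e]
    have h1 := BC.norm_slowDeriv_le R
    have h2 : ‖fastDeriv ε hε n‖ ≤ ε * ‖n‖ := norm_diag_le _ _ _ n
    nlinarith

end CosSeries
end

noncomputable section
namespace CosSeries

lemma trans_trans (s t : ℝ) (a : CosSeries BC) : trans s (trans t a) = trans (s + t) a := by
  refine ext_coef fun k => ?_
  rw [coef_trans, coef_trans, coef_trans]
  ext y
  rw [BC.shift_apply, BC.shift_apply, BC.shift_apply, add_assoc]

lemma trans_one (s : ℝ) : trans s 1 = 1 := by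
  refine ext_coef fun k => ?_
  rw [coef_trans, one_def, coef_e]
  ext y
  rw [BC.shift_apply]
  split_ifs <;> rfl

lemma trans_pow (s : ℝ) (a : CosSeries BC) (n : ℕ) : trans s (a ^ n) = trans s a ^ n := by
  induction n with
  | zero => rw [pow_zero, pow_zero, trans_one]
  | succ n ih => rw [pow_succ, pow_succ, trans_mul, ih]

lemma trans_nl (s μ : ℝ) (a : CosSeries BC) : trans s (nl μ a) = nl μ (trans s a) := by
  simp only [nl, map_add, map_sub, map_neg, map_smul, trans_pow]

lemma norm_trans_sub_le {a a' : CosSeries BC} (h : Der a a') (s : ℝ) :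
    ‖trans s a - a‖ ≤ |s| * ‖a'‖ := by
  refine hasSum_le (fun k => ?_) (hasSum_norm (trans s a - a)) ((hasSum_norm a').mul_left |s|)
  have : ‖coef k (trans s a - a)‖ ≤ |s| * ‖coef k a'‖ := by
    rw [map_sub, coef_trans]
    refine (BoundedContinuousFunction.norm_le (by positivity)).2 fun y => ?_
    have := convex_univ.norm_image_sub_le_of_norm_hasDerivWithin_le (𝕜 := ℝ)
      (f := (coef k a : BC)) (x := y) (y := y + s) (C := ‖coef k a'‖)
      (fun x _ => (h k x).hasDerivWithinAt) (fun x _ => BC.abs_le_norm _ x) trivial trivial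
    rw [add_sub_cancel_left, mul_comm] at this
    exact this
  calc (2:ℝ) ^ k * ‖coef k (trans s a - a)‖ ≤ 2 ^ k * (|s| * ‖coef k a'‖) := by gcongr
    _ = _ := by ring

lemma continuous_trans {a a' : CosSeries BC} (h : Der a a') : Continuous fun s => trans s a := by
  refine (LipschitzWith.of_dist_le_mul (K := ‖a'‖₊) fun s t => ?_).continuous
  have h1 : trans s a - trans t a = trans t (trans (s - t) a - a) := by
    rw [map_sub, trans_trans, add_sub_cancel]
  rw [dist_eq_norm, h1, coe_nnnorm, Real.dist_eq, mul_comm]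
  exact (norm_trans_le _ _).trans (norm_trans_sub_le h _)

lemma trans_eq_integral {a a' : CosSeries BC} (h : Der a a')
    (hc : Continuous fun s => trans s a') (s : ℝ) :
    trans s a = a + ∫ t in (0:ℝ)..s, trans t a' := by
  refine ext_coef fun k => ?_
  ext y
  have h1 := (((BoundedContinuousFunction.evalCLM ℝ y : BC →L[ℝ] ℝ) ∘L coef k)).intervalIntegral_comp_comm
    (hc.intervalIntegrable (μ := volume) 0 s)
  have h2 : ∫ t in (0:ℝ)..s, (coef k a' : BC) (y + t) =
      (coef k a : BC) (y + s) - (coef k a : BC) (y + 0) := by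
    refine intervalIntegral.integral_eq_sub_of_hasDerivAt
      (f := fun t => (coef k a : BC) (y + t)) (fun t _ => ?_) ?_
    · exact (h k (y + t)).comp_const_add y t
    · exact (((coef k a' : BC).continuous).comp (continuous_const.add continuous_id)).intervalIntegrable _ _
  have h3 : ∀ t, ((BoundedContinuousFunction.evalCLM ℝ y : BC →L[ℝ] ℝ) ∘L coef k) (trans t a') =
      (coef k a' : BC) (y + t) := fun t => by
    change (coef k (trans t a') : BC) y = _
    rw [coef_trans, BC.shift_apply]
  simp only [h3] at h1
  rw [h2, add_zero] at h1
  rw [coef_trans, BC.shift_apply, map_add (coef k)]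
  change _ = (coef k a : BC) y + ((BoundedContinuousFunction.evalCLM ℝ y : BC →L[ℝ] ℝ) ∘L coef k)
    (∫ t in (0:ℝ)..s, trans t a')
  rw [← h1]; ring

lemma hasDerivAt_trans {a a' : CosSeries BC} (h : Der a a')
    (hc : Continuous fun s => trans s a') (s : ℝ) :
    HasDerivAt (fun s => trans s a) (trans s a') s := by
  rw [funext (trans_eq_integral h hc)]
  exact (intervalIntegral.integral_hasDerivAt_right (hc.intervalIntegrable _ _)
    (hc.stronglyMeasurableAtFilter _ _)
    hc.continuousAt).const_add a

end CosSeries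

end

noncomputable section

/-- The derivative of `nl μ` on the reals. -/
def nlD (μ t : ℝ) : ℝ := -1 + 3 * (16 / 3 + μ) * t ^ 2 - 24 * t ^ 4

lemma hasDerivAt_nl (μ t : ℝ) : HasDerivAt (nl μ : ℝ → ℝ) (nlD μ t) t := by
  have h := ((hasDerivAt_id t).neg.add (((hasDerivAt_pow 3 t)).const_mul (16 / 3 + μ))).sub
    ((hasDerivAt_pow 5 t).const_mul (24 / 5))
  refine (h.congr_deriv ?_).congr_of_eventuallyEq (Filter.Eventually.of_forall fun s => ?_)
  · simp [nlD]; ring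
  · simp [nl]

/-- Smooth functions close to `prof y * cos x` solving the rescaled equation, together with
their derivatives. -/
structure IsApproxSol (ε μ δ : ℝ) (U Ux Uxx V Vx Vxx W WY : ℝ → ℝ → ℝ) : Prop where
  smooth : ContDiff ℝ (⊤ : ℕ∞) fun p : ℝ × ℝ => U p.1 p.2
  bound : ∃ M, ∀ x y, |U x y| ≤ M ∧ |Ux x y| ≤ M ∧ |V x y| ≤ M
  hasDerivAt_U : ∀ x y, HasDerivAt (fun x => U x y) (Ux x y) x
  hasDerivAt_Ux : ∀ x y, HasDerivAt (fun x => Ux x y) (Uxx x y) x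
  hasDerivAt_U' : ∀ x y, HasDerivAt (U x) (V x y) y
  hasDerivAt_V : ∀ x y, HasDerivAt (fun x => V x y) (Vx x y) x
  hasDerivAt_Vx : ∀ x y, HasDerivAt (fun x => Vx x y) (Vxx x y) x
  hasDerivAt_V' : ∀ x y, HasDerivAt (V x) (W x y) y
  hasDerivAt_W' : ∀ x y, HasDerivAt (W x) (WY x y) y
  pde : ∀ x y, Uxx x y + ε ^ 2 * W x y + U x y + ε ^ 2 * nl μ (U x y) = 0
  pde_deriv : ∀ x y, Vxx x y + ε ^ 2 * WY x y + (1 + ε ^ 2 * nlD μ (U x y)) * V x y = 0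
  add_pi : ∀ x y, U (x + Real.pi) y = -U x y
  close : ∀ x y, |U x y - prof y * Real.cos x| ≤ δ * |Real.cos x|
  close_deriv : ∀ x y, |V x y - profD y * Real.cos x| ≤ δ * |Real.cos x|

namespace CosSeries

lemma contDiff_nl_comp {n : WithTop ℕ∞} {μ : ℝ} {f : ℝ → CosSeries BC} (hf : ContDiff ℝ n f) :
    ContDiff ℝ n fun s => nl μ (f s) := by
  unfold nl
  exact (hf.neg.add ((hf.pow 3).const_smul _)).sub ((hf.pow 5).const_smul _)

lemma contDiff_trans {ε μ : ℝ} {hε : 0 < ε} {u u₁ : CosSeries BC} (h1 : Der u u₁)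
    (h2 : Der u₁ (accel ε hε (nl μ u))) :
    ContDiff ℝ (⊤ : ℕ∞) (fun s => trans s u) ∧ ContDiff ℝ (⊤ : ℕ∞) (fun s => trans s u₁) ∧
      ContDiff ℝ (⊤ : ℕ∞) fun s => trans s (accel ε hε (nl μ u)) := by
  have h3 : (fun s => trans s (accel ε hε (nl μ u))) = fun s => accel ε hε (nl μ (trans s u)) :=
    funext fun s => by rw [← accel_trans, trans_nl]
  have hc : ∀ n : WithTop ℕ∞, ContDiff ℝ n (fun s => trans s u) →
      ContDiff ℝ n fun s => trans s (accel ε hε (nl μ u)) := fun n h => by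
    rw [h3]
    exact (accel ε hε).contDiff.comp (contDiff_nl_comp h)
  have hd1 := hasDerivAt_trans h1 (continuous_trans h2)
  have hd2 := hasDerivAt_trans h2 (hc 0 (contDiff_zero.2 (continuous_trans h1))).continuous
  have key : ∀ n : ℕ, ContDiff ℝ n (fun s => trans s u) ∧ ContDiff ℝ n (fun s => trans s u₁) := by
    intro n
    induction n with
    | zero => exact ⟨contDiff_zero.2 (continuous_trans h1), contDiff_zero.2 (continuous_trans h2)⟩
    | succ n ih =>
      refine ⟨(contDiff_succ_iff_deriv (n := (n : WithTop ℕ∞))).2 ⟨fun s => (hd1 s).differentiableAt, by simp, ?_⟩,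
        (contDiff_succ_iff_deriv (n := (n : WithTop ℕ∞))).2 ⟨fun s => (hd2 s).differentiableAt, by simp, ?_⟩⟩
      · rw [funext fun s => (hd1 s).deriv]; exact ih.2
      · rw [funext fun s => (hd2 s).deriv]; exact hc _ ih.1
  have h4 := contDiff_infty.2 fun n => (key n).1
  exact ⟨h4, contDiff_infty.2 fun n => (key n).2, hc _ h4⟩

section evalDeriv

variable {V : Type*} [NormedCommRing V] [NormedAlgebra ℝ V] [CompleteSpace V]

lemma hasDerivAt_evalAt (x : ℝ) (a : CosSeries V) :
    HasDerivAt (fun x => evalAt x a) (deriv evalAt x a) x :=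
  (ContinuousLinearMap.apply ℝ V a).hasFDerivAt.comp_hasDerivAt x
    ((contDiff_evalAt (V := V)).differentiable (by simp) x).hasDerivAt

lemma hasDerivAt_deriv_evalAt (x : ℝ) (a : CosSeries V) :
    HasDerivAt (fun x => deriv evalAt x a) (deriv (deriv evalAt) x a) x :=
  (ContinuousLinearMap.apply ℝ V a).hasFDerivAt.comp_hasDerivAt x
    ((contDiff_infty_iff_deriv.1 (contDiff_evalAt (V := V))).2.differentiable (by simp) x).hasDerivAt

lemma deriv_evalAt_e (x : ℝ) (k : ℕ) (v : V) :
    deriv evalAt x (e k v) = (-(k * Real.sin (k * x))) • v := by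
  have h1 : HasDerivAt (fun x => evalAt x (e k v)) (deriv evalAt x (e k v)) x :=
    hasDerivAt_evalAt x _
  have h2 : HasDerivAt (fun x => evalAt x (e k v)) ((-(k * Real.sin (k * x))) • v) x := by
    simp only [evalAt_e]
    refine HasDerivAt.smul_const ?_ v
    have := ((hasDerivAt_id x).const_mul (k:ℝ)).cos
    exact this.congr_deriv (by simp; ring)
  exact h1.unique h2

lemma deriv_deriv_evalAt_e (x : ℝ) (k : ℕ) (v : V) :
    deriv (deriv evalAt) x (e k v) = (-(k ^ 2 * Real.cos (k * x))) • v := by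
  have h1 : HasDerivAt (fun x => deriv evalAt x (e k v)) (deriv (deriv evalAt) x (e k v)) x :=
    hasDerivAt_deriv_evalAt x _
  have h2 : HasDerivAt (fun x => deriv evalAt x (e k v)) ((-(k ^ 2 * Real.cos (k * x))) • v) x := by
    simp only [deriv_evalAt_e]
    refine HasDerivAt.smul_const ?_ v
    have := (((hasDerivAt_id x).const_mul (k:ℝ)).sin.const_mul (k:ℝ)).neg
    exact this.congr_deriv (by simp; ring)
  exact h1.unique h2

lemma norm_deriv_evalAt_apply_le (x : ℝ) (a : CosSeries V) : ‖deriv evalAt x a‖ ≤ ‖a‖ := by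
  refine ((hasSum_e a).mapL (deriv evalAt x)).norm_le_of_bounded (hasSum_norm a) fun k => ?_
  rw [deriv_evalAt_e, norm_smul]
  gcongr
  rw [norm_neg, norm_mul, Real.norm_natCast]
  have h1 : (k:ℝ) ≤ 2 ^ k := by exact_mod_cast Nat.lt_two_pow_self.le
  have h2 := Real.abs_sin_le_one (k * x)
  rw [← Real.norm_eq_abs] at h2
  nlinarith [norm_nonneg (Real.sin (k * x)), (Nat.cast_nonneg k : (0:ℝ) ≤ k)]

lemma evalAt_add_pi {a : CosSeries V} (ha : IsOdd a) (x : ℝ) :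
    evalAt (x + Real.pi) a = -evalAt x a := by
  have h := hasSum_evalAt (x + Real.pi) a
  have h2 : ∀ k : ℕ, Real.cos (k * (x + Real.pi)) • coef k a = -(Real.cos (k * x) • coef k a) := ?_
  · simp only [h2] at h
    exact h.unique (hasSum_evalAt x a).neg
  intro k
  rcases Nat.even_or_odd k with hk | hk
  · rw [ha.coef_eq_zero hk, smul_zero, smul_zero, neg_zero]
  · rw [mul_add, Real.cos_add_nat_mul_pi, hk.neg_one_pow, neg_one_mul, neg_smul]

/-- The equation for the coefficients sums up to a differential equation. -/
lemma deriv_deriv_evalAt_add {ε : ℝ} {a b n : CosSeries V}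
    (h : ∀ k, ε ^ 2 • coef k b = ((k:ℝ) ^ 2 - 1) • coef k a - ε ^ 2 • coef k n) (x : ℝ) :
    deriv (deriv evalAt) x a + ε ^ 2 • evalAt x b + evalAt x a + ε ^ 2 • evalAt x n = 0 := by
  have h1 := (hasSum_e a).mapL (deriv (deriv evalAt) x)
  have h2 := ((h1.add ((hasSum_evalAt x b).const_smul (ε ^ 2))).add (hasSum_evalAt x a)).add
    ((hasSum_evalAt x n).const_smul (ε ^ 2))
  refine h2.unique ?_
  have h3 : ∀ k : ℕ, deriv (deriv evalAt) x (e k (coef k a)) +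
      ε ^ 2 • Real.cos (k * x) • coef k b + Real.cos (k * x) • coef k a +
      ε ^ 2 • Real.cos (k * x) • coef k n = 0 := fun k => by
    rw [deriv_deriv_evalAt_e, smul_comm, h]
    module
  simp only [h3]
  exact hasSum_zero

end evalDeriv

/-- Evaluation at the slow coordinate zero, after applying `E`. -/
def atZero (E : CosSeries BC →L[ℝ] BC) : CosSeries BC →L[ℝ] ℝ :=
  (BoundedContinuousFunction.evalCLM ℝ 0 : BC →L[ℝ] ℝ) ∘L E

lemma atZero_apply (E : CosSeries BC →L[ℝ] BC) (a : CosSeries BC) :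
    atZero E a = (E a) 0 := rfl

lemma atZero_evalAt_nl (x μ : ℝ) (a : CosSeries BC) :
    atZero (evalAt x) (nl μ a) = nl μ (atZero (evalAt x) a) := by
  simp only [atZero_apply, nl, map_add, map_sub, map_neg, map_smul, evalAt_pow]
  rfl

lemma evalAt_trans (x s : ℝ) (a : CosSeries BC) : evalAt x (trans s a) = BC.shift s (evalAt x a) := by
  have h := (hasSum_evalAt x a).mapL (BC.shift s)
  simp only [map_smul, ← coef_trans] at h
  exact (hasSum_evalAt x _).unique h

lemma abs_atZero_evalAt_sub_le {δ : ℝ} {a : CosSeries BC} (ha : IsOdd a) (p : BC)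
    (h : ‖a - e 1 p‖ ≤ δ) (x y : ℝ) :
    |atZero (evalAt x) (trans y a) - p y * Real.cos x| ≤ δ * |Real.cos x| := by
  have h1 : IsOdd (a - e 1 p) := by
    rw [sub_eq_add_neg, ← neg_one_smul ℝ (e 1 p)]
    refine ha.add (IsOdd.smul _ (isOdd_of_coef fun k hk => ?_))
    rw [coef_e, if_neg]
    rintro rfl
    exact absurd hk (by decide)
  have h2 : atZero (evalAt x) (trans y a) - p y * Real.cos x = (evalAt x (a - e 1 p) : BC) y := by
    rw [atZero_apply, evalAt_trans, BC.shift_apply, zero_add, map_sub, evalAt_e]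
    simp [mul_comm]
  rw [h2]
  exact ((BC.abs_le_norm _ y).trans (norm_evalAt_le_of_isOdd x h1)).trans (by gcongr)

lemma hasDerivAt_atZero {E : ℝ → CosSeries BC →L[ℝ] BC} {E' : CosSeries BC →L[ℝ] BC} {x : ℝ}
    {a : CosSeries BC} (h : HasDerivAt (fun x => E x a) (E' a) x) :
    HasDerivAt (fun x => atZero (E x) a) (atZero E' a) x :=
  (BoundedContinuousFunction.evalCLM ℝ 0 : BC →L[ℝ] ℝ).hasFDerivAt.comp_hasDerivAt x h

theorem exists_isApproxSol {δ : ℝ} (hδ : 0 < δ) : ∃ ε > 0, ∃ μ, ε ≤ δ ∧ |μ| ≤ δ ∧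
    ∃ U Ux Uxx V Vx Vxx W WY, IsApproxSol ε μ δ U Ux Uxx V Vx Vxx W WY := by
  obtain ⟨ε, hε, μ, u, u₁, hεδ, hμ, hu, hu₁, h1, h2, hk, hc, hc₁⟩ := exists_profile hδ
  obtain ⟨s0, s1, s2⟩ := contDiff_trans h1 h2
  set u₂ := accel ε hε (nl μ u) with hu₂
  have d1 := hasDerivAt_trans h1 s1.continuous
  have d2 := hasDerivAt_trans h2 s2.continuous
  have d3 : ∀ y, HasDerivAt (fun s => trans s u₂) (deriv (fun s => trans s u₂) y) y :=
    fun y => (s2.differentiable (by simp) y).hasDerivAt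
  have pde : ∀ x y, atZero (deriv (deriv evalAt) x) (trans y u) +
      ε ^ 2 * atZero (evalAt x) (trans y u₂) + atZero (evalAt x) (trans y u) +
      ε ^ 2 * nl μ (atZero (evalAt x) (trans y u)) = 0 := fun x y => by
    have h3 := deriv_deriv_evalAt_add (ε := ε) (a := trans y u) (b := trans y u₂)
      (n := nl μ (trans y u)) (fun k => by
        rw [← trans_nl, coef_trans, coef_trans, coef_trans, ← map_smul, hk k, map_sub, map_smul,
          map_smul]) x
    have h4 := congrArg (BoundedContinuousFunction.evalCLM ℝ 0 : BC →L[ℝ] ℝ) h3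
    rw [← atZero_evalAt_nl]
    exact h4
  have cd : ∀ (E : CosSeries BC →L[ℝ] BC) {f : ℝ → CosSeries BC} {f' : CosSeries BC} {y : ℝ},
      HasDerivAt f f' y → HasDerivAt (fun y => atZero E (f y)) (atZero E f') y :=
    fun E f f' y h => (atZero E).hasFDerivAt.comp_hasDerivAt y h
  refine ⟨ε, hε, μ, hεδ, hμ, fun x y => atZero (evalAt x) (trans y u),
    fun x y => atZero (deriv evalAt x) (trans y u),
    fun x y => atZero (deriv (deriv evalAt) x) (trans y u),
    fun x y => atZero (evalAt x) (trans y u₁),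
    fun x y => atZero (deriv evalAt x) (trans y u₁),
    fun x y => atZero (deriv (deriv evalAt) x) (trans y u₁),
    fun x y => atZero (evalAt x) (trans y u₂),
    fun x y => atZero (evalAt x) (deriv (fun s => trans s u₂) y),
    ⟨?_, ⟨‖u‖ + ‖u₁‖, fun x y => ⟨?_, ?_, ?_⟩⟩,
    fun x y => hasDerivAt_atZero (hasDerivAt_evalAt x _),
    fun x y => hasDerivAt_atZero (hasDerivAt_deriv_evalAt x _),
    fun x y => cd _ (d1 y),
    fun x y => hasDerivAt_atZero (hasDerivAt_evalAt x _),
    fun x y => hasDerivAt_atZero (hasDerivAt_deriv_evalAt x _),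
    fun x y => cd _ (d2 y),
    fun x y => cd _ (d3 y), pde, fun x y => ?_, fun x y => ?_,
    abs_atZero_evalAt_sub_le hu _ hc, abs_atZero_evalAt_sub_le hu₁ _ hc₁⟩⟩
  · exact (BoundedContinuousFunction.evalCLM ℝ 0 : BC →L[ℝ] ℝ).contDiff.comp
      (((contDiff_evalAt (V := BC)).comp contDiff_fst).clm_apply (s0.comp contDiff_snd))
  · exact ((BC.abs_le_norm _ _).trans (norm_evalAt_apply_le _ _)).trans
      ((norm_trans_le _ _).trans (le_add_of_nonneg_right (norm_nonneg _)))
  · exact ((BC.abs_le_norm _ _).trans (norm_deriv_evalAt_apply_le _ _)).trans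
      ((norm_trans_le _ _).trans (le_add_of_nonneg_right (norm_nonneg _)))
  · exact ((BC.abs_le_norm _ _).trans (norm_evalAt_apply_le _ _)).trans
      ((norm_trans_le _ _).trans (le_add_of_nonneg_left (norm_nonneg _)))
  · have h3 := (((cd (deriv (deriv evalAt) x) (d1 y)).add
      ((cd (evalAt x) (d3 y)).const_mul (ε ^ 2))).add (cd (evalAt x) (d1 y))).add
      (((hasDerivAt_nl μ _).comp y (cd (evalAt x) (d1 y))).const_mul (ε ^ 2))
    have h4 := h3.unique ((hasDerivAt_const y (0:ℝ)).congr_of_eventuallyEq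
      (Filter.Eventually.of_forall fun s => pde x s))
    linarith
  · change (evalAt (x + Real.pi) (trans y u) : BC) 0 = -(evalAt x (trans y u) : BC) 0
    rw [evalAt_trans, evalAt_add_pi hu, map_neg, evalAt_trans]
    rfl

end CosSeries

end

noncomputable section

lemma IsLocalMin.second_deriv_nonneg {f f' : ℝ → ℝ} {x c : ℝ} (h : IsLocalMin f x)
    (hf : ∀ y, HasDerivAt f (f' y) y) (hf' : HasDerivAt f' c x) : 0 ≤ c := by
  by_contra! hc
  have h1 : deriv f = f' := funext fun y => (hf y).deriv
  have h2 : IsLocalMax f x := by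
    refine isLocalMax_of_deriv_deriv_neg ?_ ?_ (hf x).continuousAt
    · rw [h1, hf'.deriv]; exact hc
    · exact h.deriv_eq_zero
  have h3 : f =ᶠ[nhds x] fun _ => f x := by
    filter_upwards [h, h2] with y hy hy'
    exact le_antisymm hy' hy
  have h4 : f' =ᶠ[nhds x] fun _ => 0 := by
    have := h3.deriv
    rw [h1] at this
    simpa using this
  have h5 := hf'.unique ((hasDerivAt_const x (0:ℝ)).congr_of_eventuallyEq h4)
  exact hc.ne h5

/-- A comparison principle in a half-strip, for an equation with a positive strict
supersolution which only depends on the bounded variable. -/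
theorem halfStrip_lower_bound {ε K b M m d : ℝ} {z zx zxx zY zYY γ : ℝ → ℝ → ℝ}
    {Ψ Ψ' Ψ'' : ℝ → ℝ}
    (hε : 0 < ε) (hb : 0 ≤ b) (hm : 0 < m) (hd : 0 < d)
    (hz : Continuous fun p : ℝ × ℝ => z p.1 p.2)
    (hzx : ∀ x y, HasDerivAt (fun x => z x y) (zx x y) x)
    (hzxx : ∀ x y, HasDerivAt (fun x => zx x y) (zxx x y) x)
    (hzY : ∀ x y, HasDerivAt (z x) (zY x y) y)
    (hzYY : ∀ x y, HasDerivAt (zY x) (zYY x y) y)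
    (hΨ' : ∀ x, HasDerivAt Ψ (Ψ' x) x) (hΨ'' : ∀ x, HasDerivAt Ψ' (Ψ'' x) x)
    (hpde : ∀ x y, zxx x y + ε ^ 2 * zYY x y + (1 + ε ^ 2 * γ x y) * z x y = 0)
    (hM : ∀ x y, |z x y| ≤ M)
    (hγ : ∀ x, |x| ≤ Real.pi / 2 → ∀ y, K ≤ y → -100 ≤ γ x y)
    (hl : ∀ y, z (-(Real.pi / 2)) y = 0) (hr : ∀ y, z (Real.pi / 2) y = 0)
    (hK : ∀ x, |x| ≤ Real.pi / 2 → b * Real.cos x ≤ z x K)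
    (hΨ : ∀ x, |x| ≤ Real.pi / 2 → d ≤ Ψ x)
    (hsup : ∀ x, |x| ≤ Real.pi / 2 → ∀ y, K ≤ y →
      Ψ'' x + (1 + ε ^ 2 * γ x y) * Ψ x ≤ -(m * ε ^ 2 * Ψ x))
    {x y : ℝ} (hx : |x| ≤ Real.pi / 2) (hy : K ≤ y) :
    b * Real.exp (-10 * (y - K)) * Real.cos x ≤ z x y := by
  by_contra! hneg
  obtain ⟨l, hl0, hlm⟩ : ∃ l : ℝ, 0 < l ∧ l ^ 2 < m := by
    refine ⟨√(m / 2), Real.sqrt_pos.2 (by positivity), ?_⟩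
    rw [Real.sq_sqrt (by positivity)]; linarith
  set s : ℝ → ℝ → ℝ := fun x y => b * Real.exp (-10 * (y - K)) * Real.cos x with hs
  set Φ : ℝ → ℝ → ℝ := fun x y => Ψ x * Real.cosh (l * (y - K)) with hΦ
  have hΦpos : ∀ x, |x| ≤ Real.pi / 2 → ∀ y, 0 < Φ x y := fun x hx y =>
    mul_pos (hd.trans_le (hΨ x hx)) (Real.cosh_pos _)
  have hcΨ : Continuous Ψ := continuous_iff_continuousAt.2 fun x => (hΨ' x).continuousAt
  have hcs : Continuous fun p : ℝ × ℝ => s p.1 p.2 := by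
    simp only [hs]; fun_prop
  have hcΦ : Continuous fun p : ℝ × ℝ => Φ p.1 p.2 := by
    simp only [hΦ]
    exact (hcΨ.comp continuous_fst).mul (by fun_prop)
  set q : ℝ × ℝ → ℝ := fun p => (z p.1 p.2 - s p.1 p.2) / Φ p.1 p.2 with hq
  have hq0 : q (x, y) < 0 := div_neg_of_neg_of_pos (by simp only [hs]; linarith) (hΦpos x hx y)
  have hsb : ∀ x y, K ≤ y → s x y ≤ b := fun x y hy => by
    have h1 : Real.exp (-10 * (y - K)) ≤ 1 := Real.exp_le_one_iff.2 (by linarith)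
    have h2 := Real.cos_le_one x
    have h3 := Real.exp_pos (-10 * (y - K))
    calc s x y = b * (Real.exp (-10 * (y - K)) * Real.cos x) := by simp only [hs]; ring
      _ ≤ b * 1 := by gcongr; nlinarith
      _ = b := mul_one b
  have hM0 : 0 ≤ M := (abs_nonneg _).trans (hM 0 0)
  obtain ⟨R, hRy, hR⟩ : ∃ R, y ≤ R ∧ ∀ x', |x'| ≤ Real.pi / 2 → q (x, y) < q (x', R) := by
    set η := -q (x, y) with hη
    have hη0 : 0 < η := by linarith
    refine ⟨max y (K + 2 * ((M + b) / (d * η)) / l), le_max_left _ _, fun x' hx' => ?_⟩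
    set R := max y (K + 2 * ((M + b) / (d * η)) / l) with hRdef
    have h1 : 2 * ((M + b) / (d * η)) ≤ l * (R - K) := by
      have h2 : 2 * ((M + b) / (d * η)) / l ≤ R - K := by
        have := le_max_right y (K + 2 * ((M + b) / (d * η)) / l)
        linarith
      rw [div_le_iff₀ hl0] at h2
      linarith
    have h2 : (M + b) / (d * η) < Real.cosh (l * (R - K)) := by
      rw [Real.cosh_eq]
      have h3 := Real.add_one_le_exp (l * (R - K))
      have h4 := Real.exp_pos (-(l * (R - K)))
      linarith
    rw [div_lt_iff₀ (by positivity)] at h2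
    have h3 : -(M + b) ≤ z x' R - s x' R := by
      have h4 := (abs_le.1 (hM x' R)).1
      have h5 := hsb x' R (hy.trans (le_max_left _ _))
      linarith
    have h4 : q (x, y) = -η := by rw [hη, neg_neg]
    rw [h4]
    simp only [hq]
    rw [lt_div_iff₀ (hΦpos x' hx' R)]
    have h5 : d * Real.cosh (l * (R - K)) * η ≤ Φ x' R * η := by
      simp only [hΦ]
      gcongr
      exact hΨ x' hx'
    nlinarith
  set S : Set (ℝ × ℝ) := Set.Icc (-(Real.pi / 2)) (Real.pi / 2) ×ˢ Set.Icc K R with hS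
  have hScomp : IsCompact S := isCompact_Icc.prod isCompact_Icc
  have hxS : (x, y) ∈ S := ⟨abs_le.1 hx, hy, hRy⟩
  have hqc : ContinuousOn q S := by
    refine ContinuousOn.div (hz.sub hcs).continuousOn hcΦ.continuousOn fun p hp => ?_
    exact (hΦpos p.1 (abs_le.2 hp.1) p.2).ne'
  obtain ⟨⟨x₀, y₀⟩, hp, hmin⟩ := hScomp.exists_isMinOn ⟨_, hxS⟩ hqc
  set c := q (x₀, y₀) with hc
  have hc0 : c ≤ q (x, y) := hmin hxS
  have hcneg : c < 0 := hc0.trans_lt hq0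
  have hx₀ : |x₀| ≤ Real.pi / 2 := abs_le.2 hp.1
  have hΦ₀ := hΦpos x₀ hx₀ y₀
  have hcmul : z x₀ y₀ - s x₀ y₀ = c * Φ x₀ y₀ := by
    rw [hc]; simp only [hq]; rw [div_mul_cancel₀ _ hΦ₀.ne']
  have hneg₀ : z x₀ y₀ - s x₀ y₀ < 0 := by rw [hcmul]; exact mul_neg_of_neg_of_pos hcneg hΦ₀
  have hge : ∀ p ∈ S, 0 ≤ z p.1 p.2 - s p.1 p.2 - c * Φ p.1 p.2 := fun p hp' => by
    have h1 : c ≤ q p := hmin hp'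
    have h2 := hΦpos p.1 (abs_le.2 hp'.1) p.2
    have h3 := (le_div_iff₀ h2).1 h1
    linarith
  have hxl : -(Real.pi / 2) < x₀ := by
    refine lt_of_le_of_ne hp.1.1 fun h => hneg₀.not_ge ?_
    rw [← h, hl]; simp [hs]
  have hxr : x₀ < Real.pi / 2 := by
    refine lt_of_le_of_ne hp.1.2 fun h => hneg₀.not_ge ?_
    rw [h, hr]; simp [hs]
  have hyl : K < y₀ := by
    refine lt_of_le_of_ne hp.2.1 fun h => hneg₀.not_ge ?_
    have h1 := hK x₀ hx₀
    change K = y₀ at h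
    rw [← h]; simp [hs, h1]
  have hyr : y₀ < R := by
    refine lt_of_le_of_ne hp.2.2 fun h => ?_
    change y₀ = R at h
    have h1 := hR x₀ hx₀
    rw [← h] at h1
    exact (hc0.trans_lt h1).false
  have hmx : IsLocalMin (fun x => z x y₀ - s x y₀ - c * Φ x y₀) x₀ := by
    filter_upwards [Icc_mem_nhds hxl hxr] with x' hx'
    have h1 := hge (x', y₀) ⟨hx', hp.2⟩
    have h2 : z x₀ y₀ - s x₀ y₀ - c * Φ x₀ y₀ = 0 := by linarith
    rw [h2]; exact h1
  have hmy : IsLocalMin (fun y => z x₀ y - s x₀ y - c * Φ x₀ y) y₀ := by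
    filter_upwards [Icc_mem_nhds hyl hyr] with y' hy'
    have h1 := hge (x₀, y') ⟨hp.1, hy'⟩
    have h2 : z x₀ y₀ - s x₀ y₀ - c * Φ x₀ y₀ = 0 := by linarith
    rw [h2]; exact h1
  set E := Real.exp (-10 * (y₀ - K)) with hE
  set C := Real.cosh (l * (y₀ - K)) with hC
  have hxx := hmx.second_deriv_nonneg
    (f' := fun x => zx x y₀ - b * E * (-Real.sin x) - c * (Ψ' x * C))
    (c := zxx x₀ y₀ - b * E * (-Real.cos x₀) - c * (Ψ'' x₀ * C))
    (fun x => ((hzx x y₀).sub ((Real.hasDerivAt_cos x).const_mul (b * E))).sub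
      (((hΨ' x).mul_const C).const_mul c))
    (((hzxx x₀ y₀).sub ((Real.hasDerivAt_sin x₀).neg.const_mul (b * E))).sub
      (((hΨ'' x₀).mul_const C).const_mul c))
  have hde : ∀ y, HasDerivAt (fun y => Real.exp (-10 * (y - K)))
      (-10 * Real.exp (-10 * (y - K))) y := fun y =>
    (((hasDerivAt_id y).sub_const K).const_mul (-10)).exp.congr_deriv (by simp; ring)
  have hdc : ∀ y, HasDerivAt (fun y => Real.cosh (l * (y - K)))
      (l * Real.sinh (l * (y - K))) y := fun y =>
    (((hasDerivAt_id y).sub_const K).const_mul l).cosh.congr_deriv (by simp; ring)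
  have hds : ∀ y, HasDerivAt (fun y => Real.sinh (l * (y - K)))
      (l * Real.cosh (l * (y - K))) y := fun y =>
    (((hasDerivAt_id y).sub_const K).const_mul l).sinh.congr_deriv (by simp; ring)
  have hyy := hmy.second_deriv_nonneg
    (f' := fun y => zY x₀ y - b * (-10 * Real.exp (-10 * (y - K))) * Real.cos x₀ -
      c * (Ψ x₀ * (l * Real.sinh (l * (y - K)))))
    (c := zYY x₀ y₀ - b * (-10 * (-10 * E)) * Real.cos x₀ - c * (Ψ x₀ * (l * (l * C))))
    (fun y => ((hzY x₀ y).sub (((hde y).const_mul b).mul_const (Real.cos x₀))).sub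
      (((hdc y).const_mul (Ψ x₀)).const_mul c))
    (((hzYY x₀ y₀).sub ((((hde y₀).const_mul (-10)).const_mul b).mul_const (Real.cos x₀))).sub
      ((((hds y₀).const_mul l).const_mul (Ψ x₀)).const_mul c))
  have hCpos : 0 < C := Real.cosh_pos _
  have hcos : 0 ≤ Real.cos x₀ := Real.cos_nonneg_of_mem_Icc hp.1
  have hEpos : 0 < E := Real.exp_pos _
  have h1 := hpde x₀ y₀
  have h2 : z x₀ y₀ = b * E * Real.cos x₀ + c * (Ψ x₀ * C) := by
    have : s x₀ y₀ = b * E * Real.cos x₀ := rfl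
    have h3 : Φ x₀ y₀ = Ψ x₀ * C := rfl
    rw [this, h3] at hcmul; linarith
  have h3 : 0 ≤ b * E * Real.cos x₀ * (100 + γ x₀ y₀) := by
    have := hγ x₀ hx₀ y₀ hyl.le
    have h4 : 0 ≤ 100 + γ x₀ y₀ := by linarith
    positivity
  have h4 : Ψ'' x₀ + (1 + ε ^ 2 * γ x₀ y₀) * Ψ x₀ + ε ^ 2 * l ^ 2 * Ψ x₀ < 0 := by
    have h5 := hsup x₀ hx₀ y₀ hyl.le
    have h6 : 0 < ε ^ 2 * Ψ x₀ := mul_pos (by positivity) (hd.trans_le (hΨ x₀ hx₀))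
    nlinarith
  have h5 : 0 < c * C * (Ψ'' x₀ + (1 + ε ^ 2 * γ x₀ y₀) * Ψ x₀ + ε ^ 2 * l ^ 2 * Ψ x₀) :=
    mul_pos_of_neg_of_neg (mul_neg_of_neg_of_pos hcneg hCpos) h4
  have h6 := mul_nonneg (sq_nonneg ε) hyy
  have h7 := mul_nonneg (sq_nonneg ε) h3
  rw [h2] at h1
  nlinarith

end

noncomputable section

lemma cos_mul_ge {κ x : ℝ} (h0 : 0 ≤ κ) (h1 : κ ≤ 1) (hx : |x| ≤ Real.pi / 2) :
    Real.cos x ≤ Real.cos (κ * x) ∧ Real.cos (κ * (Real.pi / 2)) ≤ Real.cos (κ * x) ∧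
      Real.cos (κ * x) - Real.cos x ≤ 2 * (1 - κ) := by
  have hpi := Real.pi_pos
  have hpi4 := Real.pi_le_four
  have e1 : |κ * x| = κ * |x| := by rw [abs_mul, abs_of_nonneg h0]
  have h3 : κ * |x| ≤ |x| := mul_le_of_le_one_left (abs_nonneg x) h1
  refine ⟨?_, ?_, ?_⟩
  · rw [← Real.cos_abs x, ← Real.cos_abs (κ * x), e1]
    exact Real.cos_le_cos_of_nonneg_of_le_pi (by positivity) (by linarith) h3
  · rw [← Real.cos_abs (κ * x), e1]
    refine Real.cos_le_cos_of_nonneg_of_le_pi (by positivity) ?_ (by gcongr)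
    nlinarith
  · have h4 := (le_abs_self _).trans (Real.abs_cos_sub_cos_le (κ * x) x)
    have h5 : |κ * x - x| = (1 - κ) * |x| := by
      rw [show κ * x - x = -((1 - κ) * x) by ring, abs_neg, abs_mul, abs_of_nonneg (by linarith)]
    rw [h5] at h4
    nlinarith

lemma cos_mul_pi_half_pos {κ : ℝ} (h0 : 0 ≤ κ) (h1 : κ < 1) : 0 < Real.cos (κ * (Real.pi / 2)) := by
  have hpi := Real.pi_pos
  exact Real.cos_pos_of_mem_Ioo ⟨by nlinarith, by nlinarith⟩

lemma hasDerivAt_cos_mul (κ x : ℝ) :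
    HasDerivAt (fun x => Real.cos (κ * x)) (-(κ * Real.sin (κ * x))) x :=
  (((hasDerivAt_id x).const_mul κ).cos).congr_deriv (by simp; ring)

lemma hasDerivAt_neg_sin_mul (κ x : ℝ) :
    HasDerivAt (fun x => -(κ * Real.sin (κ * x))) (-(κ ^ 2 * Real.cos (κ * x))) x :=
  ((((hasDerivAt_id x).const_mul κ).sin.const_mul κ).neg).congr_deriv (by simp; ring)

/-- The comparison principle when the potential stays below `-1/2`. -/
lemma halfStrip_lower_bound_of_le {ε K b M : ℝ} {z zx zxx zY zYY γ : ℝ → ℝ → ℝ}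
    (hε : 0 < ε) (hε1 : ε ≤ 1) (hb : 0 ≤ b)
    (hz : Continuous fun p : ℝ × ℝ => z p.1 p.2)
    (hzx : ∀ x y, HasDerivAt (fun x => z x y) (zx x y) x)
    (hzxx : ∀ x y, HasDerivAt (fun x => zx x y) (zxx x y) x)
    (hzY : ∀ x y, HasDerivAt (z x) (zY x y) y)
    (hzYY : ∀ x y, HasDerivAt (zY x) (zYY x y) y)
    (hpde : ∀ x y, zxx x y + ε ^ 2 * zYY x y + (1 + ε ^ 2 * γ x y) * z x y = 0)
    (hM : ∀ x y, |z x y| ≤ M)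
    (hγ : ∀ x, |x| ≤ Real.pi / 2 → ∀ y, K ≤ y → -100 ≤ γ x y ∧ γ x y ≤ -(1 / 2))
    (hl : ∀ y, z (-(Real.pi / 2)) y = 0) (hr : ∀ y, z (Real.pi / 2) y = 0)
    (hK : ∀ x, |x| ≤ Real.pi / 2 → b * Real.cos x ≤ z x K)
    {x y : ℝ} (hx : |x| ≤ Real.pi / 2) (hy : K ≤ y) :
    b * Real.exp (-10 * (y - K)) * Real.cos x ≤ z x y := by
  obtain ⟨κ, hκ0, hκ1, hκ⟩ : ∃ κ : ℝ, 0 ≤ κ ∧ κ < 1 ∧ κ ^ 2 = 1 - ε ^ 2 / 4 := by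
    refine ⟨√(1 - ε ^ 2 / 4), Real.sqrt_nonneg _, ?_, Real.sq_sqrt (by nlinarith)⟩
    rw [Real.sqrt_lt' one_pos]
    nlinarith
  have hd := cos_mul_pi_half_pos hκ0 hκ1
  refine halfStrip_lower_bound (m := 1 / 4) hε hb (by norm_num) hd hz hzx hzxx hzY hzYY
    (hasDerivAt_cos_mul κ) (hasDerivAt_neg_sin_mul κ) hpde hM
    (fun x hx y hy => (hγ x hx y hy).1) hl hr hK (fun x hx => (cos_mul_ge hκ0 hκ1.le hx).2.1)
    (fun x hx y hy => ?_) hx hy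
  have h1 := (hγ x hx y hy).2
  have h2 := hd.trans_le (cos_mul_ge hκ0 hκ1.le hx).2.1
  rw [hκ]
  have h3 : 0 ≤ ε ^ 2 * Real.cos (κ * x) * (-(1 / 2) - γ x y) :=
    mul_nonneg (by positivity) (by linarith)
  nlinarith

lemma nlD_bounds {c t μ : ℝ} (hc : 0 ≤ c) (hc1 : c ≤ 1) (ht : |t - c| ≤ 0.002 * c)
    (hμ : |μ| ≤ 0.001) :
    -30 ≤ nlD μ t ∧ nlD μ t ≤ 30 ∧ nlD μ t ≤ -1 + 16 * c ^ 2 - 24 * c ^ 4 + 1 / 2 ∧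
      nlD μ t ≤ -1 + 21 * c ^ 2 := by
  obtain ⟨h1, h2⟩ := abs_le.1 ht
  obtain ⟨h3, h4⟩ := abs_le.1 hμ
  have h5 : t ^ 2 ≤ 1.0041 * c ^ 2 := by nlinarith
  have h6 : 0.9959 * c ^ 2 ≤ t ^ 2 := by nlinarith
  have h7 : c ^ 2 ≤ 1 := by nlinarith
  have h8 := sq_nonneg c
  have h9 : t ^ 4 ≤ 1.009 * c ^ 4 := by nlinarith
  have h10 : 0.991 * c ^ 4 ≤ t ^ 4 := by nlinarith
  have h11 : μ * t ^ 2 ≤ 0.002 := by nlinarith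
  have h12 : -0.002 ≤ μ * t ^ 2 := by nlinarith
  have h13 : c ^ 4 ≤ c ^ 2 := by nlinarith
  have h14 : μ * t ^ 2 ≤ 0.001 * t ^ 2 := by nlinarith [sq_nonneg t]
  have h15 : 0 ≤ t ^ 4 := by positivity
  unfold nlD
  refine ⟨?_, ?_, ?_, ?_⟩ <;> nlinarith

lemma neg_le_cubic_quintic {c : ℝ} (hc : 0 ≤ c) (hc1 : c ≤ 1) :
    -c ≤ c - c ^ 3 / 2 - c ^ 5 ∧ c - c ^ 3 / 2 - c ^ 5 ≤ c := by
  have h1 : c ^ 3 ≤ c := pow_le_of_le_one hc hc1 (by norm_num)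
  have h2 : c ^ 5 ≤ c := pow_le_of_le_one hc hc1 (by norm_num)
  have h3 : 0 ≤ c ^ 3 := by positivity
  have h4 : 0 ≤ c ^ 5 := by positivity
  constructor <;> linarith

lemma supersolution_aux {ε c p ψ γ : ℝ} (hε : ε ^ 2 ≤ 0.000001) (hc : 0 ≤ c)
    (hc1 : c ≤ 1) (h1 : c ≤ p) (h2 : p - c ≤ ε ^ 2) (h4 : -c ≤ ψ) (h5 : ψ ≤ c)
    (g1 : -30 ≤ γ) (g2 : γ ≤ 30) (g3 : γ ≤ -1 + 16 * c ^ 2 - 24 * c ^ 4 + 1 / 2)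
    (g4 : γ ≤ -1 + 21 * c ^ 2) :
    -((1 - ε ^ 2 / 2) * p) + ε ^ 2 * (-ψ - (3 * c + 16 * c ^ 3 - 24 * c ^ 5)) +
      (1 + ε ^ 2 * γ) * (p + ε ^ 2 * ψ) ≤ -(1 / 4 * ε ^ 2 * (p + ε ^ 2 * ψ)) := by
  have e1 : c * (γ - (-1 + 16 * c ^ 2 - 24 * c ^ 4) - 13 / 4) ≤ c * (-11 / 4) :=
    mul_le_mul_of_nonneg_left (by linarith) hc
  have e2 : (3 / 4 + γ) * (p - c) ≤ 21 * c ^ 2 * (p - c) :=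
    mul_le_mul_of_nonneg_right (by linarith) (by linarith)
  have e3 : 21 * c ^ 2 * (p - c) ≤ c := by
    have h6 : c * (p - c) ≤ 0.000001 := by nlinarith
    nlinarith
  have e4 : ψ * (γ + 1 / 4) ≤ 31 * c := by
    rcases le_total 0 ψ with h | h <;> nlinarith
  have e5 : ε ^ 2 * (ψ * (γ + 1 / 4)) ≤ c := by nlinarith [sq_nonneg ε]
  have e6 : 0 ≤ ε ^ 2 * -(c * (γ - (-1 + 16 * c ^ 2 - 24 * c ^ 4) - 13 / 4) +
      (3 / 4 + γ) * (p - c) + ε ^ 2 * (ψ * (γ + 1 / 4))) :=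
    mul_nonneg (sq_nonneg ε) (by linarith)
  nlinarith

/-- The comparison principle when the potential is close to `nlD 0 (cos x)`. -/
lemma halfStrip_lower_bound_of_close {ε K b M μ : ℝ} {z zx zxx zY zYY u : ℝ → ℝ → ℝ}
    (hε : 0 < ε) (hε1 : ε ≤ 0.001) (hμ : |μ| ≤ 0.001) (hb : 0 ≤ b)
    (hz : Continuous fun p : ℝ × ℝ => z p.1 p.2)
    (hzx : ∀ x y, HasDerivAt (fun x => z x y) (zx x y) x)
    (hzxx : ∀ x y, HasDerivAt (fun x => zx x y) (zxx x y) x)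
    (hzY : ∀ x y, HasDerivAt (z x) (zY x y) y)
    (hzYY : ∀ x y, HasDerivAt (zY x) (zYY x y) y)
    (hpde : ∀ x y, zxx x y + ε ^ 2 * zYY x y + (1 + ε ^ 2 * nlD μ (u x y)) * z x y = 0)
    (hM : ∀ x y, |z x y| ≤ M)
    (hu : ∀ x, |x| ≤ Real.pi / 2 → ∀ y, K ≤ y → |u x y - Real.cos x| ≤ 0.002 * Real.cos x)
    (hl : ∀ y, z (-(Real.pi / 2)) y = 0) (hr : ∀ y, z (Real.pi / 2) y = 0)
    (hK : ∀ x, |x| ≤ Real.pi / 2 → b * Real.cos x ≤ z x K)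
    {x y : ℝ} (hx : |x| ≤ Real.pi / 2) (hy : K ≤ y) :
    b * Real.exp (-10 * (y - K)) * Real.cos x ≤ z x y := by
  obtain ⟨κ, hκ0, hκ1, hκ⟩ : ∃ κ : ℝ, 0 ≤ κ ∧ κ < 1 ∧ κ ^ 2 = 1 - ε ^ 2 / 2 := by
    refine ⟨√(1 - ε ^ 2 / 2), Real.sqrt_nonneg _, ?_, Real.sq_sqrt (by nlinarith)⟩
    rw [Real.sqrt_lt' one_pos]
    nlinarith
  have hκ' : 2 * (1 - κ) ≤ ε ^ 2 := by nlinarith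
  have hε2 : ε ^ 2 ≤ 0.000001 := by nlinarith
  have hd := cos_mul_pi_half_pos hκ0 hκ1
  have hcos : ∀ x, |x| ≤ Real.pi / 2 → 0 ≤ Real.cos x := fun x hx =>
    Real.cos_nonneg_of_mem_Icc (abs_le.1 hx)
  have hψ : ∀ x : ℝ, -(7 / 16) * Real.cos (3 * x) - 1 / 16 * Real.cos (5 * x) =
      Real.cos x - Real.cos x ^ 3 / 2 - Real.cos x ^ 5 := fun x => by
    rw [Real.cos_three_mul, show 5 * x = 3 * x + 2 * x by ring, Real.cos_add, Real.cos_three_mul,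
      Real.sin_three_mul, Real.cos_two_mul, Real.sin_two_mul]
    have h1 := Real.sin_sq x
    have h2 : Real.sin x ^ 4 = (1 - Real.cos x ^ 2) ^ 2 := by rw [← h1]; ring
    ring_nf
    rw [h2, h1]
    ring
  have hψ2 : ∀ x : ℝ, -(7 / 16) * -(3 ^ 2 * Real.cos (3 * x)) -
      1 / 16 * -(5 ^ 2 * Real.cos (5 * x)) = -(Real.cos x - Real.cos x ^ 3 / 2 - Real.cos x ^ 5)
      - (3 * Real.cos x + 16 * Real.cos x ^ 3 - 24 * Real.cos x ^ 5) := fun x => by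
    have h1 := hψ x
    have h2 := Real.cos_three_mul x
    linarith
  refine halfStrip_lower_bound (m := 1 / 4) (d := Real.cos (κ * (Real.pi / 2)) / 2)
    (γ := fun x y => nlD μ (u x y)) hε hb (by norm_num)
    (by positivity) hz hzx hzxx hzY hzYY
    (fun x => (hasDerivAt_cos_mul κ x).add ((((hasDerivAt_cos_mul 3 x).const_mul (-(7 / 16))).sub
      ((hasDerivAt_cos_mul 5 x).const_mul (1 / 16))).const_mul (ε ^ 2)))
    (fun x => (hasDerivAt_neg_sin_mul κ x).add
      ((((hasDerivAt_neg_sin_mul 3 x).const_mul (-(7 / 16))).sub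
      ((hasDerivAt_neg_sin_mul 5 x).const_mul (1 / 16))).const_mul (ε ^ 2))) hpde hM
    (fun x hx y hy => ?_) hl hr hK (fun x hx => ?_)
    (fun x hx y hy => ?_) hx hy
  · have := (nlD_bounds (hcos x hx) (Real.cos_le_one x) (hu x hx y hy) hμ).1
    linarith
  · obtain ⟨h1, h2, h3⟩ := cos_mul_ge hκ0 hκ1.le hx
    have hc := hcos x hx
    have hc1 := Real.cos_le_one x
    simp only [Pi.add_apply, Pi.sub_apply]
    rw [hψ x]
    have h4 : -(Real.cos x) ≤ Real.cos x - Real.cos x ^ 3 / 2 - Real.cos x ^ 5 :=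
      (neg_le_cubic_quintic hc hc1).1
    nlinarith
  · obtain ⟨h1, h2, h3⟩ := cos_mul_ge hκ0 hκ1.le hx
    obtain ⟨g1, g2, g3, g4⟩ := nlD_bounds (hcos x hx) (Real.cos_le_one x) (hu x hx y hy) hμ
    have hc := hcos x hx
    have hc1 := Real.cos_le_one x
    simp only [Pi.add_apply, Pi.sub_apply]
    rw [hψ2 x, hψ x, hκ]
    obtain ⟨h4, h5⟩ := neg_le_cubic_quintic hc hc1
    exact supersolution_aux hε2 hc hc1 h1 (h3.trans hκ') h4 h5 g1 g2 g3 g4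

end

noncomputable section

namespace IsApproxSol

variable {ε μ δ : ℝ} {U Ux Uxx V Vx Vxx W WY : ℝ → ℝ → ℝ}
  (h : IsApproxSol ε μ δ U Ux Uxx V Vx Vxx W WY)
include h

lemma eq_zero {x : ℝ} (hx : Real.cos x = 0) (y : ℝ) : U x y = 0 ∧ V x y = 0 := by
  have h1 := h.close x y
  have h2 := h.close_deriv x y
  rw [hx, mul_zero, sub_zero, abs_zero, mul_zero] at h1 h2
  exact ⟨abs_eq_zero.1 (h1.antisymm (abs_nonneg _)), abs_eq_zero.1 (h2.antisymm (abs_nonneg _))⟩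

lemma continuous_uncurry_deriv : Continuous fun p : ℝ × ℝ => V p.1 p.2 := by
  have h1 : (fun p : ℝ × ℝ => V p.1 p.2) =
      fun p => fderiv ℝ (fun p : ℝ × ℝ => U p.1 p.2) p (0, 1) := by
    funext p
    have h2 := (h.smooth.differentiable (by simp) p).hasFDerivAt.comp_hasDerivAt p.2
      ((hasDerivAt_const p.2 p.1).prodMk (hasDerivAt_id p.2))
    exact (h.hasDerivAt_U' p.1 p.2).unique h2
  rw [h1]
  exact (h.smooth.continuous_fderiv (by simp)).clm_apply continuous_const

lemma lower_bounds {x : ℝ} (hx : |x| ≤ Real.pi / 2) (y : ℝ) :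
    (prof y - δ) * Real.cos x ≤ U x y ∧ (profD y - δ) * Real.cos x ≤ V x y ∧
      U x y ≤ (prof y + δ) * Real.cos x := by
  have hc : 0 ≤ Real.cos x := Real.cos_nonneg_of_mem_Icc (abs_le.1 hx)
  have h1 := abs_le.1 (h.close x y)
  have h2 := abs_le.1 (h.close_deriv x y)
  rw [abs_of_nonneg hc] at h1 h2
  refine ⟨?_, ?_, ?_⟩ <;> linarith

lemma deriv_pos_right {K b : ℝ} (hε : 0 < ε) (hε1 : ε ≤ 0.001) (hδ : δ ≤ 0.001)
    (hμ : |μ| ≤ 0.001) (hK : 0.999 ≤ prof K) (hb : 0 < b) (hbK : b ≤ profD K - δ)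
    {x y : ℝ} (hx : |x| < Real.pi / 2) (hy : K ≤ y) : 0 < V x y := by
  obtain ⟨M, hM⟩ := h.bound
  have hcos : 0 < Real.cos x := Real.cos_pos_of_mem_Ioo (abs_lt.1 hx)
  refine lt_of_lt_of_le ?_ (halfStrip_lower_bound_of_close (u := U) (K := K) hε hε1 hμ hb.le
    h.continuous_uncurry_deriv
    h.hasDerivAt_V h.hasDerivAt_Vx h.hasDerivAt_V' h.hasDerivAt_W' h.pde_deriv
    (fun x y => (hM x y).2.2) (fun x hx y hy => ?_)
    (fun y => (h.eq_zero (by rw [Real.cos_neg, Real.cos_pi_div_two]) y).2)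
    (fun y => (h.eq_zero Real.cos_pi_div_two y).2) (fun x hx => ?_) hx.le hy)
  · have := Real.exp_pos (-10 * (y - K))
    positivity
  · have hc : 0 ≤ Real.cos x := Real.cos_nonneg_of_mem_Icc (abs_le.1 hx)
    obtain ⟨h1, -, h2⟩ := h.lower_bounds hx y
    have h3 := prof_lt_one y
    have h4 := hK.trans (strictMono_prof.monotone hy)
    rw [abs_le]
    constructor <;> nlinarith
  · have hc : 0 ≤ Real.cos x := Real.cos_nonneg_of_mem_Icc (abs_le.1 hx)
    exact (mul_le_mul_of_nonneg_right hbK hc).trans (h.lower_bounds hx K).2.1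

lemma abs_le_of_le_neg {K : ℝ} (hδ0 : 0 ≤ δ) (hδ : δ ≤ 0.001) (hK : prof (-K) ≤ 0.1)
    {x y : ℝ} (hx : |x| ≤ Real.pi / 2) (hy : K ≤ y) : |U x (-y)| ≤ 0.11 := by
  have hc : 0 ≤ Real.cos x := Real.cos_nonneg_of_mem_Icc (abs_le.1 hx)
  have hc1 := Real.cos_le_one x
  obtain ⟨h1, -, h2⟩ := h.lower_bounds hx (-y)
  have h3 := prof_pos (-y)
  have h4 := (strictMono_prof.monotone (neg_le_neg hy)).trans hK
  rw [abs_le]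
  constructor <;> nlinarith

lemma deriv_pos_left {K b : ℝ} (hε : 0 < ε) (hε1 : ε ≤ 0.001) (hδ0 : 0 ≤ δ) (hδ : δ ≤ 0.001)
    (hμ : |μ| ≤ 0.001) (hK : prof (-K) ≤ 0.1) (hb : 0 < b) (hbK : b ≤ profD (-K) - δ)
    {x y : ℝ} (hx : |x| < Real.pi / 2) (hy : y ≤ -K) : 0 < V x y := by
  obtain ⟨M, hM⟩ := h.bound
  have hcos : 0 < Real.cos x := Real.cos_pos_of_mem_Ioo (abs_lt.1 hx)
  have := halfStrip_lower_bound_of_le (K := K) (b := b) (M := M) (z := fun x y => V x (-y))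
    (zx := fun x y => Vx x (-y)) (zxx := fun x y => Vxx x (-y)) (zY := fun x y => -W x (-y))
    (zYY := fun x y => WY x (-y)) (γ := fun x y => nlD μ (U x (-y))) hε (by linarith) hb.le
    (h.continuous_uncurry_deriv.comp (continuous_fst.prodMk continuous_snd.neg))
    (fun x y => h.hasDerivAt_V x _) (fun x y => h.hasDerivAt_Vx x _)
    (fun x y => ((h.hasDerivAt_V' x (-y)).scomp y (hasDerivAt_neg y)).congr_deriv (by simp))
    (fun x y => (((h.hasDerivAt_W' x (-y)).scomp y (hasDerivAt_neg y)).neg).congr_deriv (by simp))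
    (fun x y => h.pde_deriv x _)
    (fun x y => (hM x _).2.2) (fun x hx y hy => ?_)
    (fun y => (h.eq_zero (by rw [Real.cos_neg, Real.cos_pi_div_two]) _).2)
    (fun y => (h.eq_zero Real.cos_pi_div_two _).2) (fun x hx => ?_) hx.le (le_neg.1 hy)
  · simp only [neg_neg] at this
    refine lt_of_lt_of_le ?_ this
    have := Real.exp_pos (-10 * (-y - K))
    positivity
  · have h1 := h.abs_le_of_le_neg hδ0 hδ hK hx hy
    have h2 : U x (-y) ^ 2 ≤ 0.0121 := by
      rw [← sq_abs]; nlinarith [abs_nonneg (U x (-y))]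
    have h3 := abs_le.1 hμ
    have h4 := sq_nonneg (U x (-y))
    have h5 : U x (-y) ^ 4 = (U x (-y) ^ 2) ^ 2 := by ring
    rw [nlD, h5]
    constructor <;> nlinarith
  · have hc : 0 ≤ Real.cos x := Real.cos_nonneg_of_mem_Icc (abs_le.1 hx)
    exact (mul_le_mul_of_nonneg_right hbK hc).trans (h.lower_bounds hx (-K)).2.1

lemma lower_bound_left {K b : ℝ} (hε : 0 < ε) (hε1 : ε ≤ 0.001) (hδ0 : 0 ≤ δ) (hδ : δ ≤ 0.001)
    (hμ : |μ| ≤ 0.001) (hK : prof (-K) ≤ 0.1) (hb : 0 < b) (hbK : b ≤ prof (-K) - δ)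
    {x y : ℝ} (hx : |x| ≤ Real.pi / 2) (hy : y ≤ -K) :
    b * Real.exp (-10 * (-y - K)) * Real.cos x ≤ U x y := by
  obtain ⟨M, hM⟩ := h.bound
  have := halfStrip_lower_bound_of_le (K := K) (b := b) (M := M) (z := fun x y => U x (-y))
    (zx := fun x y => Ux x (-y)) (zxx := fun x y => Uxx x (-y)) (zY := fun x y => -V x (-y))
    (zYY := fun x y => W x (-y))
    (γ := fun x y => -1 + (16 / 3 + μ) * U x (-y) ^ 2 - 24 / 5 * U x (-y) ^ 4) hε (by linarith) hb.le
    (h.smooth.continuous.comp (continuous_fst.prodMk continuous_snd.neg))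
    (fun x y => h.hasDerivAt_U x _) (fun x y => h.hasDerivAt_Ux x _)
    (fun x y => ((h.hasDerivAt_U' x (-y)).scomp y (hasDerivAt_neg y)).congr_deriv (by simp))
    (fun x y => (((h.hasDerivAt_V' x (-y)).scomp y (hasDerivAt_neg y)).neg).congr_deriv (by simp))
    (fun x y => ?_)
    (fun x y => (hM x _).1) (fun x hx y hy => ?_)
    (fun y => (h.eq_zero (by rw [Real.cos_neg, Real.cos_pi_div_two]) _).1)
    (fun y => (h.eq_zero Real.cos_pi_div_two _).1) (fun x hx => ?_) hx (le_neg.1 hy)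
  · simpa only [neg_neg] using this
  · have h1 := h.pde x (-y)
    simp only [nl, smul_eq_mul] at h1
    linarith
  · have h1 := h.abs_le_of_le_neg hδ0 hδ hK hx hy
    have h2 : U x (-y) ^ 2 ≤ 0.0121 := by
      rw [← sq_abs]; nlinarith [abs_nonneg (U x (-y))]
    have h3 := abs_le.1 hμ
    have h4 := sq_nonneg (U x (-y))
    have h5 : U x (-y) ^ 4 = (U x (-y) ^ 2) ^ 2 := by ring
    rw [h5]
    constructor <;> nlinarith
  · have hc : 0 ≤ Real.cos x := Real.cos_nonneg_of_mem_Icc (abs_le.1 hx)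
    exact (mul_le_mul_of_nonneg_right hbK hc).trans (h.lower_bounds hx (-K)).1

lemma deriv_pos_of_lower_bound {b y : ℝ} (hb : 0 < b)
    (hU : ∀ x, |x| ≤ Real.pi / 2 → b * Real.cos x ≤ U x y) : 0 < Ux (-(Real.pi / 2)) y := by
  have h1 := ((h.hasDerivAt_U (-(Real.pi / 2)) y).sub
    ((Real.hasDerivAt_cos (-(Real.pi / 2))).const_mul b)).hasDerivWithinAt
    (s := Set.Ioi (-(Real.pi / 2)))
  rw [Real.sin_neg, Real.sin_pi_div_two, hasDerivWithinAt_iff_tendsto_slope' (by simp)] at h1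
  have hpi := Real.pi_pos
  have h2 : 0 ≤ Ux (-(Real.pi / 2)) y - b * (- -1) := by
    refine ge_of_tendsto h1 ?_
    filter_upwards [Ioc_mem_nhdsGT (show -(Real.pi / 2) < Real.pi / 2 by linarith)] with x hx
    have h3 := hU x (abs_le.2 ⟨hx.1.le, hx.2⟩)
    rw [slope_def_field]
    refine div_nonneg ?_ (by linarith [hx.1])
    simp only [Pi.sub_apply]
    have hc : Real.cos (-(Real.pi / 2)) = 0 := by rw [Real.cos_neg, Real.cos_pi_div_two]
    rw [(h.eq_zero hc y).1, hc]
    linarith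
  linarith

end IsApproxSol

theorem exists_monotone_isApproxSol : ∃ ε > 0, ∃ μ δ : ℝ, ∃ U Ux Uxx V Vx Vxx W WY,
    IsApproxSol ε μ δ U Ux Uxx V Vx Vxx W WY ∧ (∀ x y, |x| < Real.pi / 2 → 0 < V x y) ∧
      ∀ y, 0 < Ux (-(Real.pi / 2)) y := by
  obtain ⟨K, hK0, hK1, hK2⟩ : ∃ K : ℝ, 0 ≤ K ∧ 0.999 ≤ prof K ∧ prof (-K) ≤ 0.1 := by
    have h1 := tendsto_prof_atTop.eventually (Ici_mem_nhds (show (0.999:ℝ) < 1 by norm_num))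
    have h2 := (tendsto_prof_atBot.comp Filter.tendsto_neg_atTop_atBot).eventually
      (Iic_mem_nhds (show (0:ℝ) < 0.1 by norm_num))
    obtain ⟨K, hK⟩ := ((h1.and h2).and (Filter.eventually_ge_atTop 0)).exists
    exact ⟨K, hK.2, hK.1.1, hK.1.2⟩
  set a := prof (-K) with ha
  have ha0 : 0 < a := prof_pos _
  set d := a * (1 - prof K ^ 2) with hd
  have hpK := prof_lt_one K
  have hpK0 := prof_pos K
  have hd0 : 0 < d := mul_pos ha0 (by nlinarith)
  have hda : d ≤ a := by rw [hd]; nlinarith [sq_nonneg (prof K)]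
  have hdp : ∀ y, -K ≤ y → y ≤ K → d ≤ profD y := fun y h1 h2 => by
    have h3 := strictMono_prof.monotone h1
    have h4 := strictMono_prof.monotone h2
    have h5 := prof_pos y
    rw [hd, profD]
    have h6 : prof y ^ 2 ≤ prof K ^ 2 := by gcongr
    have h7 : 0 ≤ 1 - prof K ^ 2 := by nlinarith
    exact mul_le_mul h3 (by linarith) h7 h5.le
  set δ := min 0.001 (d / 2) with hδ
  have hδ0 : 0 < δ := lt_min (by norm_num) (by positivity)
  have hδ1 : δ ≤ 0.001 := min_le_left _ _
  have hδ2 : δ ≤ d / 2 := min_le_right _ _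
  obtain ⟨ε, hε, μ, hεδ, hμ, U, Ux, Uxx, V, Vx, Vxx, W, WY, h⟩ :=
    CosSeries.exists_isApproxSol hδ0
  have hε1 := hεδ.trans hδ1
  have hμ1 := hμ.trans hδ1
  refine ⟨ε, hε, μ, δ, U, Ux, Uxx, V, Vx, Vxx, W, WY, h, fun x y hx => ?_, fun y => ?_⟩
  · rcases le_total K y with hy | hy
    · refine h.deriv_pos_right (b := d / 2) hε hε1 hδ1 hμ1 hK1 (by positivity) ?_ hx hy
      have := hdp K (by linarith) le_rfl
      linarith
    · rcases le_total y (-K) with hy' | hy'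
      · refine h.deriv_pos_left (b := d / 2) hε hε1 hδ0.le hδ1 hμ1 hK2 (by positivity) ?_ hx hy'
        have := hdp (-K) le_rfl (by linarith)
        linarith
      · have h1 := hdp y hy' hy
        exact lt_of_lt_of_le (mul_pos (by linarith) (Real.cos_pos_of_mem_Ioo (abs_lt.1 hx)))
          (h.lower_bounds hx.le y).2.1
  · rcases le_total y (-K) with hy | hy
    · refine h.deriv_pos_of_lower_bound (b := a / 2 * Real.exp (-10 * (-y - K)))
        (by have := Real.exp_pos (-10 * (-y - K)); positivity)
        fun x hx => h.lower_bound_left hε hε1 hδ0.le hδ1 hμ1 hK2 (by positivity) (by linarith) hx hy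
    · refine h.deriv_pos_of_lower_bound (b := prof y - δ) ?_ fun x hx => (h.lower_bounds hx y).1
      have : a ≤ prof y := strictMono_prof.monotone hy
      linarith

end

lemma pd1_eq_of_hasDerivAt {F : ℝ × ℝ → ℝ} {p : ℝ × ℝ} {c : ℝ} (hF : DifferentiableAt ℝ F p)
    (h : HasDerivAt (fun t => F (t, p.2)) c p.1) : pd1 F p = c :=
  (hF.hasFDerivAt.comp_hasDerivAt p.1
    ((hasDerivAt_id p.1).prodMk (hasDerivAt_const p.1 p.2))).unique h

lemma pd2_eq_of_hasDerivAt {F : ℝ × ℝ → ℝ} {p : ℝ × ℝ} {c : ℝ} (hF : DifferentiableAt ℝ F p)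
    (h : HasDerivAt (fun t => F (p.1, t)) c p.2) : pd2 F p = c :=
  (hF.hasFDerivAt.comp_hasDerivAt p.2
    ((hasDerivAt_const p.2 p.1).prodMk (hasDerivAt_id p.2))).unique h

lemma differentiable_fderiv_apply {F : ℝ × ℝ → ℝ} (hF : ContDiff ℝ (⊤ : ℕ∞) F) (v : ℝ × ℝ) :
    Differentiable ℝ fun p => fderiv ℝ F p v :=
  ((hF.fderiv_right (m := 1) (by norm_cast)).clm_apply contDiff_const).differentiable
    (by simp)

namespace IsApproxSol

variable {ε μ δ : ℝ} {U Ux Uxx V Vx Vxx W WY : ℝ → ℝ → ℝ}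
  (h : IsApproxSol ε μ δ U Ux Uxx V Vx Vxx W WY)
include h

lemma deriv_add_pi (x y : ℝ) : Ux (x + Real.pi) y = -Ux x y ∧ V (x + Real.pi) y = -V x y := by
  constructor
  · refine ((h.hasDerivAt_U (x + Real.pi) y).comp_add_const x Real.pi).unique ?_
    rw [funext fun x => h.add_pi x y]
    exact (h.hasDerivAt_U x y).neg
  · refine (h.hasDerivAt_U' (x + Real.pi) y).unique ?_
    rw [funext fun y => h.add_pi x y]
    exact (h.hasDerivAt_U' x y).neg

lemma grad_ne_zero (hV : ∀ x y, |x| < Real.pi / 2 → 0 < V x y)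
    (hUx : ∀ y, 0 < Ux (-(Real.pi / 2)) y) (x y : ℝ) : Ux x y ≠ 0 ∨ V x y ≠ 0 := by
  have hper : Function.Periodic (fun x => Ux x y ^ 2 + V x y ^ 2) Real.pi := fun x => by
    simp only [(h.deriv_add_pi x y).1, (h.deriv_add_pi x y).2, neg_sq]
  obtain ⟨x', hx', he⟩ := hper.exists_mem_Ico Real.pi_pos x (-(Real.pi / 2))
  have hpos : 0 < Ux x' y ^ 2 + V x' y ^ 2 := by
    rcases hx'.1.eq_or_lt with h1 | h1
    · have := hUx y
      rw [← h1]; positivity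
    · have := hV x' y (abs_lt.2 ⟨h1, by linarith [hx'.2]⟩)
      positivity
  rw [← he] at hpos
  by_contra! h0
  simp [h0.1, h0.2] at hpos

lemma hasDerivAt_rescaled (p : ℝ × ℝ) :
    HasDerivAt (fun t => U (t - Real.pi / 2) (ε * p.2)) (Ux (p.1 - Real.pi / 2) (ε * p.2)) p.1 ∧
    HasDerivAt (fun t => Ux (t - Real.pi / 2) (ε * p.2)) (Uxx (p.1 - Real.pi / 2) (ε * p.2)) p.1 ∧
    HasDerivAt (fun t => U (p.1 - Real.pi / 2) (ε * t)) (ε * V (p.1 - Real.pi / 2) (ε * p.2)) p.2 ∧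
    HasDerivAt (fun t => ε * V (p.1 - Real.pi / 2) (ε * t))
      (ε ^ 2 * W (p.1 - Real.pi / 2) (ε * p.2)) p.2 := by
  have hm : HasDerivAt (fun t : ℝ => ε * t) ε p.2 :=
    ((hasDerivAt_id p.2).const_mul ε).congr_deriv (mul_one ε)
  refine ⟨(h.hasDerivAt_U _ _).comp_sub_const _ _, (h.hasDerivAt_Ux _ _).comp_sub_const _ _,
    ((h.hasDerivAt_U' _ _).comp p.2 hm).congr_deriv (mul_comm _ _),
    (((h.hasDerivAt_V' _ _).comp p.2 hm).const_mul ε).congr_deriv (by ring)⟩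

end IsApproxSol

/-- there are a smooth odd `f` and a bounded smooth solution of `-Δu = f(u)` in
the half-plane `(0,∞) × ℝ`, vanishing on `{0} × ℝ`, with bounded and nowhere vanishing
gradient on the closed half-plane, which is not one-dimensional. -/
theorem halfplane_solution_no_critical_points :
    ∃ f : ℝ → ℝ, ∃ u : ℝ × ℝ → ℝ,
      ContDiff ℝ (⊤ : ℕ∞) f ∧ (∀ t : ℝ, f (-t) = -f t) ∧
      ContDiffOn ℝ (⊤ : ℕ∞) u (Set.Ici (0:ℝ) ×ˢ (Set.univ : Set ℝ)) ∧
      (∃ M : ℝ, ∀ p ∈ Set.Ici (0:ℝ) ×ˢ (Set.univ : Set ℝ), |u p| ≤ M) ∧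
      (∀ p ∈ Set.Ioi (0:ℝ) ×ˢ (Set.univ : Set ℝ), -lap2 u p = f (u p)) ∧
      (∀ x₂ : ℝ, u (0, x₂) = 0) ∧
      (∃ M : ℝ, ∀ p ∈ Set.Ici (0:ℝ) ×ˢ (Set.univ : Set ℝ), ‖grad2 u p‖ ≤ M) ∧
      (∀ p ∈ Set.Ici (0:ℝ) ×ˢ (Set.univ : Set ℝ), grad2 u p ≠ 0) ∧
      ¬ ∃ e : ℝ × ℝ, ‖e‖ = 1 ∧ ∃ g : ℝ → ℝ,
        ∀ p ∈ Set.Ici (0:ℝ) ×ˢ (Set.univ : Set ℝ), u p = g (p.1 * e.1 + p.2 * e.2) := by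
  obtain ⟨ε, hε, μ, δ, U, Ux, Uxx, V, Vx, Vxx, W, WY, h, hV, hUx⟩ := exists_monotone_isApproxSol
  obtain ⟨M, hM⟩ := h.bound
  set u : ℝ × ℝ → ℝ := fun p => U (p.1 - Real.pi / 2) (ε * p.2) with hu
  have hus : ContDiff ℝ (⊤ : ℕ∞) u :=
    h.smooth.comp ((contDiff_fst.sub contDiff_const).prodMk (contDiff_const.mul contDiff_snd))
  have h1 : pd1 u = fun p => Ux (p.1 - Real.pi / 2) (ε * p.2) := funext fun p =>
    pd1_eq_of_hasDerivAt (hus.differentiable (by simp) p) (h.hasDerivAt_rescaled p).1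
  have h2 : pd2 u = fun p => ε * V (p.1 - Real.pi / 2) (ε * p.2) := funext fun p =>
    pd2_eq_of_hasDerivAt (hus.differentiable (by simp) p) (h.hasDerivAt_rescaled p).2.2.1
  have hlap : ∀ p, lap2 u p =
      Uxx (p.1 - Real.pi / 2) (ε * p.2) + ε ^ 2 * W (p.1 - Real.pi / 2) (ε * p.2) := fun p => by
    have d1 : DifferentiableAt ℝ (pd1 u) p := differentiable_fderiv_apply hus _ p
    have d2 : DifferentiableAt ℝ (pd2 u) p := differentiable_fderiv_apply hus _ p
    refine congrArg₂ (· + ·) (pd1_eq_of_hasDerivAt d1 ?_) (pd2_eq_of_hasDerivAt d2 ?_)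
    · rw [h1]; exact (h.hasDerivAt_rescaled p).2.1
    · rw [h2]; exact (h.hasDerivAt_rescaled p).2.2.2
  have hzero : ∀ y, u (0, y) = 0 := fun y =>
    (h.eq_zero (by rw [zero_sub, Real.cos_neg, Real.cos_pi_div_two]) _).1
  refine ⟨fun t => t + ε ^ 2 * nl μ t, u, ?_, fun t => ?_, hus.contDiffOn, ⟨M, fun p _ => (hM _ _).1⟩,
    fun p _ => ?_, hzero, ⟨max M (ε * M), fun p _ => ?_⟩, fun p _ h0 => ?_, ?_⟩
  · simp only [nl, smul_eq_mul]
    fun_prop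
  · simp only [nl, smul_eq_mul]
    ring
  · have := h.pde (p.1 - Real.pi / 2) (ε * p.2)
    rw [hlap]
    linarith
  · rw [grad2, h1, h2, Prod.norm_def]
    refine max_le_max (hM _ _).2.1 ?_
    rw [norm_mul, Real.norm_of_nonneg hε.le]
    exact mul_le_mul_of_nonneg_left (hM _ _).2.2 hε.le
  · rw [grad2, h1, h2, Prod.mk_eq_zero, mul_eq_zero, or_iff_right hε.ne'] at h0
    exact (h.grad_ne_zero hV hUx _ _).elim (fun h3 => h3 h0.1) fun h3 => h3 h0.2
  · rintro ⟨e, he, g, hg⟩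
    have hconst : ∀ y, u (Real.pi / 2, y) = u (Real.pi / 2, 0) := by
      intro y
      have hp : ∀ y, u (Real.pi / 2, y) = g (Real.pi / 2 * e.1 + y * e.2) := fun y =>
        hg (Real.pi / 2, y) ⟨(div_nonneg Real.pi_pos.le zero_le_two : (0:ℝ) ≤ Real.pi / 2), trivial⟩
      rw [hp, hp]
      by_cases h2 : e.2 = 0
      · rw [h2, mul_zero, mul_zero]
      · have hg0 : ∀ t, g t = 0 := fun t => by
          have h3 := hg (0, t / e.2) ⟨le_refl (0:ℝ), trivial⟩
          rw [hzero] at h3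
          simpa [div_mul_cancel₀ _ h2] using h3.symm
        rw [hg0, hg0]
    have h3 := (h.hasDerivAt_rescaled (Real.pi / 2, 0)).2.2.1
    have h4 := h3.unique ((hasDerivAt_const (0:ℝ) (u (Real.pi / 2, 0))).congr_of_eventuallyEq
      (Filter.Eventually.of_forall hconst))
    have h5 := hV (Real.pi / 2 - Real.pi / 2) (ε * 0) (by rw [sub_self, abs_zero]; positivity)
    exact (mul_pos hε h5).ne' h4
end

section
/- Let f : ℝ → ℝ be a smooth odd function and let u : [0,1] × ℝ → ℝ be smooth with −Δu = f(u) in (0,1) × ℝ and u(0, x₂) = u(1, x₂) = 0 for all x₂ ∈ ℝ. Let v : ℝ² → ℝ be the unique function that is 2-periodic in x₁, agrees with u on [0,1] × ℝ, and satisfies v(x₁, x₂) = −u(2 − x₁, x₂) for x₁ ∈ [1,2]. Then v is smooth on ℝ² and −Δv = f(v) everywhere in ℝ². -/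
open MeasureTheory

section Gluing

open Set Filter Topology
open scoped ContDiff

section PartialDerivatives

variable {w g : ℝ × ℝ → ℝ} {p : ℝ × ℝ}

lemma lap2_congr_of_eventuallyEq (h : w =ᶠ[𝓝 p] g) : lap2 w p = lap2 g p := by
  have h1 : pd1 w =ᶠ[𝓝 p] pd1 g :=
    h.eventuallyEq_nhds.mono fun q hq => by simp only [pd1, hq.fderiv_eq]
  have h2 : pd2 w =ᶠ[𝓝 p] pd2 g :=
    h.eventuallyEq_nhds.mono fun q hq => by simp only [pd2, hq.fderiv_eq]
  simp only [lap2, h1.fderiv_eq, h2.fderiv_eq]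

lemma fderiv_apply_fderiv_comm (hw : ContDiffAt ℝ 2 w p) (e e' : ℝ × ℝ) :
    fderiv ℝ (fun q => fderiv ℝ w q e) p e' = fderiv ℝ (fun q => fderiv ℝ w q e') p e := by
  have hd : DifferentiableAt ℝ (fderiv ℝ w) p :=
    (hw.fderiv_right (m := 1) (by norm_num)).differentiableAt (by norm_num)
  have key (e e' : ℝ × ℝ) :
      fderiv ℝ (fun q => fderiv ℝ w q e) p e' = fderiv ℝ (fderiv ℝ w) p e' e := by
    rw [(hd.hasFDerivAt.clm_apply (hasFDerivAt_const e p)).fderiv]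
    simp
  rw [key, key, (hw.isSymmSndFDerivAt (by simp)).eq]

lemma fderivWithin_apply_fderivWithin_comm {A : Set (ℝ × ℝ)} (hA : UniqueDiffOn ℝ A)
    (hw : ContDiffOn ℝ ∞ w A) (hp : p ∈ A) (hpc : p ∈ closure (interior A)) (e e' : ℝ × ℝ) :
    fderivWithin ℝ (fun q => fderivWithin ℝ w A q e) A p e' =
      fderivWithin ℝ (fun q => fderivWithin ℝ w A q e') A p e := by
  have hd : DifferentiableWithinAt ℝ (fderivWithin ℝ w A) A p :=
    ((hw.fderivWithin hA (m := ∞) (by simp)).differentiableOn (by simp)) p hp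
  have key (e e' : ℝ × ℝ) : fderivWithin ℝ (fun q => fderivWithin ℝ w A q e) A p e' =
      fderivWithin ℝ (fderivWithin ℝ w A) A p e' e := by
    rw [(hd.hasFDerivWithinAt.clm_apply (hasFDerivWithinAt_const e p A)).fderivWithin (hA p hp)]
    simp
  rw [key, key, ((hw p hp).isSymmSndFDerivWithinAt (by simp; norm_cast) hA hpc hp).eq]

lemma contDiff_succ_of_partial {n : ℕ} (hw : Differentiable ℝ w) (h1 : ContDiff ℝ n (pd1 w))
    (h2 : ContDiff ℝ n (pd2 w)) : ContDiff ℝ (n + 1) w := by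
  refine contDiff_succ_iff_fderiv.2 ⟨hw, by simp, contDiff_clm_apply_iff.2 fun y => ?_⟩
  have : (fun x => fderiv ℝ w x y) = fun x => y.1 * pd1 w x + y.2 * pd2 w x := by
    funext x
    have hy : y = y.1 • ((1 : ℝ), (0 : ℝ)) + y.2 • ((0 : ℝ), (1 : ℝ)) := by ext <;> simp
    conv_lhs => rw [hy, map_add, map_smul, map_smul]
    rfl
  rw [this]
  fun_prop

/-- Reflections and translations in the first coordinate, and rescalings of the values, commute
with the Laplacian. -/
lemma lap2_affine {s e c : ℝ} (he : e * e = 1) (hw : ContDiffAt ℝ 2 w (e * p.1 + c, p.2)) :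
    lap2 (fun q => s * w (e * q.1 + c, q.2)) p = s * lap2 w (e * p.1 + c, p.2) := by
  set φ : ℝ × ℝ → ℝ × ℝ := fun q => (e * q.1 + c, q.2) with hφ
  have hφd (q : ℝ × ℝ) : HasFDerivAt φ
      ((e • ContinuousLinearMap.fst ℝ ℝ ℝ).prod (ContinuousLinearMap.snd ℝ ℝ ℝ)) q :=
    ((hasFDerivAt_fst.const_mul e).add_const c).prodMk hasFDerivAt_snd
  have hcomp {g : ℝ × ℝ → ℝ} {q : ℝ × ℝ} (r : ℝ) (hg : DifferentiableAt ℝ g (φ q)) :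
      fderiv ℝ (fun q => r * g (φ q)) q (1, 0) = r * e * pd1 g (φ q) ∧
      fderiv ℝ (fun q => r * g (φ q)) q (0, 1) = r * pd2 g (φ q) := by
    have h := (hg.hasFDerivAt.comp q (hφd q)).const_mul r
    have he0 : ((e, 0) : ℝ × ℝ) = e • ((1 : ℝ), (0 : ℝ)) := by simp
    constructor
    · refine (congrArg (· ((1 : ℝ), (0 : ℝ))) h.fderiv).trans ?_
      simp [he0, -Prod.smul_mk, pd1, mul_assoc]
    · refine (congrArg (· ((0 : ℝ), (1 : ℝ))) h.fderiv).trans ?_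
      simp [pd2]
  have hev : ∀ᶠ q in 𝓝 p, DifferentiableAt ℝ w (φ q) :=
    (hφd p).continuousAt.eventually
      ((hw.eventually (by simp)).mono fun q hq => hq.differentiableAt (by simp))
  have hpd (d : ℝ × ℝ) : DifferentiableAt ℝ (fun q => fderiv ℝ w q d) (φ p) :=
    ((hw.fderiv_right (m := 1) (by norm_num)).clm_apply contDiffAt_const).differentiableAt
      (by simp)
  have h1 : pd1 (fun q => s * w (φ q)) =ᶠ[𝓝 p] fun q => s * e * pd1 w (φ q) :=
    hev.mono fun q hq => (hcomp s hq).1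
  have h2 : pd2 (fun q => s * w (φ q)) =ᶠ[𝓝 p] fun q => s * pd2 w (φ q) :=
    hev.mono fun q hq => (hcomp s hq).2
  change lap2 (fun q => s * w (φ q)) p = s * lap2 w (φ p)
  rw [lap2, h1.fderiv_eq, h2.fderiv_eq, (hcomp (g := pd1 w) (s * e) (hpd _)).1,
    (hcomp (g := pd2 w) s (hpd _)).2, mul_assoc s e e, he]
  simp only [lap2, pd1, pd2]
  ring

end PartialDerivatives

/-- Two closed sets covering the plane, overlapping in a union of vertical lines, across which
functions are glued. -/
structure IsVerticalGluing (A B : Set (ℝ × ℝ)) : Prop where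
  isClosed_left : IsClosed A
  isClosed_right : IsClosed B
  union_eq : A ∪ B = univ
  uniqueDiffOn_left : UniqueDiffOn ℝ A
  uniqueDiffOn_right : UniqueDiffOn ℝ B
  subset_closure_left : A ⊆ closure Bᶜ
  subset_closure_right : B ⊆ closure Aᶜ
  vertical : ∀ p ∈ A ∩ B, ∀ t : ℝ, p + t • ((0 : ℝ), (1 : ℝ)) ∈ A ∩ B

/-- Smoothness, up to the boundary, on each of the two pieces. -/
def PiecewiseSmooth (A B : Set (ℝ × ℝ)) (w : ℝ × ℝ → ℝ) : Prop :=
  ContDiffOn ℝ ∞ w A ∧ ContDiffOn ℝ ∞ w B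

namespace IsVerticalGluing

variable {A B : Set (ℝ × ℝ)} {w G : ℝ × ℝ → ℝ} {p : ℝ × ℝ}

lemma symm (h : IsVerticalGluing A B) : IsVerticalGluing B A where
  isClosed_left := h.isClosed_right
  isClosed_right := h.isClosed_left
  union_eq := by rw [union_comm, h.union_eq]
  uniqueDiffOn_left := h.uniqueDiffOn_right
  uniqueDiffOn_right := h.uniqueDiffOn_left
  subset_closure_left := h.subset_closure_right
  subset_closure_right := h.subset_closure_left
  vertical := by rw [inter_comm]; exact h.vertical

lemma compl_subset_interior (h : IsVerticalGluing A B) : Bᶜ ⊆ interior A :=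
  interior_maximal (compl_subset_iff_union.2 (by rw [union_comm, h.union_eq]))
    h.isClosed_right.isOpen_compl

lemma mem_closure_interior (h : IsVerticalGluing A B) (hp : p ∈ A) : p ∈ closure (interior A) :=
  closure_mono h.compl_subset_interior (h.subset_closure_left hp)

lemma contDiffAt_left (h : IsVerticalGluing A B) (hw : PiecewiseSmooth A B w) (hp : p ∉ B) :
    ContDiffAt ℝ ∞ w p :=
  hw.1.contDiffAt (mem_interior_iff_mem_nhds.1 (h.compl_subset_interior hp))

lemma contDiffAt (h : IsVerticalGluing A B) (hw : PiecewiseSmooth A B w) (hp : p ∉ A ∩ B) :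
    ContDiffAt ℝ ∞ w p := by
  by_cases hB : p ∈ B
  · exact h.symm.contDiffAt_left hw.symm fun hA => hp ⟨hA, hB⟩
  · exact h.contDiffAt_left hw hB

lemma continuous (h : IsVerticalGluing A B) (hw : PiecewiseSmooth A B w) : Continuous w := by
  rw [← continuousOn_univ, ← h.union_eq]
  exact hw.1.continuousOn.union_of_isClosed hw.2.continuousOn h.isClosed_left h.isClosed_right

lemma fderivWithin_vertical_eq (h : IsVerticalGluing A B) (hw : PiecewiseSmooth A B w)
    (hp : p ∈ A ∩ B) : fderivWithin ℝ w A p (0, 1) = fderivWithin ℝ w B p (0, 1) := by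
  have key {S : Set (ℝ × ℝ)} (hS : ContDiffOn ℝ ∞ w S) (hpS : p ∈ S)
      (hv : ∀ t : ℝ, p + t • ((0 : ℝ), (1 : ℝ)) ∈ S) :
      HasDerivAt (fun t : ℝ => w (p + t • ((0 : ℝ), (1 : ℝ)))) (fderivWithin ℝ w S p (0, 1)) 0 := by
    have hl : HasDerivAt (fun t : ℝ => p + t • ((0 : ℝ), (1 : ℝ))) ((0 : ℝ), (1 : ℝ)) 0 := by
      simpa using ((hasDerivAt_id (0 : ℝ)).smul_const ((0 : ℝ), (1 : ℝ))).const_add p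
    have hd : HasFDerivWithinAt w (fderivWithin ℝ w S p) S (p + (0 : ℝ) • ((0 : ℝ), (1 : ℝ))) := by
      simpa using (hS.differentiableOn (by simp) p hpS).hasFDerivWithinAt
    rw [← hasDerivWithinAt_univ] at hl ⊢
    exact hd.comp_hasDerivWithinAt 0 hl fun t _ => hv t
  exact (key hw.1 hp.1 fun t => (h.vertical p hp t).1).unique
    (key hw.2 hp.2 fun t => (h.vertical p hp t).2)

/-- A piecewise smooth function whose one-sided normal derivatives agree is differentiable. -/
lemma differentiable (h : IsVerticalGluing A B) (hw : PiecewiseSmooth A B w)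
    (hn : ∀ p ∈ A ∩ B, fderivWithin ℝ w A p (1, 0) = fderivWithin ℝ w B p (1, 0)) :
    Differentiable ℝ w := by
  intro p
  by_cases hp : p ∈ A ∩ B
  · have heq : fderivWithin ℝ w A p = fderivWithin ℝ w B p := by
      ext
      · simpa using hn p hp
      · simpa using h.fderivWithin_vertical_eq hw hp
    have hA := (hw.1.differentiableOn (by simp) p hp.1).hasFDerivWithinAt
    have hB := (hw.2.differentiableOn (by simp) p hp.2).hasFDerivWithinAt
    rw [← heq] at hB
    have hU := hA.union hB
    rw [h.union_eq, hasFDerivWithinAt_univ] at hU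
    exact hU.differentiableAt
  · exact (h.contDiffAt hw hp).differentiableAt (by simp)

lemma contDiffOn_fderiv_apply (h : IsVerticalGluing A B) (hw : PiecewiseSmooth A B w)
    (hd : Differentiable ℝ w) (e : ℝ × ℝ) : ContDiffOn ℝ ∞ (fun q => fderiv ℝ w q e) A :=
  ((hw.1.fderivWithin h.uniqueDiffOn_left (m := ∞) (by simp)).clm_apply contDiffOn_const).congr
    fun q hq => by rw [(hd q).fderivWithin (h.uniqueDiffOn_left q hq)]

lemma piecewiseSmooth_fderiv_apply (h : IsVerticalGluing A B) (hw : PiecewiseSmooth A B w)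
    (hd : Differentiable ℝ w) (e : ℝ × ℝ) : PiecewiseSmooth A B (fun q => fderiv ℝ w q e) :=
  ⟨h.contDiffOn_fderiv_apply hw hd e, h.symm.contDiffOn_fderiv_apply hw.symm hd e⟩

lemma fderivWithin_pd2_eq (h : IsVerticalGluing A B) (hw : PiecewiseSmooth A B w)
    (hd : Differentiable ℝ w) (hp : p ∈ A) :
    fderivWithin ℝ (pd2 w) A p (1, 0) = fderivWithin ℝ (pd1 w) A p (0, 1) := by
  have hE (e : ℝ × ℝ) : EqOn (fun q => fderiv ℝ w q e) (fun q => fderivWithin ℝ w A q e) A :=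
    fun q hq => by simp only [(hd q).fderivWithin (h.uniqueDiffOn_left q hq)]
  change fderivWithin ℝ (fun q => fderiv ℝ w q (0, 1)) A p (1, 0) =
    fderivWithin ℝ (fun q => fderiv ℝ w q (1, 0)) A p (0, 1)
  rw [fderivWithin_congr (hE _) (hE _ hp), fderivWithin_congr (hE _) (hE _ hp)]
  exact fderivWithin_apply_fderivWithin_comm h.uniqueDiffOn_left hw.1 hp
    (h.mem_closure_interior hp) _ _

/-- The equation `Δw = G` extends, one-sidedly, to the interface. -/
lemma fderivWithin_pd1_add_fderivWithin_pd2 (h : IsVerticalGluing A B)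
    (hw : PiecewiseSmooth A B w) (hd : Differentiable ℝ w) (hG : ContinuousOn G A)
    (hlap : ∀ p ∉ A ∩ B, lap2 w p = G p) (hp : p ∈ A) :
    fderivWithin ℝ (pd1 w) A p (1, 0) + fderivWithin ℝ (pd2 w) A p (0, 1) = G p := by
  have hc (e : ℝ × ℝ) : ContinuousOn
      (fun p => fderivWithin ℝ (fun q => fderiv ℝ w q e) A p e) A :=
    ((h.contDiffOn_fderiv_apply hw hd e).continuousOn_fderivWithin h.uniqueDiffOn_left
      (by simp)).clm_apply continuousOn_const
  have hE : EqOn (fun p => fderivWithin ℝ (pd1 w) A p (1, 0) + fderivWithin ℝ (pd2 w) A p (0, 1))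
      G Bᶜ := by
    intro q hq
    have hn : A ∈ 𝓝 q := mem_interior_iff_mem_nhds.1 (h.compl_subset_interior hq)
    simp only [fderivWithin_of_mem_nhds hn]
    exact hlap q fun hq' => hq hq'.2
  exact hE.of_subset_closure ((hc (1, 0)).add (hc (0, 1))) hG
    (h.compl_subset_interior.trans interior_subset) h.subset_closure_left hp

lemma differentiable_pd2 (h : IsVerticalGluing A B) (hw : PiecewiseSmooth A B w)
    (hd : Differentiable ℝ w) : Differentiable ℝ (pd2 w) := by
  refine h.differentiable (h.piecewiseSmooth_fderiv_apply hw hd _) fun p hp => ?_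
  rw [h.fderivWithin_pd2_eq hw hd hp.1, h.symm.fderivWithin_pd2_eq hw.symm hd hp.2]
  exact h.fderivWithin_vertical_eq (h.piecewiseSmooth_fderiv_apply hw hd _) hp

lemma differentiable_pd1 (h : IsVerticalGluing A B) (hw : PiecewiseSmooth A B w)
    (hd : Differentiable ℝ w) (hG : Continuous G) (hlap : ∀ p ∉ A ∩ B, lap2 w p = G p) :
    Differentiable ℝ (pd1 w) := by
  refine h.differentiable (h.piecewiseSmooth_fderiv_apply hw hd _) fun p hp => ?_
  have hA := h.fderivWithin_pd1_add_fderivWithin_pd2 hw hd hG.continuousOn hlap hp.1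
  have hB := h.symm.fderivWithin_pd1_add_fderivWithin_pd2 hw.symm hd hG.continuousOn
    (by rwa [inter_comm]) hp.2
  have hv := h.fderivWithin_vertical_eq (w := pd2 w) (h.piecewiseSmooth_fderiv_apply hw hd _) hp
  linarith

lemma lap2_eq (h : IsVerticalGluing A B) (hw : PiecewiseSmooth A B w)
    (hd : Differentiable ℝ w) (hG : Continuous G) (hlap : ∀ p ∉ A ∩ B, lap2 w p = G p)
    (p : ℝ × ℝ) : lap2 w p = G p := by
  by_cases hp : p ∈ A ∩ B
  · rw [← h.fderivWithin_pd1_add_fderivWithin_pd2 hw hd hG.continuousOn hlap hp.1,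
      (h.differentiable_pd1 hw hd hG hlap p).fderivWithin (h.uniqueDiffOn_left p hp.1),
      (h.differentiable_pd2 hw hd p).fderivWithin (h.uniqueDiffOn_left p hp.1), lap2]
  · exact hlap p hp

lemma lap2_fderiv_apply (h : IsVerticalGluing A B) (hw : PiecewiseSmooth A B w)
    (hlap : ∀ p ∉ A ∩ B, lap2 w p = G p) (e : ℝ × ℝ) (hp : p ∉ A ∩ B) :
    lap2 (fun q => fderiv ℝ w q e) p = fderiv ℝ G p e := by
  have hopen : IsOpen (A ∩ B)ᶜ := (h.isClosed_left.inter h.isClosed_right).isOpen_compl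
  have hsm {q : ℝ × ℝ} (hq : q ∉ A ∩ B) (e : ℝ × ℝ) :
      ContDiffAt ℝ ∞ (fun q => fderiv ℝ w q e) q :=
    ((h.contDiffAt hw hq).fderiv_right (m := ∞) (by simp)).clm_apply contDiffAt_const
  have hcomm (d : ℝ × ℝ) : fderiv ℝ (fun q => fderiv ℝ (fun q => fderiv ℝ w q e) q d) p d =
      fderiv ℝ (fun q => fderiv ℝ (fun q => fderiv ℝ w q d) q d) p e := by
    have hE : (fun q => fderiv ℝ (fun q => fderiv ℝ w q e) q d) =ᶠ[𝓝 p]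
        fun q => fderiv ℝ (fun q => fderiv ℝ w q d) q e := by
      filter_upwards [hopen.mem_nhds hp] with q hq
      exact fderiv_apply_fderiv_comm ((h.contDiffAt hw hq).of_le (by norm_cast)) e d
    rw [hE.fderiv_eq]
    exact fderiv_apply_fderiv_comm ((hsm hp d).of_le (by norm_cast)) e d
  have hdiff (d : ℝ × ℝ) :
      DifferentiableAt ℝ (fun q => fderiv ℝ (fun q => fderiv ℝ w q d) q d) p :=
    (((hsm hp d).fderiv_right (m := ∞) (by simp)).clm_apply contDiffAt_const).differentiableAt
      (by simp)
  have hE : lap2 w =ᶠ[𝓝 p] G := by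
    filter_upwards [hopen.mem_nhds hp] with q hq using hlap q hq
  rw [← hE.fderiv_eq]
  change fderiv ℝ (fun q => fderiv ℝ (fun q => fderiv ℝ w q e) q (1, 0)) p (1, 0) +
    fderiv ℝ (fun q => fderiv ℝ (fun q => fderiv ℝ w q e) q (0, 1)) p (0, 1) = _
  rw [hcomm, hcomm]
  exact congrArg (· e) (fderiv_add (hdiff (1, 0)) (hdiff (0, 1))).symm

/-- Regularity across the interface for solutions of the Poisson equation `Δw = G`. -/
lemma contDiff_add_two (h : IsVerticalGluing A B) (n : ℕ) (hw : PiecewiseSmooth A B w)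
    (hd : Differentiable ℝ w) (hG : PiecewiseSmooth A B G) (hGn : ContDiff ℝ n G)
    (hlap : ∀ p ∉ A ∩ B, lap2 w p = G p) : ContDiff ℝ (n + 2 : ℕ) w := by
  induction n generalizing w G with
  | zero =>
    have hd1 := h.differentiable_pd1 hw hd hGn.continuous hlap
    have hd2 := h.differentiable_pd2 hw hd
    have key {g : ℝ × ℝ → ℝ} (hg : PiecewiseSmooth A B g) (hgd : Differentiable ℝ g) :
        ContDiff ℝ (1 : ℕ) g := by
      have := contDiff_succ_of_partial (n := 0) hgd
        (contDiff_zero.2 (h.continuous (h.piecewiseSmooth_fderiv_apply hg hgd _)))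
        (contDiff_zero.2 (h.continuous (h.piecewiseSmooth_fderiv_apply hg hgd _)))
      simpa using this
    exact contDiff_succ_of_partial (n := 1) hd
      (key (h.piecewiseSmooth_fderiv_apply hw hd _) hd1)
      (key (h.piecewiseSmooth_fderiv_apply hw hd _) hd2)
  | succ n ih =>
    have hGd : Differentiable ℝ G := hGn.differentiable (by simp)
    have key (e : ℝ × ℝ) (he : Differentiable ℝ (fun q => fderiv ℝ w q e)) :
        ContDiff ℝ (n + 2 : ℕ) (fun q => fderiv ℝ w q e) :=
      ih (h.piecewiseSmooth_fderiv_apply hw hd e) he (h.piecewiseSmooth_fderiv_apply hG hGd e)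
        ((hGn.fderiv_right (m := n) (by simp)).clm_apply contDiff_const)
        fun p hp => h.lap2_fderiv_apply hw hlap e hp
    exact contDiff_succ_of_partial (n := n + 2) hd
      (key _ (h.differentiable_pd1 hw hd hGn.continuous hlap))
      (key _ (h.differentiable_pd2 hw hd))

/-- Regularity across the interface for solutions of the semilinear equation `-Δw = f(w)`. -/
lemma contDiff_of_semilinear (h : IsVerticalGluing A B) {f : ℝ → ℝ} (hf : ContDiff ℝ ∞ f)
    (hw : PiecewiseSmooth A B w) (hd : Differentiable ℝ w)
    (hlap : ∀ p ∉ A ∩ B, lap2 w p = -f (w p)) : ContDiff ℝ ∞ w := by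
  refine contDiff_infty.2 fun n => ?_
  induction n with
  | zero => exact contDiff_zero.2 (h.continuous hw)
  | succ n ih =>
    have hG : PiecewiseSmooth A B (fun p => -f (w p)) :=
      ⟨(hf.comp_contDiffOn hw.1).neg, (hf.comp_contDiffOn hw.2).neg⟩
    exact (h.contDiff_add_two n hw hd hG ((contDiff_infty.1 hf n).comp ih).neg hlap).of_le
      (by norm_cast; omega)

end IsVerticalGluing

/-- The union of every other vertical strip of unit width, starting at abscissa `c`. -/
def verticalStrips (c : ℝ) : Set (ℝ × ℝ) :=
  {p | ∃ k : ℤ, 2 * (k : ℝ) + c ≤ p.1 ∧ p.1 ≤ 2 * k + c + 1}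

section VerticalStrips

variable {c : ℝ} {p : ℝ × ℝ}

lemma exists_of_notMem_verticalStrips (hp : p ∉ verticalStrips c) :
    ∃ k : ℤ, 2 * (k : ℝ) + c + 1 < p.1 ∧ p.1 < 2 * k + c + 2 := by
  have h1 := Int.floor_le ((p.1 - c) / 2)
  have h2 := Int.lt_floor_add_one ((p.1 - c) / 2)
  refine ⟨⌊(p.1 - c) / 2⌋, ?_, by linarith⟩
  by_contra! h
  exact hp ⟨⌊(p.1 - c) / 2⌋, by linarith, by linarith⟩

lemma notMem_verticalStrips {k : ℤ} (h1 : 2 * (k : ℝ) + c + 1 < p.1)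
    (h2 : p.1 < 2 * k + c + 2) : p ∉ verticalStrips c := by
  rintro ⟨j, hj1, hj2⟩
  have h3 : k < j := by exact_mod_cast (by linarith : (k : ℝ) < j)
  have h4 : j < k + 1 := by exact_mod_cast (by linarith : (j : ℝ) < k + 1)
  omega

lemma isClosed_verticalStrips : IsClosed (verticalStrips c) := by
  refine ⟨isOpen_iff_mem_nhds.2 fun p hp => ?_⟩
  obtain ⟨k, h1, h2⟩ := exists_of_notMem_verticalStrips hp
  filter_upwards [continuous_fst.continuousAt (Ioo_mem_nhds h1 h2)] with q hq
  exact notMem_verticalStrips hq.1 hq.2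

lemma mem_verticalStrips_of_mem_prod {k : ℤ}
    (hp : p ∈ Icc (2 * (k : ℝ) + c) (2 * k + c + 1) ×ˢ (univ : Set ℝ)) :
    p ∈ verticalStrips c :=
  ⟨k, hp.1.1, hp.1.2⟩

lemma uniqueDiffOn_verticalStrips : UniqueDiffOn ℝ (verticalStrips c) := by
  rintro p ⟨k, hp⟩
  exact (((uniqueDiffOn_Icc (by linarith)).prod uniqueDiffOn_univ) p ⟨hp, mem_univ _⟩).mono
    fun q hq => mem_verticalStrips_of_mem_prod hq

lemma verticalStrips_subset_closure {S : Set (ℝ × ℝ)}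
    (h : ∀ (k : ℤ) (p : ℝ × ℝ), 2 * (k : ℝ) + c < p.1 → p.1 < 2 * k + c + 1 → p ∈ S) :
    verticalStrips c ⊆ closure S := by
  rintro p ⟨k, hp⟩
  have hsub : Ioo (2 * (k : ℝ) + c) (2 * k + c + 1) ×ˢ (univ : Set ℝ) ⊆ S :=
    fun q hq => h k q hq.1.1 hq.1.2
  refine closure_mono hsub ?_
  rw [closure_prod_eq, closure_Ioo (by linarith)]
  exact ⟨hp, by simp⟩

lemma contDiffOn_verticalStrips {w : ℝ × ℝ → ℝ}
    (h : ∀ k : ℤ, ContDiffOn ℝ ∞ w (Icc (2 * (k : ℝ) + c) (2 * k + c + 1) ×ˢ univ)) :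
    ContDiffOn ℝ ∞ w (verticalStrips c) := by
  rintro p ⟨k, hp⟩
  refine (h k p ⟨hp, mem_univ _⟩).mono_of_mem_nhdsWithin ?_
  have hnhds : Prod.fst ⁻¹' Ioo (2 * (k : ℝ) + c - 1) (2 * k + c + 2) ∈ 𝓝 p :=
    continuous_fst.continuousAt (Ioo_mem_nhds (by linarith [hp.1]) (by linarith [hp.2]))
  filter_upwards [mem_nhdsWithin_of_mem_nhds hnhds, self_mem_nhdsWithin]
  rintro q ⟨h1, h2⟩ ⟨j, h3, h4⟩
  have h5 : k - 1 < j := by exact_mod_cast (by linarith : (k : ℝ) - 1 < j)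
  have h6 : j < k + 1 := by exact_mod_cast (by linarith : (j : ℝ) < k + 1)
  obtain rfl : j = k := by omega
  exact ⟨⟨h3, h4⟩, mem_univ _⟩

lemma isVerticalGluing_verticalStrips :
    IsVerticalGluing (verticalStrips 0) (verticalStrips 1) where
  isClosed_left := isClosed_verticalStrips
  isClosed_right := isClosed_verticalStrips
  union_eq := by
    refine eq_univ_of_forall fun p => or_iff_not_imp_left.2 fun hp => ?_
    obtain ⟨k, h1, h2⟩ := exists_of_notMem_verticalStrips hp
    exact ⟨k, by linarith, by linarith⟩
  uniqueDiffOn_left := uniqueDiffOn_verticalStrips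
  uniqueDiffOn_right := uniqueDiffOn_verticalStrips
  subset_closure_left := verticalStrips_subset_closure fun k p h1 h2 =>
    notMem_verticalStrips (k := k - 1) (by push_cast; linarith) (by push_cast; linarith)
  subset_closure_right := verticalStrips_subset_closure fun k p h1 h2 =>
    notMem_verticalStrips (k := k) (by linarith) (by linarith)
  vertical := by
    rintro p ⟨⟨j, hj⟩, ⟨k, hk⟩⟩ t
    exact ⟨⟨j, by simpa using hj⟩, ⟨k, by simpa using hk⟩⟩

lemma exists_int_of_mem_inter_verticalStrips (hp : p ∈ verticalStrips 0 ∩ verticalStrips 1) :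
    ∃ m : ℤ, p.1 = m := by
  obtain ⟨⟨k, hk1, hk2⟩, ⟨j, hj1, hj2⟩⟩ := hp
  have h1 : k ≤ j + 1 := by exact_mod_cast (by linarith : (k : ℝ) ≤ j + 1)
  have h2 : j ≤ k := by exact_mod_cast (by linarith : (j : ℝ) ≤ k)
  obtain rfl | rfl : k = j ∨ k = j + 1 := by omega
  · exact ⟨2 * k + 1, by push_cast; linarith⟩
  · refine ⟨2 * j + 2, ?_⟩
    push_cast at *
    linarith

lemma reflect_mem_verticalStrips (m : ℤ) (hp : p ∈ verticalStrips 0) :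
    ((2 * m - p.1, p.2) : ℝ × ℝ) ∈ verticalStrips 1 := by
  obtain ⟨k, h1, h2⟩ := hp
  exact ⟨m - k - 1, by push_cast; linarith, by push_cast; linarith⟩

/-- A piecewise smooth function that is odd about every interface line is differentiable. -/
lemma differentiable_of_odd {v : ℝ × ℝ → ℝ}
    (hv : PiecewiseSmooth (verticalStrips 0) (verticalStrips 1) v)
    (hodd : ∀ (m : ℤ) (x y : ℝ), v (2 * m - x, y) = -v (x, y)) : Differentiable ℝ v := by
  refine isVerticalGluing_verticalStrips.differentiable hv fun p hp => ?_
  obtain ⟨m, hm⟩ := exists_int_of_mem_inter_verticalStrips hp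
  set σ : ℝ × ℝ → ℝ × ℝ := fun q => (2 * m - q.1, q.2)
  have hσp : σ p = p := Prod.ext (by simp only [σ]; linarith) rfl
  have hσ : HasFDerivWithinAt σ
      ((-ContinuousLinearMap.fst ℝ ℝ ℝ).prod (ContinuousLinearMap.snd ℝ ℝ ℝ))
      (verticalStrips 0) p :=
    ((hasFDerivAt_fst.const_sub (2 * (m : ℝ))).prodMk hasFDerivAt_snd).hasFDerivWithinAt
  have hB : HasFDerivWithinAt v (fderivWithin ℝ v (verticalStrips 1) p) (verticalStrips 1)
      (σ p) := by
    rw [hσp]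
    exact (hv.2.differentiableOn (by simp) p hp.2).hasFDerivWithinAt
  have hA := (hB.comp p hσ fun q hq => reflect_mem_verticalStrips m hq).neg
  have hvσ : -(v ∘ σ) = v := by
    funext q
    simp [σ, hodd m q.1 q.2]
  rw [hvσ] at hA
  rw [hA.fderivWithin (uniqueDiffOn_verticalStrips p hp.1)]
  have hneg : ((-1, 0) : ℝ × ℝ) = -((1 : ℝ), (0 : ℝ)) := by simp
  simp [hneg, -Prod.neg_mk]

end VerticalStrips

end Gluing

/-- odd periodic reflection: if `u` is a smooth solution of `-Δu = f(u)` on the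
closed strip `[0,1] × ℝ` vanishing on both lateral boundaries, `f` smooth and odd, then the
2-periodic extension `v` of `u` obtained by odd reflection is smooth on `ℝ²` and solves
`-Δv = f(v)` everywhere. -/
theorem odd_reflection_is_entire_solution
    (f : ℝ → ℝ) (hf : ContDiff ℝ (⊤ : ℕ∞) f) (hodd : ∀ t : ℝ, f (-t) = -f t)
    (u : ℝ × ℝ → ℝ)
    (huC : ContDiffOn ℝ (⊤ : ℕ∞) u (Set.Icc (0:ℝ) 1 ×ˢ (Set.univ : Set ℝ)))
    (heq : ∀ p ∈ Set.Ioo (0:ℝ) 1 ×ˢ (Set.univ : Set ℝ), -lap2 u p = f (u p))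
    (hbd : ∀ x₂ : ℝ, u (0, x₂) = 0 ∧ u (1, x₂) = 0)
    (v : ℝ × ℝ → ℝ)
    (hper : ∀ x₁ x₂ : ℝ, v (x₁ + 2, x₂) = v (x₁, x₂))
    (hagree : ∀ x₁ ∈ Set.Icc (0:ℝ) 1, ∀ x₂ : ℝ, v (x₁, x₂) = u (x₁, x₂))
    (hrefl : ∀ x₁ ∈ Set.Icc (1:ℝ) 2, ∀ x₂ : ℝ, v (x₁, x₂) = -u (2 - x₁, x₂)) :
    ContDiff ℝ (⊤ : ℕ∞) v ∧ ∀ p : ℝ × ℝ, -lap2 v p = f (v p) := by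
  have hperZ (k : ℤ) (x y : ℝ) : v (x + 2 * k, y) = v (x, y) := by
    have h : Function.Periodic (fun x => v (x, y)) 2 := fun x => hper x y
    simpa [mul_comm] using h.int_mul k x
  have hA (k : ℤ) (x y : ℝ) (h1 : 2 * (k : ℝ) ≤ x) (h2 : x ≤ 2 * k + 1) :
      v (x, y) = u (x - 2 * k, y) := by
    rw [← hagree (x - 2 * k) ⟨by linarith, by linarith⟩ y, ← hperZ k (x - 2 * k), sub_add_cancel]
  have hB (k : ℤ) (x y : ℝ) (h1 : 2 * (k : ℝ) + 1 ≤ x) (h2 : x ≤ 2 * k + 2) :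
      v (x, y) = -u (2 - (x - 2 * k), y) := by
    rw [← hrefl (x - 2 * k) ⟨by linarith, by linarith⟩ y, ← hperZ k (x - 2 * k), sub_add_cancel]
  have hsymm (m : ℤ) (x y : ℝ) : v (2 * m - x, y) = -v (x, y) := by
    have h1 := Int.floor_le (x / 2)
    have h2 := Int.lt_floor_add_one (x / 2)
    set k := ⌊x / 2⌋
    rcases le_total x (2 * k + 1) with h | h
    · rw [hA k x y (by linarith) h,
        hB (m - k - 1) _ y (by push_cast; linarith) (by push_cast; linarith)]
      congr 3
      push_cast
      ring
    · rw [hB k x y h (by linarith),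
        hA (m - k - 1) _ y (by push_cast; linarith) (by push_cast; linarith), neg_neg]
      congr 2
      push_cast
      ring
  have hpw : PiecewiseSmooth (verticalStrips 0) (verticalStrips 1) v := by
    constructor
    · refine contDiffOn_verticalStrips fun k => ?_
      refine (huC.comp (g := u) (f := fun q : ℝ × ℝ => (q.1 - 2 * (k : ℝ), q.2))
        (by fun_prop) ?_).congr ?_
      · rintro q ⟨⟨h1, h2⟩, -⟩
        exact ⟨⟨by linarith, by linarith⟩, trivial⟩
      · rintro ⟨x, y⟩ ⟨⟨h1, h2⟩, -⟩
        exact hA k x y (by linarith) (by linarith)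
    · refine contDiffOn_verticalStrips fun k => ?_
      refine (huC.comp (g := u) (f := fun q : ℝ × ℝ => (2 - (q.1 - 2 * (k : ℝ)), q.2))
        (by fun_prop) ?_).neg.congr ?_
      · rintro q ⟨⟨h1, h2⟩, -⟩
        exact ⟨⟨by linarith, by linarith⟩, trivial⟩
      · rintro ⟨x, y⟩ ⟨⟨h1, h2⟩, -⟩
        exact hB k x y (by linarith) (by linarith)
  have hu {p : ℝ × ℝ} (h1 : 0 < p.1) (h2 : p.1 < 1) : ContDiffAt ℝ 2 u p :=
    (huC.contDiffAt (prod_mem_nhds (Icc_mem_nhds h1 h2) Filter.univ_mem)).of_le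
      (by norm_cast)
  have hlap : ∀ p ∉ verticalStrips 0 ∩ verticalStrips 1, lap2 v p = -f (v p) := by
    rintro ⟨x, y⟩ hp
    rcases not_and_or.1 hp with hp | hp
    · obtain ⟨k, h1, h2⟩ := exists_of_notMem_verticalStrips hp
      simp only [add_zero] at h1 h2
      have hE : v =ᶠ[nhds (x, y)] fun q => (-1) * u ((-1) * q.1 + (2 + 2 * k), q.2) := by
        filter_upwards [continuous_fst.continuousAt (Ioo_mem_nhds h1 h2)] with q hq
        rw [hB k q.1 q.2 hq.1.le hq.2.le, neg_one_mul]
        congr 3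
        ring
      rw [lap2_congr_of_eventuallyEq hE, hE.eq_of_nhds,
        lap2_affine (by norm_num) (hu (by linarith) (by linarith)), neg_one_mul,
        neg_one_mul (u _), hodd, neg_neg, heq _ ⟨⟨by linarith, by linarith⟩, trivial⟩]
    · obtain ⟨k, h1, h2⟩ := exists_of_notMem_verticalStrips hp
      have hE : v =ᶠ[nhds (x, y)] fun q => 1 * u (1 * q.1 + -(2 * (k + 1)), q.2) := by
        filter_upwards [continuous_fst.continuousAt (Ioo_mem_nhds h1 h2)] with q hq
        have h3 := hq.1
        have h4 := hq.2
        rw [hA (k + 1) q.1 q.2 (by push_cast; linarith) (by push_cast; linarith), one_mul]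
        congr 2
        push_cast
        ring
      rw [lap2_congr_of_eventuallyEq hE, hE.eq_of_nhds,
        lap2_affine (by norm_num) (hu (by linarith) (by linarith)), one_mul,
        one_mul (u _), ← heq _ ⟨⟨by linarith, by linarith⟩, trivial⟩, neg_neg]
  have hd := differentiable_of_odd hpw hsymm
  have hv := isVerticalGluing_verticalStrips.contDiff_of_semilinear hf hpw hd hlap
  refine ⟨hv, fun p => ?_⟩
  rw [isVerticalGluing_verticalStrips.lap2_eq hpw hd
    (hf.continuous.comp hv.continuous).neg hlap p]
  exact neg_neg _
end
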